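/- arXiv:1302.5008 — 2 statements merged into one kernel-verified Lean document; each statement's English description precedes it below -/
import Mathlib

section
/- The (non-normalized) Rauzy induction on exchanges of three intervals is ergodic with respect to Lebesgue measure: every measurable set A ⊆ ℝ₊³ × {1,2,3} with 𝓘⁻¹(A) = A satisfies μ(A) = 0 or μ((ℝ₊³ × {1,2,3}) ∖ A) = 0, where μ assigns to a set the sum over the three labels of the 3-dimensional Lebesgue measure of its slices. -/
open MeasureTheory

/-- The positive cone `ℝ₊³`. -/
def posCone3 : Set (ℝ × ℝ × ℝ) := {x | 0 ≤ x.1 ∧ 0 ≤ x.2.1 ∧ 0 ≤ x.2.2}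

/-- The (non-normalized) Rauzy induction for the Rauzy class on three letters,
with labels `0 = (231)`, `1 = (321)`, `2 = (312)`. -/
noncomputable def rauzy3 (q : (ℝ × ℝ × ℝ) × Fin 3) : (ℝ × ℝ × ℝ) × Fin 3 :=
  let x1 := q.1.1
  let x2 := q.1.2.1
  let x3 := q.1.2.2
  if q.2 = 0 then
    (if x1 ≤ x3 then ((x1, x2, x3 - x1), (0 : Fin 3)) else ((x1 - x3, x3, x2), (1 : Fin 3)))
  else if q.2 = 1 then
    (if x1 ≤ x3 then ((x1, x2, x3 - x1), (2 : Fin 3)) else ((x1 - x3, x3, x2), (0 : Fin 3)))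
  else
    (if x2 ≤ x3 then ((x1, x2, x3 - x2), (1 : Fin 3)) else ((x1, x2 - x3, x3), (2 : Fin 3)))


/-- The monoid of nonnegative integer matrices generated by the two elementary ones. -/
inductive EMon : ℝ → ℝ → ℝ → ℝ → Prop
  | one : EMon 1 0 0 1
  | L {a b c d : ℝ} : EMon a b c d → EMon (a + b) b (c + d) d
  | R {a b c d : ℝ} : EMon a b c d → EMon a (a + b) c (c + d)

lemma EMon.props {a b c d : ℝ} (h : EMon a b c d) :
    a * d - b * c = 1 ∧ 0 ≤ a ∧ 0 ≤ b ∧ 0 ≤ c ∧ 0 ≤ d ∧ 1 ≤ a + c ∧ 1 ≤ b + d := by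
  induction h with
  | one => norm_num
  | L h ih =>
    obtain ⟨h1, h2, h3, h4, h5, h6, h7⟩ := ih
    refine ⟨by linarith, ?_, ?_, ?_, ?_, ?_, ?_⟩ <;> linarith
  | R h ih =>
    obtain ⟨h1, h2, h3, h4, h5, h6, h7⟩ := ih
    refine ⟨by linarith, ?_, ?_, ?_, ?_, ?_, ?_⟩ <;> linarith

lemma EMon.iterL {a b c d : ℝ} (h : EMon a b c d) (k : ℕ) :
    EMon (a + k * b) b (c + k * d) d := by
  induction k with
  | zero => simpa using h
  | succ k ih =>
    have := ih.L
    convert this using 1 <;> push_cast <;> ring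

lemma EMon.iterR {a b c d : ℝ} (h : EMon a b c d) (k : ℕ) :
    EMon a (b + k * a) c (d + k * c) := by
  induction k with
  | zero => simpa using h
  | succ k ih =>
    have := ih.R
    convert this using 1 <;> push_cast <;> ring

lemma floor_step {x y : ℝ} (hx : 0 < x) (hy : 0 < y) (h : Irrational (x / y)) :
    ∃ k : ℕ, 0 < x - k * y ∧ x - k * y < y ∧ Irrational ((x - k * y) / y) := by
  have hxy : 0 < x / y := div_pos hx hy
  have e : (x - (⌊x / y⌋₊ : ℕ) * y) / y = x / y - (⌊x / y⌋₊ : ℕ) := by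
    field_simp
  have hirr : Irrational ((x - (⌊x / y⌋₊ : ℕ) * y) / y) := by
    rw [e]; exact h.sub_natCast _
  refine ⟨⌊x / y⌋₊, ?_, ?_, hirr⟩
  · have h1 := Nat.floor_le hxy.le
    rw [le_div_iff₀ hy] at h1
    rcases (sub_nonneg.2 h1).lt_or_eq with h2 | h2
    · exact h2
    · rw [← h2] at hirr; simp at hirr
  · have h1 := Nat.lt_floor_add_one (x / y)
    rw [div_lt_iff₀ hy] at h1
    linarith

lemma irr_swap {x y : ℝ} (h : Irrational (x / y)) : Irrational (y / x) := by
  have := h.inv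
  rwa [inv_div] at this

lemma EMon.step {a b c d : ℝ} (h : EMon a b c d) {x y : ℝ} (hx : 0 < x) (hy : 0 < y)
    (hi : Irrational (x / y)) :
    ∃ a' b' c' d' x' y' : ℝ, EMon a' b' c' d' ∧ 0 < x' ∧ 0 < y' ∧ Irrational (x' / y') ∧
      a' * x' + b' * y' = a * x + b * y ∧ c' * x' + d' * y' = c * x + d * y ∧
      a' + c' ≤ b' + d' ∧ b' + d' ≤ 2 * (a' + c') ∧ a + c + 1 ≤ a' + c' := by
  obtain ⟨k, hk1, hk2, hk3⟩ := floor_step hx hy hi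
  obtain ⟨j, hj1, hj2, hj3⟩ := floor_step hy hk1 (irr_swap hk3)
  have hj : 1 ≤ (j : ℝ) := by
    rcases Nat.eq_zero_or_pos j with h0 | h0
    · subst h0; simp at hj2; linarith
    · exact_mod_cast h0
  obtain ⟨p1, p2, p3, p4, p5, p6, p7⟩ := h.props
  have hk0 : (0 : ℝ) ≤ k := Nat.cast_nonneg k
  refine ⟨_, _, _, _, x - k * y - (y - j * (x - k * y)), y - j * (x - k * y),
    ((h.iterR k).iterL j).R, by linarith, hj1, ?_, by ring, by ring, ?_, ?_, ?_⟩
  · rw [sub_div, div_self hj1.ne']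
    exact (irr_swap hj3).sub_natCast 1 |> fun h => by simpa using h
  · nlinarith [mul_nonneg hk0 p2, mul_nonneg hk0 p4]
  · nlinarith [mul_nonneg hk0 p2, mul_nonneg hk0 p4, mul_nonneg (sub_nonneg.2 hj) (by nlinarith [mul_nonneg hk0 p2, mul_nonneg hk0 p4] : 0 ≤ b + k * a + (d + k * c))]
  · nlinarith [mul_nonneg hk0 p2, mul_nonneg hk0 p4, mul_nonneg (sub_nonneg.2 hj) (by nlinarith [mul_nonneg hk0 p2, mul_nonneg hk0 p4] : 0 ≤ b + k * a + (d + k * c))]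

lemma cyl_exists {x y : ℝ} (hx : 0 < x) (hy : 0 < y) (hi : Irrational (x / y)) (n : ℕ) :
    ∃ a b c d x' y' : ℝ, EMon a b c d ∧ 0 < x' ∧ 0 < y' ∧ Irrational (x' / y') ∧
      a * x' + b * y' = x ∧ c * x' + d * y' = y ∧
      a + c ≤ b + d ∧ b + d ≤ 2 * (a + c) ∧ n + 1 ≤ a + c := by
  induction n with
  | zero =>
    obtain ⟨a, b, c, d, x', y', h, h1, h2, h3, h4, h5, h6, h7, h8⟩ := EMon.one.step hx hy hi
    exact ⟨a, b, c, d, x', y', h, h1, h2, h3, by linarith, by linarith, h6, h7,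
      by push_cast; linarith⟩
  | succ n ih =>
    obtain ⟨a, b, c, d, x', y', h, h1, h2, h3, h4, h5, h6, h7, h8⟩ := ih
    obtain ⟨a2, b2, c2, d2, x2, y2, g, g1, g2, g3, g4, g5, g6, g7, g8⟩ := h.step h1 h2 h3
    exact ⟨a2, b2, c2, d2, x2, y2, g, g1, g2, g3, by linarith, by linarith, g6, g7,
      by push_cast; linarith⟩

lemma EMon.inv {a b c d : ℝ} (h : EMon a b c d) (P : ℝ → ℝ → Prop)
    (h1 : ∀ a b, 0 < a → 0 < b → (P (a + b) b ↔ P a b))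
    (h2 : ∀ a b, 0 < a → 0 < b → (P a (a + b) ↔ P a b)) :
    ∀ x y, 0 < x → 0 < y → (P (a * x + b * y) (c * x + d * y) ↔ P x y) := by
  induction h with
  | one => intro x y hx hy; simp
  | L h ih =>
    rename_i a b c d
    intro x y hx hy
    rw [← h2 x y hx hy, ← ih x (x + y) hx (by linarith)]
    ring_nf
  | R h ih =>
    rename_i a b c d
    intro x y hx hy
    rw [← h1 x y hx hy, ← ih (x + y) y (by linarith) hy]
    ring_nf


lemma lebesgue_slices (S : Set (ℝ × ℝ)) (hS : MeasurableSet S) (μ : Measure ℝ)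
    [IsFiniteMeasure μ] :
    ∀ᵐ x : ℝ, ∀ T : Set ℝ, MeasurableSet T → μ (symmDiff (Prod.mk x ⁻¹' S) T) = 0 →
      ∀ c d : ℕ → ℝ, (∀ n, c n < d n) → (∀ n, c n ≤ x ∧ x ≤ d n) →
        Filter.Tendsto (fun n => d n - c n) Filter.atTop (nhds 0) → ∀ ε : ℝ, 0 < ε →
          ∀ᶠ n in Filter.atTop, ∫⁻ x' in Set.Icc (c n) (d n),
            μ (symmDiff (Prod.mk x' ⁻¹' S) T) ≤ ENNReal.ofReal (ε * (d n - c n)) := by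
  obtain ⟨𝒜, hc, hd⟩ := (inferInstance : IsSeparable μ).exists_countable_measureDense
  have hsec : ∀ x : ℝ, MeasurableSet (Prod.mk x ⁻¹' S) := fun x => measurable_prodMk_left hS
  have hmeas : ∀ U : Set ℝ, MeasurableSet U →
      Measurable (fun x' : ℝ => μ (symmDiff (Prod.mk x' ⁻¹' S) U)) := by
    intro U hU
    have : MeasurableSet (symmDiff S (Prod.snd ⁻¹' U)) := hS.symmDiff (measurable_snd hU)
    exact measurable_measure_prodMk_left this
  have hloc : ∀ U : Set ℝ, MeasurableSet U →
      LocallyIntegrable (fun x' : ℝ => μ.real (symmDiff (Prod.mk x' ⁻¹' S) U)) volume := by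
    intro U hU
    refine (locallyIntegrable_const (μ.real Set.univ)).mono
      (hmeas U hU).ennreal_toReal.aestronglyMeasurable ?_
    refine Filter.Eventually.of_forall fun x' => ?_
    rw [Real.norm_of_nonneg measureReal_nonneg, Real.norm_of_nonneg measureReal_nonneg]
    exact measureReal_mono (Set.subset_univ _)
  have key := (ae_ball_iff hc).2 fun U hU =>
    IsUnifLocDoublingMeasure.ae_tendsto_average (volume : Measure ℝ) (hloc U (hd.measurable U hU)) 1
  filter_upwards [key] with x hx T hT hT0 c d hcd hmem hlim ε hε
  obtain ⟨U, hU, hUx⟩ := hd.approx _ (hsec x) (measure_ne_top _ _) (ε / 4) (by linarith)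
  have hUm := hd.measurable U hU
  have hUx' : μ.real (symmDiff (Prod.mk x ⁻¹' S) U) < ε / 4 := by
    rw [measureReal_def]
    exact (ENNReal.lt_ofReal_iff_toReal_lt (measure_ne_top _ _)).1 hUx
  have hUT : μ (symmDiff U T) ≤ ENNReal.ofReal (ε / 4) := by
    calc μ (symmDiff U T) ≤ μ (symmDiff U (Prod.mk x ⁻¹' S)) + μ (symmDiff (Prod.mk x ⁻¹' S) T) :=
          (measure_mono (symmDiff_triangle _ _ _)).trans (measure_union_le _ _)
      _ ≤ ENNReal.ofReal (ε / 4) := by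
          rw [hT0, add_zero, symmDiff_comm]; exact hUx.le
  have hball : ∀ n, Metric.closedBall ((c n + d n) / 2) ((d n - c n) / 2) = Set.Icc (c n) (d n) := by
    intro n; rw [Real.closedBall_eq_Icc]; congr 1 <;> ring
  have ht := hx U hU (l := Filter.atTop) (fun n => (c n + d n) / 2) (fun n => (d n - c n) / 2)
    (by
      rw [tendsto_nhdsWithin_iff]
      refine ⟨by simpa using hlim.div_const 2, Filter.Eventually.of_forall fun n => ?_⟩
      have := hcd n
      simp only [Set.mem_Ioi]; linarith)
    (by
      refine Filter.Eventually.of_forall fun n => ?_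
      rw [one_mul, hball]; exact hmem n)
  filter_upwards [ht.eventually (gt_mem_nhds (hUx'.trans (by linarith : ε / 4 < ε / 2)))] with n hn
  rw [hball, setAverage_eq, Real.volume_real_Icc_of_le (hcd n).le, smul_eq_mul] at hn
  have hpos : 0 < d n - c n := sub_pos.2 (hcd n)
  have hn' : ∫ x' in Set.Icc (c n) (d n), μ.real (symmDiff (Prod.mk x' ⁻¹' S) U) <
      ε / 2 * (d n - c n) := by
    rw [inv_mul_lt_iff₀ hpos] at hn; linarith
  have hInt : IntegrableOn (fun x' : ℝ => μ.real (symmDiff (Prod.mk x' ⁻¹' S) U))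
      (Set.Icc (c n) (d n)) volume := (hloc U hUm).integrableOn_isCompact isCompact_Icc
  have hl : ∫⁻ x' in Set.Icc (c n) (d n), μ (symmDiff (Prod.mk x' ⁻¹' S) U) ≤
      ENNReal.ofReal (ε / 2 * (d n - c n)) := by
    have := ofReal_integral_eq_lintegral_ofReal hInt
      (Filter.Eventually.of_forall fun _ => measureReal_nonneg)
    simp only [measureReal_def, ENNReal.ofReal_toReal (measure_ne_top _ _)] at this
    rw [← this]
    exact ENNReal.ofReal_le_ofReal (by simpa [measureReal_def] using hn'.le)
  calc ∫⁻ x' in Set.Icc (c n) (d n), μ (symmDiff (Prod.mk x' ⁻¹' S) T)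
      ≤ ∫⁻ x' in Set.Icc (c n) (d n),
          (μ (symmDiff (Prod.mk x' ⁻¹' S) U) + ENNReal.ofReal (ε / 4)) := by
        refine lintegral_mono fun x' => ?_
        refine ((measure_mono (symmDiff_triangle _ U _)).trans (measure_union_le _ _)).trans ?_
        gcongr
    _ ≤ ENNReal.ofReal (ε / 2 * (d n - c n)) + ENNReal.ofReal (ε / 4) * ENNReal.ofReal (d n - c n) := by
        rw [lintegral_add_right _ measurable_const, setLIntegral_const, Real.volume_Icc]
        gcongr
    _ ≤ ENNReal.ofReal (ε * (d n - c n)) := by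
        rw [← ENNReal.ofReal_mul (by linarith), ← ENNReal.ofReal_add (by positivity) (by positivity)]
        exact ENNReal.ofReal_le_ofReal (by nlinarith)

lemma vol_preimage_lin (a b c d : ℝ) (h : a * d - b * c ≠ 0) (s : Set (ℝ × ℝ)) :
    volume ((fun w : ℝ × ℝ => (a * w.1 + b * w.2, c * w.1 + d * w.2)) ⁻¹' s) =
      ENNReal.ofReal |(a * d - b * c)⁻¹| * volume s := by
  have hdet : LinearMap.det (Matrix.toLin (Module.Basis.finTwoProd ℝ) (Module.Basis.finTwoProd ℝ)
      !![a, b; c, d]) = a * d - b * c := by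
    rw [LinearMap.det_toLin, Matrix.det_fin_two_of]
  have := Measure.addHaar_preimage_linearMap (volume : Measure (ℝ × ℝ))
    (f := Matrix.toLin (Module.Basis.finTwoProd ℝ) (Module.Basis.finTwoProd ℝ) !![a, b; c, d])
    (by rw [hdet]; exact h) s
  rw [hdet] at this
  rw [← this]
  congr 1
  ext w
  simp only [Set.mem_preimage, Matrix.toLin_finTwoProd_apply]

lemma polar (V : Set (ℝ × ℝ)) (hV : MeasurableSet V) :
    volume V = ∫⁻ u : ℝ, ENNReal.ofReal |u| * volume {x : ℝ | (u * x, u * (1 - x)) ∈ V} := by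
  have h1 := vol_preimage_lin 1 0 (-1) 1 (by norm_num) V
  have hm : Measurable (fun w : ℝ × ℝ => (1 * w.1 + 0 * w.2, -1 * w.1 + 1 * w.2)) := by fun_prop
  have h2 : volume V = volume
      ((fun w : ℝ × ℝ => (1 * w.1 + 0 * w.2, -1 * w.1 + 1 * w.2)) ⁻¹' V) := by
    rw [h1]; norm_num
  rw [h2, Measure.volume_eq_prod, Measure.prod_apply_symm (hm hV)]
  refine lintegral_congr_ae ?_
  have h0 : ∀ᵐ u : ℝ, u ≠ 0 := by simp [ae_iff]
  filter_upwards [h0] with u hu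
  have h3 := Real.volume_preimage_mul_left hu
    ((fun x : ℝ => (x, u)) ⁻¹' ((fun w : ℝ × ℝ => (1 * w.1 + 0 * w.2, -1 * w.1 + 1 * w.2)) ⁻¹' V))
  have h4 : {x : ℝ | (u * x, u * (1 - x)) ∈ V} = (fun x => u * x) ⁻¹' ((fun x : ℝ => (x, u)) ⁻¹'
      ((fun w : ℝ × ℝ => (1 * w.1 + 0 * w.2, -1 * w.1 + 1 * w.2)) ⁻¹' V)) := by
    ext x
    simp only [Set.mem_setOf_eq, Set.mem_preimage]
    ring_nf
  rw [h4, h3, ← mul_assoc, ← ENNReal.ofReal_mul (abs_nonneg _), ← abs_mul, mul_inv_cancel₀ hu]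
  simp


/-- Measurable subsets of the plane whose trace on the quadrant is invariant under the
Euclidean algorithm. -/
structure EInv (R : Set (ℝ × ℝ)) : Prop where
  meas : MeasurableSet R
  inv1 : ∀ a b : ℝ, 0 < a → 0 < b → ((a + b, b) ∈ R ↔ (a, b) ∈ R)
  inv2 : ∀ a b : ℝ, 0 < a → 0 < b → ((a, a + b) ∈ R ↔ (a, b) ∈ R)

lemma EInv.compl {R : Set (ℝ × ℝ)} (h : EInv R) : EInv Rᶜ :=
  ⟨h.meas.compl, fun a b ha hb => not_congr (h.inv1 a b ha hb),
    fun a b ha hb => not_congr (h.inv2 a b ha hb)⟩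

lemma EInv.mon {R : Set (ℝ × ℝ)} (hR : EInv R) {a b c d : ℝ} (h : EMon a b c d) {x y : ℝ}
    (hx : 0 < x) (hy : 0 < y) : ((a * x + b * y, c * x + d * y) ∈ R ↔ (x, y) ∈ R) :=
  h.inv (fun x y => (x, y) ∈ R) hR.inv1 hR.inv2 x y hx hy

/-- The set `R` in projective coordinates. -/
def polSet (R : Set (ℝ × ℝ)) : Set (ℝ × ℝ) := {p | (p.2 * p.1, p.2 * (1 - p.1)) ∈ R}

lemma polSet_meas {R : Set (ℝ × ℝ)} (h : MeasurableSet R) : MeasurableSet (polSet R) := by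
  have : Measurable (fun p : ℝ × ℝ => (p.2 * p.1, p.2 * (1 - p.1))) := by fun_prop
  exact this h

/-- The bad set in a cylinder. -/
def badSet (R : Set (ℝ × ℝ)) (T : Set ℝ) (r s q1 q2 : ℝ) : Set (ℝ × ℝ) :=
  {w | 0 < w.1 ∧ 0 < w.2 ∧ q1 * w.1 + q2 * w.2 ∈ Set.Ioo r s ∧
    ¬ (w ∈ R ↔ q1 * w.1 + q2 * w.2 ∈ T)}

lemma bad_le {R : Set (ℝ × ℝ)} (hR : EInv R) {T : Set ℝ} (hT : MeasurableSet T) {r s : ℝ}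
    (hr : 0 < r) {a b c d : ℝ} (h : EMon a b c d) :
    volume (badSet R T r s (a + c) (b + d)) ≤ ENNReal.ofReal s *
      ∫⁻ x in Set.Icc (b / (b + d)) (a / (a + c)),
        (volume.restrict (Set.Ioo r s)) (symmDiff (Prod.mk x ⁻¹' polSet R) T) := by
  obtain ⟨p1, p2, p3, p4, p5, p6, p7⟩ := h.props
  set V : Set (ℝ × ℝ) := {v | 0 < d * v.1 - b * v.2 ∧ 0 < a * v.2 - c * v.1 ∧
    v.1 + v.2 ∈ Set.Ioo r s ∧ v ∈ symmDiff R ((fun v : ℝ × ℝ => v.1 + v.2) ⁻¹' T)} with hVdef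
  have hV : MeasurableSet V := by
    have m1 : MeasurableSet {v : ℝ × ℝ | 0 < d * v.1 - b * v.2} :=
      measurableSet_lt (by fun_prop) (by fun_prop)
    have m2 : MeasurableSet {v : ℝ × ℝ | 0 < a * v.2 - c * v.1} :=
      measurableSet_lt (by fun_prop) (by fun_prop)
    refine MeasurableSet.inter m1 (MeasurableSet.inter m2 (MeasurableSet.inter ?_ ?_))
    · exact (by fun_prop : Measurable (fun v : ℝ × ℝ => v.1 + v.2)) measurableSet_Ioo
    · exact hR.meas.symmDiff ((by fun_prop : Measurable (fun v : ℝ × ℝ => v.1 + v.2)) hT)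
  set Z : Set (ℝ × ℝ) := {p | p.1 ∈ Set.Icc (b / (b + d)) (a / (a + c)) ∧ p.2 ∈ Set.Ioo r s ∧
    p ∈ symmDiff (polSet R) (Prod.snd ⁻¹' T)} with hZdef
  have hZ : MeasurableSet Z :=
    MeasurableSet.inter (measurable_fst measurableSet_Icc) (MeasurableSet.inter
      (measurable_snd measurableSet_Ioo) ((polSet_meas hR.meas).symmDiff (measurable_snd hT)))
  have hBV : volume (badSet R T r s (a + c) (b + d)) ≤ volume V := by
    have h1 := vol_preimage_lin a b c d (by rw [p1]; norm_num) V
    rw [p1] at h1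
    simp only [inv_one, abs_one, ENNReal.ofReal_one, one_mul] at h1
    rw [← h1]
    refine measure_mono ?_
    rintro ⟨x, y⟩ ⟨hx, hy, hq, hn⟩
    simp only at hx hy hq hn
    have hm := hR.mon h hx hy
    have e : (a * x + b * y) + (c * x + d * y) = (a + c) * x + (b + d) * y := by ring
    refine ⟨?_, ?_, ?_, ?_⟩
    · show 0 < d * (a * x + b * y) - b * (c * x + d * y)
      have : d * (a * x + b * y) - b * (c * x + d * y) = (a * d - b * c) * x := by ring
      rw [this, p1]; linarith
    · show 0 < a * (c * x + d * y) - c * (a * x + b * y)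
      have : a * (c * x + d * y) - c * (a * x + b * y) = (a * d - b * c) * y := by ring
      rw [this, p1]; linarith
    · show (a * x + b * y) + (c * x + d * y) ∈ Set.Ioo r s
      rw [e]; exact hq
    · rw [Set.mem_symmDiff]
      show ((a * x + b * y, c * x + d * y) ∈ R ∧ ¬ (a * x + b * y) + (c * x + d * y) ∈ T) ∨
        ((a * x + b * y) + (c * x + d * y) ∈ T ∧ ¬ (a * x + b * y, c * x + d * y) ∈ R)
      rw [e, hm]
      tauto
  refine hBV.trans ?_
  have hZ1 : (volume : Measure (ℝ × ℝ)) Z = ∫⁻ x in Set.Icc (b / (b + d)) (a / (a + c)),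
        (volume.restrict (Set.Ioo r s)) (symmDiff (Prod.mk x ⁻¹' polSet R) T) := by
    rw [Measure.volume_eq_prod, Measure.prod_apply hZ, ← lintegral_indicator measurableSet_Icc]
    refine lintegral_congr fun x => ?_
    by_cases hx : x ∈ Set.Icc (b / (b + d)) (a / (a + c))
    · rw [Set.indicator_of_mem hx, Measure.restrict_apply' measurableSet_Ioo]
      congr 1
      ext u
      simp only [hZdef, Set.mem_preimage, Set.mem_inter_iff, Set.mem_symmDiff]
      constructor
      · rintro ⟨_, h2, h3⟩; exact ⟨h3, h2⟩
      · rintro ⟨h3, h2⟩; exact ⟨hx, h2, h3⟩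
    · rw [Set.indicator_of_notMem hx]
      convert measure_empty (μ := (volume : Measure ℝ))
      ext u
      simp only [Set.mem_preimage, Set.mem_empty_iff_false, iff_false]
      exact fun h => hx h.1
  rw [← hZ1, polar V hV, Measure.volume_eq_prod, Measure.prod_apply_symm hZ,
    ← lintegral_const_mul _ (measurable_measure_prodMk_right hZ)]
  refine lintegral_mono fun u => ?_
  by_cases hu : u ∈ Set.Ioo r s
  · have hu0 : 0 < u := hr.trans hu.1
    rw [abs_of_pos hu0]
    refine mul_le_mul' (ENNReal.ofReal_le_ofReal hu.2.le) (measure_mono ?_)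
    rintro x ⟨h1, h2, h3, h4⟩
    refine ⟨⟨?_, ?_⟩, hu, ?_⟩
    · simp only at h1
      rw [div_le_iff₀ (by linarith)]
      have : 0 < u * (x * (b + d) - b) := by linarith
      have := (mul_pos_iff_of_pos_left hu0).1 this
      linarith
    · simp only at h2
      rw [le_div_iff₀ (by linarith)]
      have : 0 < u * (a - x * (a + c)) := by linarith
      have := (mul_pos_iff_of_pos_left hu0).1 this
      linarith
    · rw [Set.mem_symmDiff] at h4 ⊢
      have e : u * x + u * (1 - x) = u := by ring
      simp only [Set.mem_preimage, e] at h4 ⊢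
      exact h4
  · have : {x : ℝ | (u * x, u * (1 - x)) ∈ V} = ∅ := by
      ext x
      simp only [Set.mem_empty_iff_false, iff_false]
      rintro ⟨h1, h2, h3, h4⟩
      have e : u * x + u * (1 - x) = u := by ring
      simp only [e] at h3
      exact hu h3
    rw [this]; simp

lemma ae_irr : ∀ᵐ x : ℝ, Irrational x := by
  rw [ae_iff]
  have : {x : ℝ | ¬ Irrational x} = Set.range ((↑) : ℚ → ℝ) := by
    ext x; simp [Irrational]
  rw [this]
  exact (Set.countable_range _).measure_zero _

lemma good_points {R : Set (ℝ × ℝ)} (hR : EInv R) {r s : ℝ} (hr : 0 < r) (hrs : r < s) :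
    ∀ᵐ x : ℝ, x ∈ Set.Ioo (0 : ℝ) 1 → ∀ T : Set ℝ, MeasurableSet T →
      (volume.restrict (Set.Ioo r s)) (symmDiff (Prod.mk x ⁻¹' polSet R) T) = 0 →
      ∀ ε : ℝ, 0 < ε → ∃ q1 q2 : ℝ, 1 ≤ q1 ∧ q1 ≤ q2 ∧ q2 ≤ 2 * q1 ∧
        ENNReal.ofReal (q1 * q2) * volume (badSet R T r s q1 q2) ≤ ENNReal.ofReal ε := by
  filter_upwards [lebesgue_slices (polSet R) (polSet_meas hR.meas) (volume.restrict (Set.Ioo r s)),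
    ae_irr] with x hx hirr hx01 T hT hT0 ε hε
  have hs : 0 < s := hr.trans hrs
  have h1x : 0 < 1 - x := sub_pos.2 hx01.2
  have hi : Irrational (x / (1 - x)) := by
    have e : x / (1 - x) = ((1 / x) - (1 : ℕ))⁻¹ := by
      have := hx01.1
      rw [Nat.cast_one, ← one_div]
      field_simp
    rw [e]
    refine Irrational.inv (Irrational.sub_natCast ?_ 1)
    rw [one_div]; exact hirr.inv
  choose a b c d x' y' h0 h1 h2 h3 h4 h5 h6 h7 h8 using fun n => cyl_exists hx01.1 h1x hi n
  have hp := fun n => (h0 n).props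
  have hlen : ∀ n, a n / (a n + c n) - b n / (b n + d n) = 1 / ((a n + c n) * (b n + d n)) := by
    intro n
    obtain ⟨p1, p2, p3, p4, p5, p6, p7⟩ := hp n
    have e1 : a n + c n ≠ 0 := by linarith
    have e2 : b n + d n ≠ 0 := by linarith
    field_simp
    linarith
  have hq : ∀ n, 1 ≤ a n + c n ∧ 1 ≤ b n + d n := fun n =>
    ⟨(hp n).2.2.2.2.2.1, (hp n).2.2.2.2.2.2⟩
  have hlt : ∀ n, b n / (b n + d n) < a n / (a n + c n) := by
    intro n
    rw [← sub_pos, hlen]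
    have := hq n
    have : 0 < (a n + c n) * (b n + d n) := mul_pos (by linarith) (by linarith)
    positivity
  have hmem : ∀ n, b n / (b n + d n) ≤ x ∧ x ≤ a n / (a n + c n) := by
    intro n
    obtain ⟨p1, p2, p3, p4, p5, p6, p7⟩ := hp n
    have e1 : (a n + c n) * x' n + (b n + d n) * y' n = 1 := by
      linarith [h4 n, h5 n]
    constructor
    · rw [div_le_iff₀ (by linarith)]
      have : x * (b n + d n) - b n = (a n * d n - b n * c n) * x' n := by
        linear_combination (-(b n + d n)) * h4 n + b n * e1
      rw [p1] at this
      linarith [h1 n]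
    · rw [le_div_iff₀ (by linarith)]
      have : a n - x * (a n + c n) = (a n * d n - b n * c n) * y' n := by
        linear_combination (a n + c n) * h4 n - a n * e1
      rw [p1] at this
      linarith [h2 n]
  have hlim : Filter.Tendsto (fun n => a n / (a n + c n) - b n / (b n + d n)) Filter.atTop
      (nhds 0) := by
    refine squeeze_zero (fun n => (sub_pos.2 (hlt n)).le) (fun n => ?_)
      tendsto_one_div_add_atTop_nhds_zero_nat
    rw [hlen]
    have := hq n
    refine one_div_le_one_div_of_le (by positivity) ?_
    nlinarith [h8 n]
  have hev := hx T hT hT0 (fun n => b n / (b n + d n)) (fun n => a n / (a n + c n)) hlt hmem hlim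
    (ε / s) (by positivity)
  obtain ⟨n, hn⟩ := hev.exists
  have hqn := hq n
  have hqq : 0 < (a n + c n) * (b n + d n) := mul_pos (by linarith) (by linarith)
  refine ⟨a n + c n, b n + d n, hqn.1, h6 n, h7 n, ?_⟩
  calc ENNReal.ofReal ((a n + c n) * (b n + d n)) * volume (badSet R T r s (a n + c n) (b n + d n))
      ≤ ENNReal.ofReal ((a n + c n) * (b n + d n)) * (ENNReal.ofReal s *
        ENNReal.ofReal (ε / s * (a n / (a n + c n) - b n / (b n + d n)))) := by
        gcongr
        refine (bad_le hR hT hr (h0 n)).trans ?_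
        gcongr
    _ = ENNReal.ofReal ε := by
        rw [← ENNReal.ofReal_mul hs.le, ← ENNReal.ofReal_mul hqq.le, hlen]
        congr 1
        field_simp
        exact div_self hqq.ne'


lemma homog_slab {R : Set (ℝ × ℝ)} (hR : EInv R) {r s : ℝ} (hr : 0 < r) (hrs : r < s)
    {H : Set ℝ}
    (hx : ∀ ε : ℝ, 0 < ε → ∃ q1 q2 : ℝ, 1 ≤ q1 ∧ q1 ≤ q2 ∧ q2 ≤ 2 * q1 ∧
        ENNReal.ofReal (q1 * q2) * volume (badSet R H r s q1 q2) ≤ ENNReal.ofReal ε) :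
    volume {p : ℝ × ℝ | r < p.1 ∧ p.1 < p.2 ∧ p.2 < s ∧ ¬ (p.1 ∈ H ↔ p.2 ∈ H)} = 0 := by
  set K : Set (ℝ × ℝ) := {p : ℝ × ℝ | r < p.1 ∧ p.1 < p.2 ∧ p.2 < s ∧ ¬ (p.1 ∈ H ↔ p.2 ∈ H)}
    with hK
  have hs : 0 < s := hr.trans hrs
  set L : ℝ := s / r with hL
  have hLpos : 0 < L := div_pos hs hr
  have hLr : L * r = s := by rw [hL]; field_simp
  have main : ∀ ε : ℝ, 0 < ε → volume K ≤ ENNReal.ofReal (2 * (L + 1) * ε) := by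
    intro ε hε
    obtain ⟨q1, q2, hq1, hq12, hq21, hq⟩ := hx ε hε
    have hq1p : 0 < q1 := by linarith
    have hq2p : 0 < q2 := by linarith
    set k : ℕ := ⌈L * q2 / q1⌉₊ with hk
    have hk1 : L * q2 ≤ k * q1 := by
      have := Nat.le_ceil (L * q2 / q1)
      rwa [div_le_iff₀ hq1p] at this
    have hk2 : k * q1 ≤ (L + 1) * q2 := by
      have := (Nat.ceil_lt_add_one (by positivity : 0 ≤ L * q2 / q1)).le
      have h2 : (k : ℝ) * q1 ≤ (L * q2 / q1 + 1) * q1 := by gcongr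
      have h3 : (L * q2 / q1 + 1) * q1 = L * q2 + q1 := by field_simp
      nlinarith
    have hkq : 0 < k * q1 := lt_of_lt_of_le (by positivity) hk1
    have hkp : (0 : ℝ) < k := pos_of_mul_pos_left hkq hq1p.le
    set B := badSet R H r s q1 q2 with hB
    have hdet : q1 * (q2 + k * q1) - q2 * q1 = k * q1 ^ 2 := by ring
    have hv1 := vol_preimage_lin q1 q2 q1 (q2 + k * q1) (by rw [hdet]; positivity) K
    have hv2 := vol_preimage_lin 1 k 0 1 (by norm_num) B
    have hv2' : volume ((fun w : ℝ × ℝ => (1 * w.1 + k * w.2, 0 * w.1 + 1 * w.2)) ⁻¹' B) =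
        volume B := by rw [hv2]; norm_num
    have hsub : (fun w : ℝ × ℝ => (q1 * w.1 + q2 * w.2, q1 * w.1 + (q2 + k * q1) * w.2)) ⁻¹' K ⊆
        B ∪ (fun w : ℝ × ℝ => (1 * w.1 + k * w.2, 0 * w.1 + 1 * w.2)) ⁻¹' B := by
      rintro ⟨x, y⟩ ⟨h1, h2, h3, h4⟩
      simp only at h1 h2 h3 h4
      have hy : 0 < y := by
        have : 0 < (k * q1) * y := by linarith
        exact (mul_pos_iff_of_pos_left hkq).1 this
      have hx : 0 < x := by
        have e1 : k * q1 * y < s := by nlinarith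
        have e2 : L * q2 * y ≤ k * q1 * y := by gcongr
        have e3 : L * (q2 * y) < L * r := by rw [hLr]; linarith
        have e4 : q2 * y < r := lt_of_mul_lt_mul_left e3 hLpos.le
        have : 0 < q1 * x := by linarith
        exact (mul_pos_iff_of_pos_left hq1p).1 this
      have hinv : ((1 * x + k * y, 0 * x + 1 * y) ∈ R ↔ (x, y) ∈ R) := by
        have := hR.mon (EMon.one.iterR k) hx hy
        simpa using this
      have e : q1 * (1 * x + k * y) + q2 * (0 * x + 1 * y) = q1 * x + (q2 + k * q1) * y := by ring
      by_cases hb : ((x, y) ∈ R ↔ q1 * x + q2 * y ∈ H)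
      · right
        refine ⟨by show 0 < 1 * x + k * y; positivity, by show 0 < 0 * x + 1 * y; linarith, ?_, ?_⟩
        · show q1 * (1 * x + k * y) + q2 * (0 * x + 1 * y) ∈ Set.Ioo r s
          rw [e]; exact ⟨by linarith, h3⟩
        · show ¬ ((1 * x + k * y, 0 * x + 1 * y) ∈ R ↔
            q1 * (1 * x + k * y) + q2 * (0 * x + 1 * y) ∈ H)
          rw [e, hinv]
          tauto
      · left
        exact ⟨hx, hy, ⟨h1, by show q1 * x + q2 * y < s; linarith⟩, hb⟩
    have h5 : ENNReal.ofReal |(q1 * (q2 + k * q1) - q2 * q1)⁻¹| * volume K ≤ 2 * volume B := by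
      rw [← hv1, two_mul]
      refine (measure_mono hsub).trans ((measure_union_le _ _).trans ?_)
      rw [hv2']
    rw [hdet, abs_of_pos (by positivity)] at h5
    have hpos : 0 < k * q1 ^ 2 := by positivity
    calc volume K = ENNReal.ofReal (k * q1 ^ 2) * (ENNReal.ofReal (k * q1 ^ 2)⁻¹ * volume K) := by
          rw [← mul_assoc, ← ENNReal.ofReal_mul hpos.le, mul_inv_cancel₀ hpos.ne']
          simp
      _ ≤ ENNReal.ofReal ((L + 1) * (q1 * q2)) * (2 * volume B) := by
          refine mul_le_mul' (ENNReal.ofReal_le_ofReal ?_) h5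
          nlinarith
      _ = ENNReal.ofReal (2 * (L + 1)) * (ENNReal.ofReal (q1 * q2) * volume B) := by
          rw [ENNReal.ofReal_mul (p := L + 1) (by positivity),
            ENNReal.ofReal_mul (p := (2 : ℝ)) (by positivity)]
          simp only [ENNReal.ofReal_ofNat]
          ring
      _ ≤ ENNReal.ofReal (2 * (L + 1)) * ENNReal.ofReal ε := by gcongr
      _ = ENNReal.ofReal (2 * (L + 1) * ε) := by rw [← ENNReal.ofReal_mul (by positivity)]
  refine le_antisymm (ENNReal.le_of_forall_pos_le_add fun ε hε _ => ?_) (zero_le)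
  have := main (ε / (2 * (L + 1))) (by positivity)
  rw [zero_add]
  refine this.trans (le_of_eq ?_)
  rw [mul_div_cancel₀ _ (by positivity)]
  simp

lemma zero_or_conull {H : Set ℝ}
    (h : ∀ n : ℕ, volume {p : ℝ × ℝ | 1 / ((n : ℝ) + 2) < p.1 ∧ p.1 < p.2 ∧ p.2 < (n : ℝ) + 2 ∧
      ¬ (p.1 ∈ H ↔ p.2 ∈ H)} = 0) :
    volume (H ∩ Set.Ioi 0) = 0 ∨ volume (Set.Ioi 0 \ H) = 0 := by
  set K : Set (ℝ × ℝ) := {p : ℝ × ℝ | 0 < p.1 ∧ p.1 < p.2 ∧ ¬ (p.1 ∈ H ↔ p.2 ∈ H)} with hK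
  have hK0 : volume K = 0 := by
    refine measure_mono_null ?_ (measure_iUnion_null h)
    rintro ⟨y, z⟩ ⟨h1, h2, h3⟩
    simp only at h1 h2 h3
    obtain ⟨n, hn⟩ := exists_nat_gt (max (1 / y) z)
    have hn1 := (le_max_left _ _).trans_lt hn
    have hn2 := (le_max_right _ _).trans_lt hn
    refine Set.mem_iUnion.2 ⟨n, ?_, h2, by show z < n + 2; linarith, h3⟩
    show 1 / ((n : ℝ) + 2) < y
    rw [div_lt_iff₀ h1] at hn1
    rw [div_lt_iff₀ (by positivity)]
    nlinarith
  have hsub : (H ∩ Set.Ioi 0) ×ˢ (Set.Ioi 0 \ H) ⊆ K ∪ Prod.swap ⁻¹' K := by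
    rintro ⟨y, z⟩ ⟨⟨h1, h2⟩, h3, h4⟩
    simp only [Set.mem_Ioi] at h1 h2 h3 h4
    rcases lt_trichotomy y z with h | h | h
    · left; exact ⟨h2, h, by tauto⟩
    · subst h; exact absurd h1 h4
    · right; exact ⟨h3, h, by simp; tauto⟩
  have hprod : volume ((H ∩ Set.Ioi 0) ×ˢ (Set.Ioi 0 \ H)) = 0 := by
    refine measure_mono_null hsub (measure_union_null hK0 ?_)
    exact (Measure.measurePreserving_swap (μ := (volume : Measure ℝ))
      (ν := (volume : Measure ℝ))).quasiMeasurePreserving.preimage_null hK0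
  rw [Measure.volume_eq_prod, Measure.prod_prod, mul_eq_zero] at hprod
  exact hprod

lemma homog_ae {R : Set (ℝ × ℝ)} (hR : EInv R) :
    ∀ᵐ x : ℝ, x ∈ Set.Ioo (0 : ℝ) 1 →
      (volume ((Prod.mk x ⁻¹' polSet R) ∩ Set.Ioi 0) = 0 ∨
        volume (Set.Ioi 0 \ (Prod.mk x ⁻¹' polSet R)) = 0) := by
  have hpos : ∀ n : ℕ, 0 < 1 / ((n : ℝ) + 2) := fun n => by positivity
  have hlt : ∀ n : ℕ, 1 / ((n : ℝ) + 2) < (n : ℝ) + 2 := fun n => by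
    rw [div_lt_iff₀ (by positivity)]
    nlinarith [(Nat.cast_nonneg n : (0 : ℝ) ≤ n)]
  filter_upwards [ae_all_iff.2 fun n : ℕ => good_points hR (hpos n) (hlt n)] with x hx hx01
  have hm : MeasurableSet (Prod.mk x ⁻¹' polSet R) := measurable_prodMk_left (polSet_meas hR.meas)
  refine zero_or_conull fun n => ?_
  exact homog_slab hR (hpos n) (hlt n) (hx n hx01 _ hm (by simp))


lemma polar_null {V : Set (ℝ × ℝ)} (hV : MeasurableSet V)
    (h : ∀ᵐ x : ℝ, volume (Prod.mk x ⁻¹' polSet V) = 0) : volume V = 0 := by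
  have hm := polSet_meas hV
  have h1 : (volume : Measure (ℝ × ℝ)) (polSet V) = 0 := by
    rw [Measure.volume_eq_prod, Measure.measure_prod_null hm]; exact h
  rw [Measure.volume_eq_prod, Measure.prod_apply_symm hm,
    lintegral_eq_zero_iff (measurable_measure_prodMk_right hm)] at h1
  rw [polar V hV, lintegral_eq_zero_iff']
  · filter_upwards [h1] with u hu
    have : volume {x : ℝ | (u * x, u * (1 - x)) ∈ V} = 0 := hu
    rw [this]; simp
  · have h2 : Measurable fun u : ℝ => volume {x : ℝ | (u * x, u * (1 - x)) ∈ V} :=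
      measurable_measure_prodMk_right hm
    fun_prop

/-- The open quadrant. -/
def quad : Set (ℝ × ℝ) := {p | 0 < p.1 ∧ 0 < p.2}

lemma quad_meas : MeasurableSet quad := by
  have m1 : MeasurableSet {v : ℝ × ℝ | 0 < v.1} := measurableSet_lt (by fun_prop) (by fun_prop)
  have m2 : MeasurableSet {v : ℝ × ℝ | 0 < v.2} := measurableSet_lt (by fun_prop) (by fun_prop)
  exact m1.inter m2

lemma quad_pol {x u : ℝ} (h : (u * x, u * (1 - x)) ∈ quad) : x ∈ Set.Ioo (0 : ℝ) 1 ∧ 0 < u := by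
  obtain ⟨h1, h2⟩ := h
  simp only at h1 h2
  have hu : 0 < u := by linarith
  have := (mul_pos_iff_of_pos_left hu).1 h1
  have := (mul_pos_iff_of_pos_left hu).1 h2
  exact ⟨⟨by assumption, by linarith⟩, hu⟩

lemma null_of_point {R : Set (ℝ × ℝ)} (hR : EInv R) {x0 : ℝ}
    (hx0 : volume ((Prod.mk x0 ⁻¹' polSet R) ∩ Set.Ioi 0) = 0)
    (hg : ∀ T : Set ℝ, MeasurableSet T →
      (volume.restrict (Set.Ioo (1 : ℝ) 8)) (symmDiff (Prod.mk x0 ⁻¹' polSet R) T) = 0 →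
      ∀ ε : ℝ, 0 < ε → ∃ q1 q2 : ℝ, 1 ≤ q1 ∧ q1 ≤ q2 ∧ q2 ≤ 2 * q1 ∧
        ENNReal.ofReal (q1 * q2) * volume (badSet R T 1 8 q1 q2) ≤ ENNReal.ofReal ε) :
    volume (R ∩ quad) = 0 := by
  have hpm := polSet_meas hR.meas
  set K : Set ℝ := {x | volume ((Prod.mk x ⁻¹' polSet R) ∩ Set.Ioi 0) ≠ 0} with hKdef
  have hK : MeasurableSet K := by
    have h1 : Measurable fun x : ℝ =>
        volume (Prod.mk x ⁻¹' (polSet R ∩ Prod.snd ⁻¹' Set.Ioi (0 : ℝ))) :=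
      measurable_measure_prodMk_left (hpm.inter (measurable_snd measurableSet_Ioi))
    exact (h1 (measurableSet_singleton 0)).compl
  set R' : Set (ℝ × ℝ) := {v | v.1 / (v.1 + v.2) ∈ K} with hR'def
  have hR' : MeasurableSet R' :=
    (by fun_prop : Measurable fun v : ℝ × ℝ => v.1 / (v.1 + v.2)) hK
  have hpolR' : ∀ x u : ℝ, 0 < u → ((u * x, u * (1 - x)) ∈ R' ↔ x ∈ K) := by
    intro x u hu
    have e : u * x / (u * x + u * (1 - x)) = x := by
      have : u * x + u * (1 - x) = u := by ring
      rw [this]; field_simp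
    show u * x / (u * x + u * (1 - x)) ∈ K ↔ x ∈ K
    rw [e]
  set V : Set (ℝ × ℝ) := quad ∩ symmDiff R R' with hVdef
  have hV : MeasurableSet V := quad_meas.inter (hR.meas.symmDiff hR')
  have hV0 : volume V = 0 := by
    refine polar_null hV ?_
    filter_upwards [homog_ae hR] with x hx
    by_cases hx01 : x ∈ Set.Ioo (0 : ℝ) 1
    · by_cases hxK : x ∈ K
      · have h2 := (hx hx01).resolve_left hxK
        refine measure_mono_null ?_ h2
        rintro u ⟨hq, hs⟩
        have hu := (quad_pol hq).2
        refine ⟨hu, fun hmem => ?_⟩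
        rw [Set.mem_symmDiff] at hs
        have h3 := (hpolR' x u hu).2 hxK
        have h4 : (u * x, u * (1 - x)) ∈ R := hmem
        simp only at hs
        tauto
      · have h2 : volume ((Prod.mk x ⁻¹' polSet R) ∩ Set.Ioi 0) = 0 := by
          by_contra h; exact hxK h
        refine measure_mono_null ?_ h2
        rintro u ⟨hq, hs⟩
        have hu := (quad_pol hq).2
        refine ⟨?_, hu⟩
        rw [Set.mem_symmDiff] at hs
        have h3 := (hpolR' x u hu).not.2 hxK
        show (u * x, u * (1 - x)) ∈ R
        simp only at hs
        tauto
    · convert measure_empty (μ := (volume : Measure ℝ))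
      ext u
      simp only [Set.mem_empty_iff_false, iff_false]
      rintro ⟨hq, hs⟩
      exact hx01 (quad_pol hq).1
  set W : Set (ℝ × ℝ) := {w | w ∈ quad ∧ 1 < w.1 + w.2 ∧ w.1 + 2 * w.2 < 8 ∧ w ∈ R'} with hWdef
  have hW : MeasurableSet W := by
    have m1 : MeasurableSet {w : ℝ × ℝ | 1 < w.1 + w.2} :=
      measurableSet_lt (by fun_prop) (by fun_prop)
    have m2 : MeasurableSet {w : ℝ × ℝ | w.1 + 2 * w.2 < 8} :=
      measurableSet_lt (by fun_prop) (by fun_prop)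
    exact quad_meas.inter (m1.inter (m2.inter hR'))
  have hT0 : (volume.restrict (Set.Ioo (1 : ℝ) 8)) (symmDiff (Prod.mk x0 ⁻¹' polSet R) ∅) = 0 := by
    rw [Measure.restrict_apply' measurableSet_Ioo]
    refine measure_mono_null ?_ hx0
    rintro u ⟨h1, h2⟩
    rw [Set.mem_symmDiff] at h1
    have h3 : (1 : ℝ) < u := h2.1
    refine ⟨?_, show (0 : ℝ) < u by linarith⟩
    rcases h1 with h1 | h1
    · exact h1.1
    · exact absurd h1.1 (Set.notMem_empty _)
  have hW0 : volume W = 0 := by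
    refine le_antisymm (ENNReal.le_of_forall_pos_le_add fun ε hε _ => ?_) zero_le
    obtain ⟨q1, q2, hq1, hq12, hq21, hq⟩ := hg ∅ MeasurableSet.empty hT0 ε (by exact_mod_cast hε)
    have hq1p : 0 < q1 := by linarith
    have hv := vol_preimage_lin q1 0 0 q1 (by
      have : q1 * q1 - 0 * 0 = q1 ^ 2 := by ring
      rw [this]; positivity) W
    have e : q1 * q1 - 0 * 0 = q1 ^ 2 := by ring
    rw [e, abs_of_pos (by positivity)] at hv
    have hsub : (fun w : ℝ × ℝ => (q1 * w.1 + 0 * w.2, 0 * w.1 + q1 * w.2)) ⁻¹' W ⊆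
        badSet R ∅ 1 8 q1 q2 ∪ V := by
      rintro ⟨x, y⟩ ⟨⟨h1, h2⟩, h3, h4, h5⟩
      simp only [zero_mul, add_zero, zero_add] at h1 h2 h3 h4
      have hx := (mul_pos_iff_of_pos_left hq1p).1 h1
      have hy := (mul_pos_iff_of_pos_left hq1p).1 h2
      have h6 : (x, y) ∈ R' := by
        have e2 : (q1 * x + 0 * y) / ((q1 * x + 0 * y) + (0 * x + q1 * y)) = x / (x + y) := by
          have : x + y ≠ 0 := by positivity
          simp only [zero_mul, add_zero, zero_add]
          rw [← mul_add, mul_div_mul_left _ _ hq1p.ne']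
        have h7 : (q1 * x + 0 * y) / ((q1 * x + 0 * y) + (0 * x + q1 * y)) ∈ K := h5
        rw [e2] at h7
        exact h7
      by_cases hxy : (x, y) ∈ R
      · left
        refine ⟨hx, hy, ⟨?_, ?_⟩, ?_⟩
        · show 1 < q1 * x + q2 * y
          nlinarith
        · show q1 * x + q2 * y < 8
          nlinarith
        · simp [hxy]
      · right
        exact ⟨⟨hx, hy⟩, Set.mem_symmDiff.2 (Or.inr ⟨h6, hxy⟩)⟩
    have h7 : ENNReal.ofReal (q1 ^ 2)⁻¹ * volume W ≤ volume (badSet R ∅ 1 8 q1 q2) := by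
      rw [← hv]
      refine (measure_mono hsub).trans ((measure_union_le _ _).trans ?_)
      rw [hV0, add_zero]
    have hpos : 0 < q1 ^ 2 := by positivity
    calc volume W = ENNReal.ofReal (q1 ^ 2) * (ENNReal.ofReal (q1 ^ 2)⁻¹ * volume W) := by
          rw [← mul_assoc, ← ENNReal.ofReal_mul hpos.le, mul_inv_cancel₀ hpos.ne']
          simp
      _ ≤ ENNReal.ofReal (q1 * q2) * volume (badSet R ∅ 1 8 q1 q2) :=
          mul_le_mul' (ENNReal.ofReal_le_ofReal (by nlinarith)) h7
      _ ≤ ENNReal.ofReal ε := hq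
      _ = 0 + ε := by simp
  have hKnull : volume (K ∩ Set.Ioo (0 : ℝ) 1) = 0 := by
    have h1 := hW0
    have h2 : Measurable fun u : ℝ => volume {x : ℝ | (u * x, u * (1 - x)) ∈ W} :=
      measurable_measure_prodMk_right (polSet_meas hW)
    rw [polar W hW, lintegral_eq_zero_iff (by fun_prop)] at h1
    have : (ae (volume.restrict (Set.Ioo (2 : ℝ) 3))).NeBot := ae_restrict_neBot.2 (by simp; norm_num)
    obtain ⟨u, hu, hu23⟩ :=
      ((ae_restrict_of_ae h1).and (ae_restrict_mem measurableSet_Ioo)).exists (f := ae (volume.restrict (Set.Ioo (2 : ℝ) 3)))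
    have hu0 : 0 < u := by linarith [hu23.1]
    simp only [Pi.zero_apply, mul_eq_zero, ENNReal.ofReal_eq_zero, abs_nonpos_iff] at hu
    have h3 := hu.resolve_left hu0.ne'
    refine measure_mono_null ?_ h3
    rintro x ⟨hxK, hx0, hx1⟩
    have hu2 := hu23.1
    have hu3 := hu23.2
    refine ⟨⟨mul_pos hu0 hx0, mul_pos hu0 (by linarith)⟩, ?_, ?_, (hpolR' x u hu0).2 hxK⟩
    · show 1 < u * x + u * (1 - x)
      linarith
    · show u * x + 2 * (u * (1 - x)) < 8
      nlinarith
  refine polar_null (hR.meas.inter quad_meas) ?_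
  have h1 : ∀ᵐ x : ℝ, x ∉ K ∩ Set.Ioo (0 : ℝ) 1 := measure_eq_zero_iff_ae_notMem.1 hKnull
  filter_upwards [h1] with x hx
  by_cases hx01 : x ∈ Set.Ioo (0 : ℝ) 1
  · have hxK : x ∉ K := fun h => hx ⟨h, hx01⟩
    have h2 : volume ((Prod.mk x ⁻¹' polSet R) ∩ Set.Ioi 0) = 0 := by
      by_contra h; exact hxK h
    refine measure_mono_null ?_ h2
    rintro u ⟨h3, h4⟩
    exact ⟨h3, (quad_pol h4).2⟩
  · convert measure_empty (μ := (volume : Measure ℝ))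
    ext u
    simp only [Set.mem_empty_iff_false, iff_false]
    rintro ⟨hs, hq⟩
    exact hx01 (quad_pol hq).1

theorem euclid_ergodic {R : Set (ℝ × ℝ)} (hR : EInv R) :
    volume (R ∩ quad) = 0 ∨ volume (quad \ R) = 0 := by
  haveI : (ae (volume.restrict (Set.Ioo (0 : ℝ) 1))).NeBot := ae_restrict_neBot.2 (by simp)
  have h := (((homog_ae hR).and (good_points hR (r := 1) (s := 8) (by norm_num) (by norm_num))).and
    (good_points hR.compl (r := 1) (s := 8) (by norm_num) (by norm_num)))
  obtain ⟨x, ⟨⟨h1, h2⟩, h3⟩, hx⟩ :=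
    ((ae_restrict_of_ae h).and (ae_restrict_mem measurableSet_Ioo)).exists
      (f := ae (volume.restrict (Set.Ioo (0 : ℝ) 1)))
  rcases h1 hx with h4 | h4
  · left
    exact null_of_point hR h4 (h2 hx)
  · right
    have h5 : volume (Rᶜ ∩ quad) = 0 := by
      refine null_of_point hR.compl ?_ (h3 hx)
      refine measure_mono_null ?_ h4
      rintro u ⟨h6, h7⟩
      exact ⟨h7, h6⟩
    refine measure_mono_null ?_ h5
    rintro v ⟨h6, h7⟩
    exact ⟨h7, h6⟩


/-- A pair of functions over the two floors, compatible with the Euclidean induction. -/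
structure Coc (f g : ℝ → ℝ → ℝ → ℝ) : Prop where
  mf : ∀ a b, Measurable (f a b)
  mg : ∀ a b, Measurable (g a b)
  f0 : ∀ a b t, 0 ≤ f a b t
  f1 : ∀ a b t, f a b t ≤ 1
  g0 : ∀ a b t, 0 ≤ g a b t
  g1 : ∀ a b t, g a b t ≤ 1
  fR : ∀ a b t, 0 < a → 0 < b → 0 < t → t < a → f a (a + b) t = f a b t
  gR1 : ∀ a b t, 0 < a → 0 < b → 0 < t → t < a → g a (a + b) t = f a b t
  gR2 : ∀ a b t, 0 < a → 0 < b → a < t → t < a + b → g a (a + b) t = g a b (t - a)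
  gL : ∀ a b t, 0 < a → 0 < b → 0 < t → t < b → g (a + b) b t = g a b t
  fL1 : ∀ a b t, 0 < a → 0 < b → 0 < t → t < b → f (a + b) b t = g a b t
  fL2 : ∀ a b t, 0 < a → 0 < b → b < t → t < a + b → f (a + b) b t = f a b (t - b)

lemma Coc.swap {f g : ℝ → ℝ → ℝ → ℝ} (h : Coc f g) :
    Coc (fun a b t => g b a t) (fun a b t => f b a t) where
  mf a b := h.mg b a
  mg a b := h.mf b a
  f0 a b t := h.g0 b a t
  f1 a b t := h.g1 b a t
  g0 a b t := h.f0 b a t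
  g1 a b t := h.f1 b a t
  fR a b t ha hb h1 h2 := by rw [add_comm a b]; exact h.gL b a t hb ha h1 h2
  gR1 a b t ha hb h1 h2 := by rw [add_comm a b]; exact h.fL1 b a t hb ha h1 h2
  gR2 a b t ha hb h1 h2 := by
    rw [add_comm a b] at *; exact h.fL2 b a t hb ha h1 h2
  gL a b t ha hb h1 h2 := by rw [add_comm a b]; exact h.fR b a t hb ha h1 h2
  fL1 a b t ha hb h1 h2 := by rw [add_comm a b]; exact h.gR1 b a t hb ha h1 h2
  fL2 a b t ha hb h1 h2 := by
    rw [add_comm a b] at *; exact h.gR2 b a t hb ha h1 h2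

/-- The primitive of a function starting at zero. -/
noncomputable def prim (f : ℝ → ℝ) (s : ℝ) : ℝ := ∫ t in (0 : ℝ)..s, f t

lemma bdd_int {f : ℝ → ℝ} (hf : Measurable f) (h0 : ∀ t, 0 ≤ f t) (h1 : ∀ t, f t ≤ 1)
    (x y : ℝ) : IntervalIntegrable f volume x y := by
  refine (intervalIntegrable_const (c := (1 : ℝ))).mono_fun hf.aestronglyMeasurable ?_
  filter_upwards with t
  rw [Real.norm_of_nonneg (h0 t), norm_one]
  exact h1 t

lemma prim_nonneg {f : ℝ → ℝ} (h0 : ∀ t, 0 ≤ f t) {s : ℝ} (hs : 0 ≤ s) : 0 ≤ prim f s :=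
  intervalIntegral.integral_nonneg hs fun t _ => h0 t

lemma prim_le {f : ℝ → ℝ} (hf : Measurable f) (h0 : ∀ t, 0 ≤ f t) (h1 : ∀ t, f t ≤ 1)
    {s : ℝ} (hs : 0 ≤ s) : prim f s ≤ s := by
  have := intervalIntegral.integral_mono_on hs (bdd_int hf h0 h1 0 s)
    (intervalIntegrable_const (c := (1 : ℝ))) (fun t _ => h1 t)
  simpa [prim] using this

lemma prim_congr {f g : ℝ → ℝ} {s : ℝ} (hs : 0 ≤ s) (h : ∀ t, 0 < t → t < s → f t = g t) :
    prim f s = prim g s := by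
  unfold prim
  rw [intervalIntegral.integral_of_le hs, intervalIntegral.integral_of_le hs,
    integral_Ioc_eq_integral_Ioo, integral_Ioc_eq_integral_Ioo]
  exact setIntegral_congr_fun measurableSet_Ioo fun t ht => h t ht.1 ht.2

lemma prim_split {f g : ℝ → ℝ} (hf : Measurable f) (h0 : ∀ t, 0 ≤ f t) (h1 : ∀ t, f t ≤ 1)
    {a s : ℝ} (hs : a ≤ s) (h : ∀ t, a < t → t < s → f t = g (t - a)) :
    prim f s = prim f a + prim g (s - a) := by
  unfold prim
  rw [← intervalIntegral.integral_add_adjacent_intervals (bdd_int hf h0 h1 0 a)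
    (bdd_int hf h0 h1 a s)]
  congr 1
  have : ∫ t in a..s, f t = ∫ t in a..s, g (t - a) := by
    rw [intervalIntegral.integral_of_le hs, intervalIntegral.integral_of_le hs,
      integral_Ioc_eq_integral_Ioo, integral_Ioc_eq_integral_Ioo]
    exact setIntegral_congr_fun measurableSet_Ioo fun t ht => h t ht.1 ht.2
  rw [this, intervalIntegral.integral_comp_sub_right]
  simp

section
variable {f g : ℝ → ℝ → ℝ → ℝ} {a b : ℝ}

lemma Coc.pR (h : Coc f g) (ha : 0 < a) (hb : 0 < b) {s : ℝ} (h0 : 0 ≤ s) (h1 : s ≤ a) :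
    prim (f a (a + b)) s = prim (f a b) s :=
  prim_congr h0 fun t ht hts => h.fR a b t ha hb ht (by linarith)

lemma Coc.qR1 (h : Coc f g) (ha : 0 < a) (hb : 0 < b) {s : ℝ} (h0 : 0 ≤ s) (h1 : s ≤ a) :
    prim (g a (a + b)) s = prim (f a b) s :=
  prim_congr h0 fun t ht hts => h.gR1 a b t ha hb ht (by linarith)

lemma Coc.qR2 (h : Coc f g) (ha : 0 < a) (hb : 0 < b) {s : ℝ} (h0 : a ≤ s) (h1 : s ≤ a + b) :
    prim (g a (a + b)) s = prim (f a b) a + prim (g a b) (s - a) := by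
  rw [← h.qR1 ha hb ha.le le_rfl]
  exact prim_split (h.mg _ _) (h.g0 _ _) (h.g1 _ _) h0
    fun t ht hts => h.gR2 a b t ha hb ht (by linarith)

lemma Coc.qL (h : Coc f g) (ha : 0 < a) (hb : 0 < b) {s : ℝ} (h0 : 0 ≤ s) (h1 : s ≤ b) :
    prim (g (a + b) b) s = prim (g a b) s :=
  prim_congr h0 fun t ht hts => h.gL a b t ha hb ht (by linarith)

lemma Coc.pL1 (h : Coc f g) (ha : 0 < a) (hb : 0 < b) {s : ℝ} (h0 : 0 ≤ s) (h1 : s ≤ b) :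
    prim (f (a + b) b) s = prim (g a b) s :=
  prim_congr h0 fun t ht hts => h.fL1 a b t ha hb ht (by linarith)

lemma Coc.pL2 (h : Coc f g) (ha : 0 < a) (hb : 0 < b) {s : ℝ} (h0 : b ≤ s) (h1 : s ≤ a + b) :
    prim (f (a + b) b) s = prim (g a b) b + prim (f a b) (s - b) := by
  rw [← h.pL1 ha hb hb.le le_rfl]
  exact prim_split (h.mf _ _) (h.f0 _ _) (h.f1 _ _) h0
    fun t ht hts => h.fL2 a b t ha hb ht (by linarith)

/-- Points of the orbit get arbitrarily small. -/
lemma small_orbit (ha : 0 < a) (hb : 0 < b) (hi : Irrational (a / b)) {ε : ℝ} (hε : 0 < ε) :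
    ∃ m1 m2 m3 m4 x y : ℝ, EMon m1 m2 m3 m4 ∧ 0 < x ∧ 0 < y ∧
      m1 * x + m2 * y = a ∧ m3 * x + m4 * y = b ∧ x ≤ ε ∧ y ≤ ε := by
  obtain ⟨n, hn⟩ := exists_nat_gt ((a + b) / ε)
  rw [div_lt_iff₀ hε] at hn
  obtain ⟨m1, m2, m3, m4, x, y, hM, hx, hy, -, e1, e2, h1, h2, h3⟩ := cyl_exists ha hb hi n
  have hn0 : (0 : ℝ) ≤ n := Nat.cast_nonneg n
  have hs : (m1 + m3) * x + (m2 + m4) * y = a + b := by linarith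
  refine ⟨m1, m2, m3, m4, x, y, hM, hx, hy, e1, e2, ?_, ?_⟩
  · by_contra! hc
    nlinarith [mul_pos (show 0 < m2 + m4 by linarith) hy, mul_le_mul_of_nonneg_right h3 hx.le]
  · by_contra! hc
    nlinarith [mul_pos (show 0 < m1 + m3 by linarith) hx,
      mul_le_mul_of_nonneg_right (h3.trans h1) hy.le]

lemma Coc.det_zero (h : Coc f g) (ha : 0 < a) (hb : 0 < b) (hi : Irrational (a / b)) :
    prim (f a b) a * b = prim (g a b) b * a := by
  set D : ℝ → ℝ → ℝ := fun a b => prim (f a b) a * b - prim (g a b) b * a with hD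
  suffices hh : |D a b| ≤ 0 by
    have := abs_nonpos_iff.1 hh
    simp only [hD] at this
    linarith
  refine le_of_forall_pos_le_add fun ε hε => ?_
  obtain ⟨m1, m2, m3, m4, x, y, hM, hx, hy, e1, e2, hx1, hy1⟩ :=
    small_orbit ha hb hi (show 0 < min ε 1 by positivity)
  have key := hM.inv (fun x y => D x y = D a b) ?_ ?_ x y hx hy
  · rw [e1, e2] at key
    have h2 := key.1 rfl
    rw [← h2, zero_add]
    have hx2 := hx1.trans (min_le_left _ _)
    have hy2 := hy1.trans (min_le_right _ _)
    have p0 := prim_nonneg (h.f0 x y) hx.le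
    have q0 := prim_nonneg (h.g0 x y) hy.le
    have p1 := prim_le (h.mf x y) (h.f0 x y) (h.f1 x y) hx.le
    have q1 := prim_le (h.mg x y) (h.g0 x y) (h.g1 x y) hy.le
    simp only [hD]
    have hxy : x * y ≤ ε := by nlinarith
    rw [abs_le]
    constructor <;> nlinarith
  · intro a b ha hb
    have : D (a + b) b = D a b := by
      simp only [hD]
      rw [h.pL2 ha hb (by linarith) le_rfl, h.qL ha hb hb.le le_rfl, add_sub_cancel_right]
      ring
    simp only [this]
  · intro a b ha hb
    have : D a (a + b) = D a b := by
      simp only [hD]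
      rw [h.qR2 ha hb (by linarith) le_rfl, h.pR ha hb ha.le le_rfl, add_sub_cancel_left]
      ring
    simp only [this]

/-- Uniform closeness of the primitives to the linear function of slope `ρ`. -/
def Near (f g : ℝ → ℝ → ℝ → ℝ) (ρ C a b : ℝ) : Prop :=
  prim (f a b) a = ρ * a ∧ prim (g a b) b = ρ * b ∧
    (∀ s, 0 ≤ s → s ≤ a → |prim (f a b) s - ρ * s| ≤ C) ∧
    (∀ s, 0 ≤ s → s ≤ b → |prim (g a b) s - ρ * s| ≤ C)

lemma Coc.near_R (h : Coc f g) (ρ C : ℝ) (ha : 0 < a) (hb : 0 < b) :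
    Near f g ρ C a (a + b) ↔ Near f g ρ C a b := by
  have e1 := h.pR ha hb ha.le le_rfl
  have e2 := h.qR2 ha hb (show a ≤ a + b by linarith) le_rfl
  rw [add_sub_cancel_left] at e2
  constructor
  · rintro ⟨h1, h2, h3, h4⟩
    refine ⟨by linarith, by linarith, fun s hs hsa => ?_, fun s hs hsa => ?_⟩
    · rw [← h.pR ha hb hs hsa]; exact h3 s hs hsa
    · have := h4 (a + s) (by linarith) (by linarith)
      rw [h.qR2 ha hb (by linarith) (by linarith), add_sub_cancel_left] at this
      convert this using 2
      linarith
  · rintro ⟨h1, h2, h3, h4⟩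
    refine ⟨by linarith, by linarith, fun s hs hsa => ?_, fun s hs hsa => ?_⟩
    · rw [h.pR ha hb hs hsa]; exact h3 s hs hsa
    · rcases le_total s a with hc | hc
      · rw [h.qR1 ha hb hs hc]; exact h3 s hs hc
      · rw [h.qR2 ha hb hc hsa]
        convert h4 (s - a) (by linarith) (by linarith) using 2
        linarith

lemma near_swap {ρ C : ℝ} :
    Near (fun a b t => g b a t) (fun a b t => f b a t) ρ C b a ↔ Near f g ρ C a b := by
  unfold Near
  tauto

lemma Coc.near_L (h : Coc f g) (ρ C : ℝ) (ha : 0 < a) (hb : 0 < b) :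
    Near f g ρ C (a + b) b ↔ Near f g ρ C a b := by
  rw [← near_swap, ← near_swap (a := a), add_comm a b]
  exact h.swap.near_R ρ C hb ha

lemma Coc.near_zero (h : Coc f g) (ha : 0 < a) (hb : 0 < b) (hi : Irrational (a / b)) :
    ∃ ρ, Near f g ρ 0 a b := by
  have hdet := h.det_zero ha hb hi
  set ρ := prim (f a b) a / a with hρ
  have hA : prim (f a b) a = ρ * a := by rw [hρ]; field_simp
  have hB : prim (g a b) b = ρ * b := by
    rw [hρ]; field_simp; linarith
  have hρ0 : 0 ≤ ρ := div_nonneg (prim_nonneg (h.f0 a b) ha.le) ha.le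
  have hρ1 : ρ ≤ 1 := by
    rw [hρ, div_le_one ha]; exact prim_le (h.mf a b) (h.f0 a b) (h.f1 a b) ha.le
  have main : ∀ ε, 0 < ε → Near f g ρ ε a b := by
    intro ε hε
    obtain ⟨m1, m2, m3, m4, x, y, hM, hx, hy, e1, e2, hx1, hy1⟩ := small_orbit ha hb hi hε
    -- the slope is the same along the orbit
    have k1 := hM.inv (fun a b => prim (f a b) a = ρ * a ∧ prim (g a b) b = ρ * b) ?_ ?_
      x y hx hy
    · rw [e1, e2] at k1
      obtain ⟨l1, l2⟩ := k1.1 ⟨hA, hB⟩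
      have k2 := hM.inv (Near f g ρ ε) (fun a b ha hb => h.near_L ρ ε ha hb)
        (fun a b ha hb => h.near_R ρ ε ha hb) x y hx hy
      rw [e1, e2] at k2
      refine k2.2 ⟨l1, l2, fun s hs hsx => ?_, fun s hs hsy => ?_⟩
      · have p0 := prim_nonneg (h.f0 x y) hs
        have p1 := prim_le (h.mf x y) (h.f0 x y) (h.f1 x y) hs
        rw [abs_le]; constructor <;> nlinarith
      · have p0 := prim_nonneg (h.g0 x y) hs
        have p1 := prim_le (h.mg x y) (h.g0 x y) (h.g1 x y) hs
        rw [abs_le]; constructor <;> nlinarith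
    · intro a b ha hb
      have e1 := h.qL ha hb hb.le le_rfl
      have e2 := h.pL2 ha hb (show b ≤ a + b by linarith) le_rfl
      rw [add_sub_cancel_right] at e2
      rw [e1, e2]
      constructor <;> rintro ⟨h1, h2⟩ <;> constructor <;> linarith
    · intro a b ha hb
      have e1 := h.pR ha hb ha.le le_rfl
      have e2 := h.qR2 ha hb (show a ≤ a + b by linarith) le_rfl
      rw [add_sub_cancel_left] at e2
      rw [e1, e2]
      constructor <;> rintro ⟨h1, h2⟩ <;> constructor <;> linarith
  refine ⟨ρ, hA, hB, fun s hs hsa => le_of_forall_pos_le_add fun ε hε => ?_,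
    fun s hs hsa => le_of_forall_pos_le_add fun ε hε => ?_⟩
  · rw [zero_add]; exact (main ε hε).2.2.1 s hs hsa
  · rw [zero_add]; exact (main ε hε).2.2.2 s hs hsa

end

lemma ae_const_of_prim {f : ℝ → ℝ} (hf : Measurable f) (h0 : ∀ t, 0 ≤ f t)
    (h1 : ∀ t, f t ≤ 1) {a ρ : ℝ} (ha : 0 < a)
    (h : ∀ s, 0 ≤ s → s ≤ a → |prim f s - ρ * s| ≤ 0) :
    ∀ᵐ t : ℝ, t ∈ Set.Ioo 0 a → f t = ρ := by
  filter_upwards [(bdd_int hf h0 h1 0 a).ae_hasDerivAt_integral] with t ht hta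
  have hd := ht (by rw [Set.uIcc_of_le ha.le]; exact ⟨hta.1.le, hta.2.le⟩) 0
    (by simp)
  have hd2 : HasDerivAt (fun s : ℝ => ρ * s) (ρ * 1) t := (hasDerivAt_id t).const_mul ρ
  have he : (fun s : ℝ => ρ * s) =ᶠ[nhds t] fun s => ∫ u in (0 : ℝ)..s, f u := by
    filter_upwards [isOpen_Ioo.mem_nhds hta] with s hs
    have := abs_nonpos_iff.1 (h s hs.1.le hs.2.le)
    unfold prim at this
    linarith
  have := (hd.congr_of_eventuallyEq he).unique hd2
  linarith

lemma Coc.ae_const {f g : ℝ → ℝ → ℝ → ℝ} {a b : ℝ} (h : Coc f g) (ha : 0 < a) (hb : 0 < b)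
    (hi : Irrational (a / b)) :
    ∃ ρ, (∀ᵐ t : ℝ, t ∈ Set.Ioo 0 a → f a b t = ρ) ∧
      (∀ᵐ t : ℝ, t ∈ Set.Ioo 0 b → g a b t = ρ) := by
  obtain ⟨ρ, -, -, h1, h2⟩ := h.near_zero ha hb hi
  exact ⟨ρ, ae_const_of_prim (h.mf _ _) (h.f0 _ _) (h.f1 _ _) ha h1,
    ae_const_of_prim (h.mg _ _) (h.g0 _ _) (h.g1 _ _) hb h2⟩

lemma slab_null {S : Set (ℝ × ℝ × ℝ)} (hS : MeasurableSet S)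
    (h : ∀ᵐ v : ℝ × ℝ, volume {t : ℝ | (t, v) ∈ S} = 0) : volume S = 0 := by
  rw [Measure.volume_eq_prod, Measure.prod_apply_symm hS]
  exact (lintegral_congr_ae h).trans (by simp)

/-- An invertible linear change of variables preserves null sets. -/
lemma null_lin (L K : ℝ × ℝ × ℝ →ₗ[ℝ] ℝ × ℝ × ℝ) (h1 : ∀ x, K (L x) = x)
    (h2 : ∀ x, L (K x) = x) {s : Set (ℝ × ℝ × ℝ)} (hs : volume s = 0) :
    volume (L ⁻¹' s) = 0 := by
  have hd : LinearMap.det L ≠ 0 := by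
    have h3 : K ∘ₗ L = LinearMap.id := LinearMap.ext h1
    intro h0
    have := congrArg LinearMap.det h3
    rw [LinearMap.det_comp, h0, LinearMap.det_id] at this
    simp at this
  have i2 : (volume : Measure (ℝ × ℝ)).IsAddHaarMeasure := Measure.prod.instIsAddHaarMeasure _ _
  have i3 : (volume : Measure (ℝ × ℝ × ℝ)).IsAddHaarMeasure :=
    Measure.prod.instIsAddHaarMeasure _ _
  rw [Measure.addHaar_preimage_linearMap _ hd, hs, mul_zero]

/-- Coordinates in `ℝ³` as linear maps. -/
def c1 : ℝ × ℝ × ℝ →ₗ[ℝ] ℝ := LinearMap.fst ℝ ℝ (ℝ × ℝ)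
/-- Second coordinate. -/
def c2 : ℝ × ℝ × ℝ →ₗ[ℝ] ℝ := LinearMap.fst ℝ ℝ ℝ ∘ₗ LinearMap.snd ℝ ℝ (ℝ × ℝ)
/-- Third coordinate. -/
def c3 : ℝ × ℝ × ℝ →ₗ[ℝ] ℝ := LinearMap.snd ℝ ℝ ℝ ∘ₗ LinearMap.snd ℝ ℝ (ℝ × ℝ)

lemma c1_apply (x : ℝ × ℝ × ℝ) : c1 x = x.1 := rfl
lemma c2_apply (x : ℝ × ℝ × ℝ) : c2 x = x.2.1 := rfl
lemma c3_apply (x : ℝ × ℝ × ℝ) : c3 x = x.2.2 := rfl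

lemma ae_coord : ∀ᵐ x : ℝ × ℝ × ℝ, x.1 ≠ 0 ∧ x.2.1 ≠ 0 ∧ x.2.2 ≠ 0 := by
  have h0 : ∀ᵐ x : ℝ, x ≠ 0 := by simp [ae_iff]
  have h1 : ∀ᵐ x : ℝ × ℝ × ℝ, x.1 ≠ 0 :=
    (Measure.quasiMeasurePreserving_fst (μ := volume) (ν := volume)).ae h0
  have h2 : ∀ᵐ x : ℝ × ℝ, x.1 ≠ 0 :=
    (Measure.quasiMeasurePreserving_fst (μ := volume) (ν := volume)).ae h0
  have h3 : ∀ᵐ x : ℝ × ℝ, x.2 ≠ 0 :=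
    (Measure.quasiMeasurePreserving_snd (μ := volume) (ν := volume)).ae h0
  have h4 : ∀ᵐ x : ℝ × ℝ × ℝ, x.2.1 ≠ 0 :=
    (Measure.quasiMeasurePreserving_snd (μ := volume) (ν := volume)).ae h2
  have h5 : ∀ᵐ x : ℝ × ℝ × ℝ, x.2.2 ≠ 0 :=
    (Measure.quasiMeasurePreserving_snd (μ := volume) (ν := volume)).ae h3
  filter_upwards [h1, h4, h5] with x a b c using ⟨a, b, c⟩

lemma irr_meas : MeasurableSet {x : ℝ | Irrational x} :=
  (Set.countable_range ((↑) : ℚ → ℝ)).measurableSet.compl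

lemma ae_irr_div : ∀ᵐ v : ℝ × ℝ, v ∈ quad → Irrational (v.1 / v.2) := by
  have hm : MeasurableSet {v : ℝ × ℝ | ¬ (v ∈ quad → Irrational (v.1 / v.2))} := by
    have : {v : ℝ × ℝ | ¬ (v ∈ quad → Irrational (v.1 / v.2))} =
        quad \ ((fun v : ℝ × ℝ => v.1 / v.2) ⁻¹' {x : ℝ | Irrational x}) := by
      ext v; simp
    rw [this]
    exact quad_meas.diff (irr_meas.preimage (by fun_prop))
  rw [ae_iff, Measure.volume_eq_prod, Measure.prod_apply_symm hm, lintegral_eq_zero_iff]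
  · filter_upwards with y
    refine Set.Countable.measure_zero ?_ _
    refine (Set.countable_range (fun q : ℚ => (q : ℝ) * y)).mono ?_
    intro x hx
    simp only [Set.mem_preimage, Set.mem_ofPred_eq, Classical.not_imp] at hx
    obtain ⟨⟨hx0, hy0⟩, hi⟩ := hx
    simp only [Irrational, not_not] at hi
    obtain ⟨q, hq⟩ := hi
    refine ⟨q, ?_⟩
    simp only at hq hy0 ⊢
    rw [hq]; field_simp
  · exact measurable_measure_prodMk_right hm

lemma exists_of_ae_Ioo {a : ℝ} (ha : 0 < a) {P : ℝ → Prop}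
    (h : ∀ᵐ t : ℝ, t ∈ Set.Ioo 0 a → P t) : ∃ t ∈ Set.Ioo 0 a, P t := by
  by_contra! hc
  have : volume (Set.Ioo 0 a) = 0 := by
    refine measure_mono_null ?_ h
    intro t ht hh
    exact hc t ht (hh ht)
  simp at this
  linarith

/-- The invariance hypothesis, pointwise. -/
def RInv (A : Set ((ℝ × ℝ × ℝ) × Fin 3)) : Prop :=
  ∀ x ∈ posCone3, ∀ σ : Fin 3, (rauzy3 (x, σ) ∈ A ↔ (x, σ) ∈ A)

lemma rz0 {x1 x2 x3 : ℝ} (h : x1 ≤ x3) : rauzy3 ((x1, x2, x3), 0) = ((x1, x2, x3 - x1), 0) := by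
  simp [rauzy3, h]
lemma rz0' {x1 x2 x3 : ℝ} (h : x3 < x1) : rauzy3 ((x1, x2, x3), 0) = ((x1 - x3, x3, x2), 1) := by
  simp [rauzy3, not_le.2 h]
lemma rz1 {x1 x2 x3 : ℝ} (h : x1 ≤ x3) : rauzy3 ((x1, x2, x3), 1) = ((x1, x2, x3 - x1), 2) := by
  simp [rauzy3, h]
lemma rz1' {x1 x2 x3 : ℝ} (h : x3 < x1) : rauzy3 ((x1, x2, x3), 1) = ((x1 - x3, x3, x2), 0) := by
  simp [rauzy3, not_le.2 h]
lemma rz2 {x1 x2 x3 : ℝ} (h : x2 ≤ x3) : rauzy3 ((x1, x2, x3), 2) = ((x1, x2, x3 - x2), 1) := by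
  simp [rauzy3, h]
lemma rz2' {x1 x2 x3 : ℝ} (h : x3 < x2) : rauzy3 ((x1, x2, x3), 2) = ((x1, x2 - x3, x3), 2) := by
  simp [rauzy3, not_le.2 h]

lemma rauzy3_cone {x : ℝ × ℝ × ℝ} (hx : x ∈ posCone3) (σ : Fin 3) :
    (rauzy3 (x, σ)).1 ∈ posCone3 := by
  obtain ⟨x1, x2, x3⟩ := x
  obtain ⟨h1, h2, h3⟩ := hx
  simp only at h1 h2 h3
  fin_cases σ
  · rcases le_or_gt x1 x3 with h | h
    · simp only [Fin.zero_eta, rz0 h]; exact ⟨h1, h2, by simp [h]⟩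
    · simp only [Fin.zero_eta, rz0' h]; exact ⟨by simp [h.le], h3, h2⟩
  · rcases le_or_gt x1 x3 with h | h
    · simp only [Fin.mk_one, rz1 h]; exact ⟨h1, h2, by simp [h]⟩
    · simp only [Fin.mk_one, rz1' h]; exact ⟨by simp [h.le], h3, h2⟩
  · rcases le_or_gt x2 x3 with h | h
    · simp only [Fin.reduceFinMk, rz2 h]; exact ⟨h1, h2, by simp [h]⟩
    · simp only [Fin.reduceFinMk, rz2' h]; exact ⟨h1, by simp [h.le], h3⟩

lemma RInv.compl {A : Set ((ℝ × ℝ × ℝ) × Fin 3)} (h : RInv A) :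
    RInv (posCone3 ×ˢ (Set.univ : Set (Fin 3)) \ A) := by
  intro x hx σ
  have h1 := h x hx σ
  have h2 := rauzy3_cone hx σ
  simp only [Set.mem_sdiff, Set.mem_prod, Set.mem_univ, and_true]
  tauto

section
variable {A : Set ((ℝ × ℝ × ℝ) × Fin 3)}

lemma RInv.m (h : RInv A) {x1 x2 x3 : ℝ} (h1 : 0 ≤ x1) (h2 : 0 ≤ x2) (h3 : 0 ≤ x3)
    (σ : Fin 3) : ((x1, x2, x3), σ) ∈ A ↔ rauzy3 ((x1, x2, x3), σ) ∈ A :=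
  (h (x1, x2, x3) ⟨h1, h2, h3⟩ σ).symm

/-- First floor: label `(312)`. -/
def FA (A : Set ((ℝ × ℝ × ℝ) × Fin 3)) (a b t : ℝ) : Prop := ((a - t, t, b), (2 : Fin 3)) ∈ A
/-- Second floor: label `(231)`. -/
def FB (A : Set ((ℝ × ℝ × ℝ) × Fin 3)) (a b t : ℝ) : Prop := ((a, b - t, t), (0 : Fin 3)) ∈ A

open Classical in
/-- Indicator of the first floor. -/
noncomputable def iA (A : Set ((ℝ × ℝ × ℝ) × Fin 3)) (a b t : ℝ) : ℝ := if FA A a b t then 1 else 0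
open Classical in
/-- Indicator of the second floor. -/
noncomputable def iB (A : Set ((ℝ × ℝ × ℝ) × Fin 3)) (a b t : ℝ) : ℝ := if FB A a b t then 1 else 0

lemma slice_meas (hA : MeasurableSet A) (σ : Fin 3) :
    MeasurableSet {x : ℝ × ℝ × ℝ | (x, σ) ∈ A} :=
  hA.preimage (by fun_prop : Measurable fun x : ℝ × ℝ × ℝ => (x, σ))

lemma iA_congr {a b t a' b' t' : ℝ} (h : FA A a b t ↔ FA A a' b' t') :
    iA A a b t = iA A a' b' t' := by
  unfold iA; split_ifs <;> tauto
lemma iB_congr {a b t a' b' t' : ℝ} (h : FB A a b t ↔ FB A a' b' t') :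
    iB A a b t = iB A a' b' t' := by
  unfold iB; split_ifs <;> tauto
lemma iAB_congr {a b t a' b' t' : ℝ} (h : FA A a b t ↔ FB A a' b' t') :
    iA A a b t = iB A a' b' t' := by
  unfold iA iB; split_ifs <;> tauto

lemma coc (hA : MeasurableSet A) (h : RInv A) : Coc (iA A) (iB A) where
  mf a b := by
    refine Measurable.ite ?_ measurable_const measurable_const
    exact (slice_meas hA 2).preimage (by fun_prop : Measurable fun t : ℝ => (a - t, t, b))
  mg a b := by
    refine Measurable.ite ?_ measurable_const measurable_const
    exact (slice_meas hA 0).preimage (by fun_prop : Measurable fun t : ℝ => (a, b - t, t))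
  f0 a b t := by unfold iA; split_ifs <;> norm_num
  f1 a b t := by unfold iA; split_ifs <;> norm_num
  g0 a b t := by unfold iB; split_ifs <;> norm_num
  g1 a b t := by unfold iB; split_ifs <;> norm_num
  fR a b t ha hb h1 h2 := by
    refine iA_congr ?_
    unfold FA
    rw [h.m (by linarith) (by linarith) (by linarith), rz2 (by linarith),
      h.m (by linarith) (by linarith) (by linarith), rz1 (by linarith)]
    ring_nf
  gR1 a b t ha hb h1 h2 := by
    refine (iAB_congr ?_).symm
    unfold FA FB
    rw [h.m (x1 := a) (by linarith) (by linarith) (by linarith), rz0' (by linarith),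
      h.m (x3 := a + b - t) (by linarith) (by linarith) (by linarith), rz1 (by linarith)]
    ring_nf
  gR2 a b t ha hb h1 h2 := by
    refine iB_congr ?_
    unfold FB
    rw [h.m (by linarith) (by linarith) (by linarith), rz0 (by linarith)]
    ring_nf
  gL a b t ha hb h1 h2 := by
    refine iB_congr ?_
    unfold FB
    rw [h.m (by linarith) (by linarith) (by linarith), rz0' (by linarith),
      h.m (by linarith) (by linarith) (by linarith), rz1' (by linarith)]
    ring_nf
  fL1 a b t ha hb h1 h2 := by
    refine iAB_congr ?_
    unfold FA FB
    rw [h.m (x3 := b) (by linarith) (by linarith) (by linarith), rz2 (by linarith),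
      h.m (x3 := b - t) (by linarith) (by linarith) (by linarith), rz1' (by linarith)]
    ring_nf
  fL2 a b t ha hb h1 h2 := by
    refine iA_congr ?_
    unfold FA
    rw [h.m (by linarith) (by linarith) (by linarith), rz2' (by linarith)]
    ring_nf

/-- If almost all fibres are null then every slice is null. -/
lemma null_case (hA : MeasurableSet A) (hi : RInv A)
    (h : ∀ᵐ v : ℝ × ℝ, v ∈ quad → (∀ᵐ t : ℝ, t ∈ Set.Ioo 0 v.1 → ¬ FA A v.1 v.2 t) ∧
      (∀ᵐ t : ℝ, t ∈ Set.Ioo 0 v.2 → ¬ FB A v.1 v.2 t)) (σ : Fin 3) :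
    volume {x : ℝ × ℝ × ℝ | x ∈ posCone3 ∧ (x, σ) ∈ A} = 0 := by
  have open_suff : ∀ (σ : Fin 3),
      volume {x : ℝ × ℝ × ℝ | (0 < x.1 ∧ 0 < x.2.1 ∧ 0 < x.2.2) ∧ (x, σ) ∈ A} = 0 →
      volume {x : ℝ × ℝ × ℝ | x ∈ posCone3 ∧ (x, σ) ∈ A} = 0 := by
    intro σ h0
    refine measure_mono_null ?_ (measure_union_null h0 (ae_iff.1 ae_coord))
    rintro x ⟨⟨h1, h2, h3⟩, hx⟩
    by_cases hc : x.1 ≠ 0 ∧ x.2.1 ≠ 0 ∧ x.2.2 ≠ 0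
    · exact Or.inl ⟨⟨h1.lt_of_ne' hc.1, h2.lt_of_ne' hc.2.1, h3.lt_of_ne' hc.2.2⟩, hx⟩
    · exact Or.inr hc
  have n2 : volume {x : ℝ × ℝ × ℝ | x ∈ posCone3 ∧ (x, (2 : Fin 3)) ∈ A} = 0 := by
    apply open_suff
    have hS : volume {p : ℝ × ℝ × ℝ | (0 < p.1 ∧ p.1 < p.2.1 ∧ 0 < p.2.2) ∧
        FA A p.2.1 p.2.2 p.1} = 0 := by
      refine slab_null ?_ ?_
      · refine MeasurableSet.inter ?_ ?_
        · have m0 : MeasurableSet {p : ℝ × ℝ × ℝ | 0 < p.1} :=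
            measurableSet_lt (by fun_prop) (by fun_prop)
          have m1 : MeasurableSet {p : ℝ × ℝ × ℝ | p.1 < p.2.1} :=
            measurableSet_lt (by fun_prop) (by fun_prop)
          have m2 : MeasurableSet {p : ℝ × ℝ × ℝ | 0 < p.2.2} :=
            measurableSet_lt (by fun_prop) (by fun_prop)
          exact m0.inter (m1.inter m2)
        · exact (slice_meas hA 2).preimage
            (by fun_prop : Measurable fun p : ℝ × ℝ × ℝ => (p.2.1 - p.1, p.1, p.2.2))
      · filter_upwards [h] with v hv
        by_cases hq : v ∈ quad
        · refine measure_mono_null ?_ (ae_iff.1 (hv hq).1)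
          rintro t ⟨⟨h1, h2, h3⟩, h4⟩ hh
          exact hh ⟨h1, h2⟩ h4
        · convert measure_empty (μ := (volume : Measure ℝ))
          ext t
          simp only [Set.mem_ofPred_eq, Set.mem_empty_iff_false, iff_false]
          rintro ⟨⟨h1, h2, h3⟩, h4⟩
          exact hq ⟨h1.trans h2, h3⟩
    refine measure_mono_null ?_ (null_lin (c2.prod ((c1 + c2).prod c3))
      ((c2 - c1).prod (c1.prod c3)) ?_ ?_ hS)
    · rintro ⟨x1, x2, x3⟩ ⟨⟨h1, h2, h3⟩, h4⟩
      simp only at h1 h2 h3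
      refine ⟨⟨h2, ?_, h3⟩, ?_⟩
      · change x2 < x1 + x2
        linarith
      · change ((x1 + x2 - x2, x2, x3), (2 : Fin 3)) ∈ A
        rwa [add_sub_cancel_right]
    · rintro ⟨x1, x2, x3⟩
      simp [c1_apply, c2_apply, c3_apply]
    · rintro ⟨x1, x2, x3⟩
      simp [c1_apply, c2_apply, c3_apply]
  have n0 : volume {x : ℝ × ℝ × ℝ | x ∈ posCone3 ∧ (x, (0 : Fin 3)) ∈ A} = 0 := by
    apply open_suff
    have hS : volume {p : ℝ × ℝ × ℝ | (0 < p.1 ∧ p.1 < p.2.2 ∧ 0 < p.2.1) ∧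
        FB A p.2.1 p.2.2 p.1} = 0 := by
      refine slab_null ?_ ?_
      · refine MeasurableSet.inter ?_ ?_
        · have m0 : MeasurableSet {p : ℝ × ℝ × ℝ | 0 < p.1} :=
            measurableSet_lt (by fun_prop) (by fun_prop)
          have m1 : MeasurableSet {p : ℝ × ℝ × ℝ | p.1 < p.2.2} :=
            measurableSet_lt (by fun_prop) (by fun_prop)
          have m2 : MeasurableSet {p : ℝ × ℝ × ℝ | 0 < p.2.1} :=
            measurableSet_lt (by fun_prop) (by fun_prop)
          exact m0.inter (m1.inter m2)
        · exact (slice_meas hA 0).preimage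
            (by fun_prop : Measurable fun p : ℝ × ℝ × ℝ => (p.2.1, p.2.2 - p.1, p.1))
      · filter_upwards [h] with v hv
        by_cases hq : v ∈ quad
        · refine measure_mono_null ?_ (ae_iff.1 (hv hq).2)
          rintro t ⟨⟨h1, h2, h3⟩, h4⟩ hh
          exact hh ⟨h1, h2⟩ h4
        · convert measure_empty (μ := (volume : Measure ℝ))
          ext t
          simp only [Set.mem_ofPred_eq, Set.mem_empty_iff_false, iff_false]
          rintro ⟨⟨h1, h2, h3⟩, h4⟩
          exact hq ⟨h3, h1.trans h2⟩
    refine measure_mono_null ?_ (null_lin (c3.prod (c1.prod (c2 + c3)))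
      (c2.prod ((c3 - c1).prod c1)) ?_ ?_ hS)
    · rintro ⟨x1, x2, x3⟩ ⟨⟨h1, h2, h3⟩, h4⟩
      simp only at h1 h2 h3
      refine ⟨⟨h3, ?_, h1⟩, ?_⟩
      · change x3 < x2 + x3
        linarith
      · change ((x1, x2 + x3 - x3, x3), (0 : Fin 3)) ∈ A
        rwa [add_sub_cancel_right]
    · rintro ⟨x1, x2, x3⟩
      simp [c1_apply, c2_apply, c3_apply]
    · rintro ⟨x1, x2, x3⟩
      simp [c1_apply, c2_apply, c3_apply]
  have n1 : volume {x : ℝ × ℝ × ℝ | x ∈ posCone3 ∧ (x, (1 : Fin 3)) ∈ A} = 0 := by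
    refine measure_mono_null ?_ (measure_union_null
      (null_lin (c1.prod (c2.prod (c3 - c1))) (c1.prod (c2.prod (c3 + c1))) ?_ ?_ n2)
      (null_lin ((c1 - c3).prod (c3.prod c2)) ((c1 + c2).prod (c3.prod c2)) ?_ ?_ n0))
    · rintro ⟨x1, x2, x3⟩ ⟨hx, h4⟩
      have hcone := rauzy3_cone hx 1
      rw [← hi _ hx] at h4
      rcases le_or_gt x1 x3 with hc | hc
      · rw [rz1 hc] at h4 hcone
        exact Or.inl ⟨hcone, h4⟩
      · rw [rz1' hc] at h4 hcone
        exact Or.inr ⟨hcone, h4⟩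
    all_goals
      rintro ⟨x1, x2, x3⟩
      simp [c1_apply, c2_apply, c3_apply]
  fin_cases σ
  exacts [n0, n1, n2]

/-- Parameters over which the fibre of `A` is not null. -/
def RSet (A : Set ((ℝ × ℝ × ℝ) × Fin 3)) : Set (ℝ × ℝ) :=
  {v | v ∈ quad ∧ Irrational (v.1 / v.2) ∧ volume {t : ℝ | t ∈ Set.Ioo 0 v.1 ∧ FA A v.1 v.2 t} ≠ 0}

lemma RSet_meas (hA : MeasurableSet A) : MeasurableSet (RSet A) := by
  refine quad_meas.inter ((irr_meas.preimage
    (by fun_prop : Measurable fun v : ℝ × ℝ => v.1 / v.2)).inter ?_)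
  have hS : MeasurableSet {p : (ℝ × ℝ) × ℝ | p.2 ∈ Set.Ioo 0 p.1.1 ∧ FA A p.1.1 p.1.2 p.2} := by
    refine MeasurableSet.inter ?_ ?_
    · have m0 : MeasurableSet {p : (ℝ × ℝ) × ℝ | 0 < p.2} :=
        measurableSet_lt (by fun_prop) (by fun_prop)
      have m1 : MeasurableSet {p : (ℝ × ℝ) × ℝ | p.2 < p.1.1} :=
        measurableSet_lt (by fun_prop) (by fun_prop)
      exact m0.inter m1
    · exact (slice_meas hA 2).preimage
        (by fun_prop : Measurable fun p : (ℝ × ℝ) × ℝ => (p.1.1 - p.2, p.2, p.1.2))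
  exact (measurable_measure_prodMk_left (ν := (volume : Measure ℝ)) hS)
    (measurableSet_singleton 0).compl

/-- On a good fibre everything is constant; membership in `RSet` decides the constant. -/
lemma fibre_cases (hA : MeasurableSet A) (hi : RInv A) {a b : ℝ} (ha : 0 < a) (hb : 0 < b)
    (hab : Irrational (a / b)) :
    ((a, b) ∈ RSet A ∧ (∀ᵐ t : ℝ, t ∈ Set.Ioo 0 a → FA A a b t) ∧
      (∀ᵐ t : ℝ, t ∈ Set.Ioo 0 b → FB A a b t)) ∨
    ((a, b) ∉ RSet A ∧ (∀ᵐ t : ℝ, t ∈ Set.Ioo 0 a → ¬ FA A a b t) ∧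
      (∀ᵐ t : ℝ, t ∈ Set.Ioo 0 b → ¬ FB A a b t)) := by
  obtain ⟨ρ, h1, h2⟩ := (coc hA hi).ae_const ha hb hab
  obtain ⟨t, ht, e⟩ := exists_of_ae_Ioo ha h1
  by_cases hf : FA A a b t
  · have hρ : ρ = 1 := by rw [← e]; simp [iA, hf]
    have h3 : ∀ᵐ t : ℝ, t ∈ Set.Ioo 0 a → FA A a b t := by
      filter_upwards [h1] with s hs hsa
      by_contra hc
      have := hs hsa
      simp [iA, hc, hρ] at this
    refine Or.inl ⟨⟨⟨ha, hb⟩, hab, fun h0 => ?_⟩, h3, ?_⟩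
    · have h4 : ∀ᵐ t : ℝ, t ∈ Set.Ioo 0 a → False := by
        filter_upwards [h3, measure_eq_zero_iff_ae_notMem.1 h0] with s hs hs2 hsa
        exact hs2 ⟨hsa, hs hsa⟩
      obtain ⟨_, _, hF⟩ := exists_of_ae_Ioo ha h4
      exact hF
    · filter_upwards [h2] with s hs hsa
      by_contra hc
      have := hs hsa
      simp [iB, hc, hρ] at this
  · have hρ : ρ = 0 := by rw [← e]; simp [iA, hf]
    have h3 : ∀ᵐ t : ℝ, t ∈ Set.Ioo 0 a → ¬ FA A a b t := by
      filter_upwards [h1] with s hs hsa hc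
      have := hs hsa
      simp [iA, hc, hρ] at this
    refine Or.inr ⟨fun hR => hR.2.2 ?_, h3, ?_⟩
    · rw [measure_eq_zero_iff_ae_notMem]
      filter_upwards [h3] with s hs hc
      exact hs hc.1 hc.2
    · filter_upwards [h2] with s hs hsa hc
      have := hs hsa
      simp [iB, hc, hρ] at this

lemma FA_iff_iA {a b t : ℝ} : FA A a b t ↔ iA A a b t = 1 := by
  unfold iA; split_ifs with h <;> simp [h]
lemma FB_iff_iB {a b t : ℝ} : FB A a b t ↔ iB A a b t = 1 := by
  unfold iB; split_ifs with h <;> simp [h]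

lemma irr_L {a b : ℝ} (hb : 0 < b) : Irrational ((a + b) / b) ↔ Irrational (a / b) := by
  have : (a + b) / b = a / b + (1 : ℕ) := by field_simp; simp
  rw [this, irrational_add_natCast_iff]

lemma irr_R {a b : ℝ} (ha : 0 < a) : Irrational (a / (a + b)) ↔ Irrational (a / b) := by
  have h := irr_L (a := b) ha
  rw [add_comm a b]
  exact ⟨fun h1 => irr_swap (h.1 (irr_swap h1)), fun h1 => irr_swap (h.2 (irr_swap h1))⟩

lemma RSet_inv (hA : MeasurableSet A) (hi : RInv A) : EInv (RSet A) where
  meas := RSet_meas hA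
  inv1 a b ha hb := by
    by_cases hab : Irrational (a / b)
    · have hab' := (irr_L hb).2 hab
      rcases fibre_cases hA hi ha hb hab with ⟨r, -, h1⟩ | ⟨r, -, h1⟩ <;>
      rcases fibre_cases hA hi (add_pos ha hb) hb hab' with ⟨r', -, h1'⟩ | ⟨r', -, h1'⟩
      · exact iff_of_true r' r
      · exfalso
        obtain ⟨t, ht, e1, e2⟩ := exists_of_ae_Ioo hb (by
          filter_upwards [h1, h1'] with t g1 g2 ht using And.intro (g1 ht) (g2 ht))
        rw [FB_iff_iB] at e1 e2
        exact e2 (by rw [(coc hA hi).gL a b t ha hb ht.1 ht.2, e1])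
      · exfalso
        obtain ⟨t, ht, e1, e2⟩ := exists_of_ae_Ioo hb (by
          filter_upwards [h1, h1'] with t g1 g2 ht using And.intro (g1 ht) (g2 ht))
        rw [FB_iff_iB] at e1 e2
        exact e1 (by rw [← (coc hA hi).gL a b t ha hb ht.1 ht.2, e2])
      · exact iff_of_false r' r
    · exact iff_of_false (fun h => hab ((irr_L hb).1 h.2.1)) (fun h => hab h.2.1)
  inv2 a b ha hb := by
    by_cases hab : Irrational (a / b)
    · have hab' := (irr_R ha).2 hab
      rcases fibre_cases hA hi ha hb hab with ⟨r, h1, -⟩ | ⟨r, h1, -⟩ <;>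
      rcases fibre_cases hA hi ha (add_pos ha hb) hab' with ⟨r', h1', -⟩ | ⟨r', h1', -⟩
      · exact iff_of_true r' r
      · exfalso
        obtain ⟨t, ht, e1, e2⟩ := exists_of_ae_Ioo ha (by
          filter_upwards [h1, h1'] with t g1 g2 ht using And.intro (g1 ht) (g2 ht))
        rw [FA_iff_iA] at e1 e2
        exact e2 (by rw [(coc hA hi).fR a b t ha hb ht.1 ht.2, e1])
      · exfalso
        obtain ⟨t, ht, e1, e2⟩ := exists_of_ae_Ioo ha (by
          filter_upwards [h1, h1'] with t g1 g2 ht using And.intro (g1 ht) (g2 ht))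
        rw [FA_iff_iA] at e1 e2
        exact e1 (by rw [← (coc hA hi).fR a b t ha hb ht.1 ht.2, e2])
      · exact iff_of_false r' r
    · exact iff_of_false (fun h => hab ((irr_R ha).1 h.2.1)) (fun h => hab h.2.1)

end

lemma posCone3_meas : MeasurableSet posCone3 := by
  have m0 : MeasurableSet {p : ℝ × ℝ × ℝ | 0 ≤ p.1} :=
    measurableSet_le (by fun_prop) (by fun_prop)
  have m1 : MeasurableSet {p : ℝ × ℝ × ℝ | 0 ≤ p.2.1} :=
    measurableSet_le (by fun_prop) (by fun_prop)
  have m2 : MeasurableSet {p : ℝ × ℝ × ℝ | 0 ≤ p.2.2} :=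
    measurableSet_le (by fun_prop) (by fun_prop)
  exact m0.inter (m1.inter m2)

/-- Rauzy induction on exchanges of three intervals is ergodic with respect to the measure
assigning to a set the sum, over the three labels, of the 3-dimensional Lebesgue measure of
its slices. -/
theorem rauzy3_ergodic (A : Set ((ℝ × ℝ × ℝ) × Fin 3)) (hA : MeasurableSet A)
    (hsub : A ⊆ posCone3 ×ˢ (Set.univ : Set (Fin 3)))
    (hinv : {y ∈ posCone3 ×ˢ (Set.univ : Set (Fin 3)) | rauzy3 y ∈ A} = A) :
    (∑ σ : Fin 3, volume {x : ℝ × ℝ × ℝ | (x, σ) ∈ A}) = 0 ∨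
      (∑ σ : Fin 3, volume {x : ℝ × ℝ × ℝ |
        (x, σ) ∈ posCone3 ×ˢ (Set.univ : Set (Fin 3)) \ A}) = 0 := by
  have hi : RInv A := by
    intro x hx σ
    have := Set.ext_iff.1 hinv (x, σ)
    rw [← this]
    simp [hx]
  rcases euclid_ergodic (RSet_inv hA hi) with h0 | h0
  · left
    refine Finset.sum_eq_zero fun σ _ => ?_
    refine measure_mono_null ?_ (null_case hA hi ?_ σ)
    · intro x hx
      exact ⟨(hsub hx).1, hx⟩
    · filter_upwards [ae_irr_div, measure_eq_zero_iff_ae_notMem.1 h0] with v hv hv2 hq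
      rcases fibre_cases hA hi hq.1 hq.2 (hv hq) with ⟨r, -⟩ | ⟨-, h1⟩
      · exact absurd ⟨r, hq⟩ hv2
      · exact h1
  · right
    have hA' : MeasurableSet (posCone3 ×ˢ (Set.univ : Set (Fin 3)) \ A) :=
      (posCone3_meas.prod MeasurableSet.univ).diff hA
    refine Finset.sum_eq_zero fun σ _ => ?_
    refine measure_mono_null ?_ (null_case hA' hi.compl ?_ σ)
    · intro x hx
      exact ⟨hx.1.1, hx⟩
    · filter_upwards [ae_irr_div, measure_eq_zero_iff_ae_notMem.1 h0] with v hv hv2 hq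
      rcases fibre_cases hA hi hq.1 hq.2 (hv hq) with ⟨-, h1, h2⟩ | ⟨r, -⟩
      · constructor
        · filter_upwards [h1] with t ht hta hc
          exact hc.2 (ht hta)
        · filter_upwards [h2] with t ht hta hc
          exact hc.2 (ht hta)
      · exact absurd ⟨hq, r⟩ hv2
end

section
/- For every d ≥ 3, the cyclic subtractive algorithm 𝓘 : ℝ₊^d × {1,…,d} → ℝ₊^d × {1,…,d} is ergodic with respect to the measure μ assigning to a set the sum over the d labels of the d-dimensional Lebesgue measure of its slices: every measurable set A with 𝓘⁻¹(A) = A satisfies μ(A) = 0 or μ((ℝ₊^d × {1,…,d}) ∖ A) = 0. -/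
open MeasureTheory

/-- The positive cone `ℝ₊^d`, for `d = m + 3`. -/
def posConeD (m : ℕ) : Set (Fin (m + 3) → ℝ) := {x | ∀ i, 0 ≤ x i}

/-- The cyclic subtractive algorithm on `ℝ₊^d × {1,…,d}` (labels are `Fin (m+3)`,
indices taken cyclically): at label `i`, it subtracts the smaller of `x[i]`, `x[i+1]`
from the larger, keeping label `i` if `x[i] ≥ x[i+1]` and moving to label `i+1`
otherwise. -/
noncomputable def cyclicAlg (m : ℕ) (q : (Fin (m + 3) → ℝ) × Fin (m + 3)) :
    (Fin (m + 3) → ℝ) × Fin (m + 3) :=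
  let x := q.1
  let i := q.2
  if x (i + 1) ≤ x i then (Function.update x i (x i - x (i + 1)), i)
  else (Function.update x (i + 1) (x (i + 1) - x i), i + 1)


namespace CycAlg

/-- A cylinder of the algorithm: columns of the matrix, together with the current label. -/
structure St (m : ℕ) where
  M : Fin (m + 3) → Fin (m + 3) → ℝ
  lab : Fin (m + 3)
  nn : ∀ k c, 0 ≤ M k c
  pos : ∀ k, 0 < ∑ c, M k c

variable {m : ℕ}

lemma succ_ne (i : Fin (m + 3)) : i + 1 ≠ i := by
  intro h
  simp at h


namespace St

/-- Column sums. -/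
def l (s : St m) (k : Fin (m + 3)) : ℝ := ∑ c, s.M k c

lemma l_pos (s : St m) (k) : 0 < s.l k := s.pos k

/-- Weight of a cylinder. -/
noncomputable def W (s : St m) : ℝ := ∏ k, (s.l k)⁻¹

lemma W_pos (s : St m) : 0 < s.W := Finset.prod_pos fun k _ => inv_pos.2 (s.l_pos k)

/-- child obtained when the label stays. -/
def stay (s : St m) : St m where
  M := Function.update s.M (s.lab + 1) (s.M (s.lab + 1) + s.M s.lab)
  lab := s.lab
  nn := by
    intro k c
    by_cases h : k = s.lab + 1
    · subst h; simp only [Function.update_self, Pi.add_apply]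
      exact add_nonneg (s.nn _ _) (s.nn _ _)
    · rw [Function.update_of_ne h]; exact s.nn _ _
  pos := by
    intro k
    by_cases h : k = s.lab + 1
    · subst h; simp only [Function.update_self, Pi.add_apply, Finset.sum_add_distrib]
      exact add_pos (s.pos _) (s.pos _)
    · rw [Function.update_of_ne h]; exact s.pos _

/-- child obtained when the label moves. -/
def move (s : St m) : St m where
  M := Function.update s.M s.lab (s.M s.lab + s.M (s.lab + 1))
  lab := s.lab + 1
  nn := by
    intro k c
    by_cases h : k = s.lab
    · subst h; simp only [Function.update_self, Pi.add_apply]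
      exact add_nonneg (s.nn _ _) (s.nn _ _)
    · rw [Function.update_of_ne h]; exact s.nn _ _
  pos := by
    intro k
    by_cases h : k = s.lab
    · subst h; simp only [Function.update_self, Pi.add_apply, Finset.sum_add_distrib]
      exact add_pos (s.pos _) (s.pos _)
    · rw [Function.update_of_ne h]; exact s.pos _

lemma l_stay (s : St m) : s.stay.l = Function.update s.l (s.lab + 1) (s.l (s.lab + 1) + s.l s.lab) := by
  funext k
  by_cases h : k = s.lab + 1
  · subst h; simp [l, stay, Finset.sum_add_distrib]
  · simp [l, stay, Function.update_of_ne h]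

lemma l_move (s : St m) : s.move.l = Function.update s.l s.lab (s.l s.lab + s.l (s.lab + 1)) := by
  funext k
  by_cases h : k = s.lab
  · subst h; simp [l, move, Finset.sum_add_distrib]
  · simp [l, move, Function.update_of_ne h]

lemma prod_upd (f : Fin (m + 3) → ℝ) (hf : ∀ k, 0 < f k) (j) (v : ℝ) :
    ∏ k, (Function.update f j v k)⁻¹ = (∏ k, (f k)⁻¹) * (f j / v) := by
  rw [← Finset.mul_prod_erase Finset.univ _ (Finset.mem_univ j),
    ← Finset.mul_prod_erase Finset.univ (fun k => (f k)⁻¹) (Finset.mem_univ j)]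
  have : ∏ k ∈ Finset.univ.erase j, (Function.update f j v k)⁻¹ =
      ∏ k ∈ Finset.univ.erase j, (f k)⁻¹ := by
    apply Finset.prod_congr rfl
    intro k hk
    rw [Function.update_of_ne (Finset.ne_of_mem_erase hk)]
  rw [this, Function.update_self]
  have := (hf j).ne'
  field_simp

lemma W_stay (s : St m) :
    s.stay.W = s.W * (s.l (s.lab + 1) / (s.l (s.lab + 1) + s.l s.lab)) := by
  unfold W; rw [l_stay, prod_upd _ s.l_pos]

lemma W_move (s : St m) :
    s.move.W = s.W * (s.l s.lab / (s.l s.lab + s.l (s.lab + 1))) := by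
  unfold W; rw [l_move, prod_upd _ s.l_pos]

lemma W_split (s : St m) : s.W = s.stay.W + s.move.W := by
  rw [W_stay, W_move]
  have := s.l_pos s.lab
  have := s.l_pos (s.lab + 1)
  field_simp
  ring

end St

/-- `Cov G s p`: a finite tree of descendants of `s`, the good leaves having weight at least `p`. -/
inductive Cov (G : St m → Prop) : St m → ℝ → Prop
  | leaf (s : St m) (p : ℝ) : G s → p ≤ s.W → Cov G s p
  | bad (s : St m) (p : ℝ) : p ≤ 0 → Cov G s p
  | split (s : St m) (p q : ℝ) : Cov G s.stay p → Cov G s.move q → Cov G s (p + q)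

namespace Cov

lemma anti {G : St m → Prop} {s : St m} {p : ℝ} (h : Cov G s p) : ∀ q ≤ p, Cov G s q := by
  induction h with
  | leaf s p hg hp => intro q hq; exact .leaf _ _ hg (hq.trans hp)
  | bad s p hp => intro q hq; exact .bad _ _ (hq.trans hp)
  | split s p q _ _ h1 h2 =>
    intro r hr
    have := Cov.split s (r - q) q (h1 _ (by linarith)) (h2 _ le_rfl)
    simpa using this

lemma le {G : St m → Prop} {s : St m} {p : ℝ} (h : Cov G s p) : p ≤ s.W := by
  induction h with
  | leaf s p hg hp => exact hp
  | bad s p hp => exact hp.trans s.W_pos.le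
  | split s p q _ _ h1 h2 => rw [s.W_split]; linarith

lemma comp {G G' : St m → Prop} {c : ℝ} (hc : 0 ≤ c) (H : ∀ s, G s → Cov G' s (c * s.W))
    {s : St m} {p : ℝ} (h : Cov G s p) : Cov G' s (c * p) := by
  induction h with
  | leaf s p hg hp => exact (H s hg).anti _ (mul_le_mul_of_nonneg_left hp hc)
  | bad s p hp => exact .bad _ _ (mul_nonpos_of_nonneg_of_nonpos hc hp)
  | split s p q _ _ h1 h2 => rw [mul_add]; exact .split _ _ _ h1 h2

lemma withInv {G I : St m → Prop} (hs : ∀ s, I s → I s.stay) (hm : ∀ s, I s → I s.move)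
    {s : St m} {p : ℝ} (h : Cov G s p) : I s → Cov (fun s => G s ∧ I s) s p := by
  induction h with
  | leaf s p hg hp => intro hi; exact .leaf _ _ ⟨hg, hi⟩ hp
  | bad s p hp => intro _; exact .bad _ _ hp
  | split s p q _ _ h1 h2 => intro hi; exact .split _ _ _ (h1 (hs _ hi)) (h2 (hm _ hi))

lemma mono {G G' : St m → Prop} (H : ∀ s, G s → G' s) {s : St m} {p : ℝ} (h : Cov G s p) :
    Cov G' s p := by
  induction h with
  | leaf s p hg hp => exact .leaf _ _ (H _ hg) hp
  | bad s p hp => exact .bad _ _ hp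
  | split s p q _ _ h1 h2 => exact .split _ _ _ h1 h2

lemma improve {G I : St m → Prop} (hs : ∀ s, I s → I s.stay) (hm : ∀ s, I s → I s.move)
    {c : ℝ} (hc1 : c ≤ 1) (H : ∀ s, I s → Cov G s (c * s.W))
    {s : St m} {p : ℝ} (h : Cov G s p) : I s → Cov G s (p + c * (s.W - p)) := by
  induction h with
  | leaf s p hg hp =>
    intro _
    exact .leaf _ _ hg (by nlinarith)
  | bad s p hp =>
    intro hi
    exact (H s hi).anti _ (by nlinarith)
  | split s p q _ _ h1 h2 =>
    intro hi
    have := Cov.split s _ _ (h1 (hs _ hi)) (h2 (hm _ hi))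
    refine this.anti _ ?_
    rw [s.W_split]; apply le_of_eq; ring

lemma iter {G I : St m → Prop} (hs : ∀ s, I s → I s.stay) (hm : ∀ s, I s → I s.move)
    {c : ℝ} (hc1 : c ≤ 1) (H : ∀ s, I s → Cov G s (c * s.W)) (s : St m) (hi : I s) (n : ℕ) :
    Cov G s ((1 - (1 - c) ^ n) * s.W) := by
  induction n with
  | zero => exact .bad _ _ (by simp)
  | succ n ih =>
    refine (improve hs hm hc1 H ih hi).anti _ (le_of_eq ?_)
    ring

lemma almost {G I : St m → Prop} (hs : ∀ s, I s → I s.stay) (hm : ∀ s, I s → I s.move)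
    {c : ℝ} (hc0 : 0 < c) (hc1 : c ≤ 1) (H : ∀ s, I s → Cov G s (c * s.W)) (s : St m) (hi : I s)
    {ε : ℝ} (hε : 0 < ε) : Cov G s ((1 - ε) * s.W) := by
  obtain ⟨n, hn⟩ := exists_pow_lt_of_lt_one hε (show 1 - c < 1 by linarith)
  refine (iter hs hm hc1 H s hi n).anti _ ?_
  exact mul_le_mul_of_nonneg_right (by linarith) s.W_pos.le

end Cov

/-- column `v` is `x` (of mass `μ`) plus something in the band. -/
def InfV (lo hi : Fin (m + 3) → ℝ) (μ : ℝ) (x v : Fin (m + 3) → ℝ) : Prop :=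
  μ ≤ (∑ c, v c) ∧
    ∀ c, lo c * ((∑ c, v c) - μ) ≤ v c - x c ∧ v c - x c ≤ hi c * ((∑ c, v c) - μ)

lemma InfV.add {lo hi : Fin (m + 3) → ℝ} {μ : ℝ} {x v w : Fin (m + 3) → ℝ}
    (h : InfV lo hi μ x v) (h' : InfV lo hi 0 0 w) : InfV lo hi μ x (v + w) := by
  obtain ⟨h0, h⟩ := h
  obtain ⟨h0', h'⟩ := h'
  refine ⟨by simp only [Pi.add_apply, Finset.sum_add_distrib]; linarith, ?_⟩
  intro c
  obtain ⟨h1, h2⟩ := h c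
  obtain ⟨h3, h4⟩ := h' c
  simp only [Pi.add_apply, Finset.sum_add_distrib, Pi.zero_apply] at *
  constructor <;> nlinarith

lemma InfV.add' {lo hi : Fin (m + 3) → ℝ} {μ : ℝ} {x v w : Fin (m + 3) → ℝ}
    (h : InfV lo hi μ x v) (h' : InfV lo hi 0 0 w) : InfV lo hi μ x (w + v) := by
  rw [add_comm]; exact h.add h'

def Band (lo hi : Fin (m + 3) → ℝ) (s : St m) : Prop := ∀ k, InfV lo hi 0 0 (s.M k)

lemma Band.stay {lo hi : Fin (m + 3) → ℝ} {s : St m} (h : Band lo hi s) : Band lo hi s.stay := by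
  intro k
  by_cases hk : k = s.lab + 1
  · subst hk; simp only [St.stay, Function.update_self]; exact (h _).add (h _)
  · simp only [St.stay, Function.update_of_ne hk]; exact h _

lemma Band.move {lo hi : Fin (m + 3) → ℝ} {s : St m} (h : Band lo hi s) : Band lo hi s.move := by
  intro k
  by_cases hk : k = s.lab
  · subst hk; simp only [St.move, Function.update_self]; exact (h _).add (h _)
  · simp only [St.move, Function.update_of_ne hk]; exact h _

lemma inf_stay {lo hi : Fin (m + 3) → ℝ} {s : St m} (h : Band lo hi s) {μ x k}
    (hi' : InfV lo hi μ x (s.M k)) : InfV lo hi μ x (s.stay.M k) := by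
  by_cases hk : k = s.lab + 1
  · subst hk; simp only [St.stay, Function.update_self]; exact hi'.add (h _)
  · simp only [St.stay, Function.update_of_ne hk]; exact hi'

lemma inf_move {lo hi : Fin (m + 3) → ℝ} {s : St m} (h : Band lo hi s) {μ x k}
    (hi' : InfV lo hi μ x (s.M k)) : InfV lo hi μ x (s.move.M k) := by
  by_cases hk : k = s.lab
  · subst hk; simp only [St.move, Function.update_self]; exact hi'.add (h _)
  · simp only [St.move, Function.update_of_ne hk]; exact hi'

lemma inf_move' {lo hi : Fin (m + 3) → ℝ} {s : St m} (h : Band lo hi s) {μ x}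
    (hi' : InfV lo hi μ x (s.M (s.lab + 1))) : InfV lo hi μ x (s.move.M s.lab) := by
  simp only [St.move, Function.update_self]; exact hi'.add' (h _)

lemma step_aux {lo hi : Fin (m + 3) → ℝ} {μ x} (J : Set (Fin (m + 3))) (T : ℝ) (i : Fin (m + 3))
    (n : ℕ) : ∀ s : St m, s.lab = i → Band lo hi s → (∀ k ∈ J, InfV lo hi μ x (s.M k)) →
    (∀ k, k ≠ i + 1 → s.l k ≤ T) → (s.l (i + 1) + n * s.l i ≤ 2 * T + s.l i) →
    Cov (fun s' => s'.lab = i + 1 ∧ Band lo hi s' ∧ (∀ k ∈ J, InfV lo hi μ x (s'.M k)) ∧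
      (i + 1 ∈ J → InfV lo hi μ x (s'.M i)) ∧ ∀ k, s'.l k ≤ 3 * T) s
      (s.W * (1 - s.l (i + 1) / (s.l (i + 1) + n * s.l i))) := by
  induction n with
  | zero =>
    intro s _ _ _ _ _
    refine .bad _ _ ?_
    have := (s.l_pos (i + 1)).ne'
    simp [this]
  | succ n ih =>
    intro s hl hB hJ hT hb
    have ha := s.l_pos i
    have hbp := s.l_pos (i + 1)
    have hTi := hT i (succ_ne i).symm
    subst hl
    have h1 : s.stay.l s.lab = s.l s.lab := by
      rw [St.l_stay, Function.update_of_ne (succ_ne _).symm]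
    have h2 : s.stay.l (s.lab + 1) = s.l (s.lab + 1) + s.l s.lab := by
      rw [St.l_stay, Function.update_self]
    push_cast at hb
    have hn : (0 : ℝ) ≤ n := n.cast_nonneg
    have hna := mul_nonneg hn ha.le
    have A := ih s.stay rfl hB.stay (fun k hk => inf_stay hB (hJ k hk))
      (fun k hk => by rw [St.l_stay, Function.update_of_ne hk]; exact hT k hk)
      (by rw [h1, h2]; linarith)
    have B : Cov (fun s' : St m => s'.lab = s.lab + 1 ∧ Band lo hi s' ∧
      (∀ k ∈ J, InfV lo hi μ x (s'.M k)) ∧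
      (s.lab + 1 ∈ J → InfV lo hi μ x (s'.M s.lab)) ∧ ∀ k, s'.l k ≤ 3 * T) s.move s.move.W := by
      refine .leaf _ _ ⟨rfl, hB.move, fun k hk => inf_move hB (hJ k hk),
        fun h => inf_move' hB (hJ _ h), ?_⟩ le_rfl
      intro k
      by_cases hk : k = s.lab
      · rw [hk, St.l_move, Function.update_self]; nlinarith
      · rw [St.l_move, Function.update_of_ne hk]
        by_cases hk' : k = s.lab + 1
        · rw [hk']; nlinarith
        · have := hT k hk'; linarith
    refine (Cov.split s _ _ A B).anti _ (le_of_eq ?_)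
    rw [h1, h2, s.W_stay, s.W_move]
    push_cast
    have e1 : s.l (s.lab + 1) + s.l s.lab + n * s.l s.lab ≠ 0 := by positivity
    have e2 : s.l (s.lab + 1) + (n + 1) * s.l s.lab ≠ 0 := by positivity
    have e3 : s.l (s.lab + 1) + s.l s.lab ≠ 0 := by positivity
    have e4 : s.l s.lab + s.l (s.lab + 1) ≠ 0 := by positivity
    have e5 : s.l (s.lab + 1) + (n + 1) * s.l s.lab = s.l (s.lab + 1) + s.l s.lab + n * s.l s.lab := by
      ring
    rw [e5]
    rw [add_comm (s.l s.lab) (s.l (s.lab + 1))]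
    field_simp
    ring

lemma step {lo hi : Fin (m + 3) → ℝ} {μ x} (J : Set (Fin (m + 3))) (T : ℝ) (i : Fin (m + 3))
    (s : St m) (hl : s.lab = i) (hB : Band lo hi s) (hJ : ∀ k ∈ J, InfV lo hi μ x (s.M k))
    (hT : ∀ k, s.l k ≤ T) :
    Cov (fun s' => s'.lab = i + 1 ∧ Band lo hi s' ∧ (∀ k ∈ J, InfV lo hi μ x (s'.M k)) ∧
      (i + 1 ∈ J → InfV lo hi μ x (s'.M i)) ∧ ∀ k, s'.l k ≤ 3 * T) s
      (1 / 2 * s.W) := by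
  have ha := s.l_pos i
  have hb := s.l_pos (i + 1)
  set n := ⌈s.l (i + 1) / s.l i⌉₊ with hn
  have h1 : s.l (i + 1) / s.l i ≤ n := Nat.le_ceil _
  have h2 : (n : ℝ) < s.l (i + 1) / s.l i + 1 := Nat.ceil_lt_add_one (by positivity)
  rw [div_le_iff₀ ha] at h1
  have h3 : (n : ℝ) * s.l i < s.l (i + 1) + s.l i := by
    have := mul_lt_mul_of_pos_right h2 ha
    rwa [add_mul, div_mul_cancel₀ _ ha.ne', one_mul] at this
  have := hT (i + 1)
  refine (step_aux J T i n s hl hB hJ (fun k _ => hT k) (by linarith)).anti _ ?_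
  rw [mul_comm]
  refine mul_le_mul_of_nonneg_left ?_ s.W_pos.le
  have : s.l (i + 1) / (s.l (i + 1) + n * s.l i) ≤ 1 / 2 := by
    rw [div_le_div_iff₀ (by positivity) (by norm_num)]; linarith
  linarith

/-- infected columns after `t` moves. -/
def JJ (k0 i : Fin (m + 3)) : ℕ → Set (Fin (m + 3))
  | 0 => {k0}
  | t + 1 => {k | k ∈ JJ k0 i t ∨ (k = i + (Fin.ofNat (m + 3) t) ∧ k + 1 ∈ JJ k0 i t)}

lemma JJ_mono (k0 i : Fin (m + 3)) {t u : ℕ} (h : t ≤ u) : JJ k0 i t ⊆ JJ k0 i u := by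
  induction h with
  | refl => exact subset_rfl
  | step _ ih => exact ih.trans fun k hk => Or.inl hk

lemma ofNat_succ (t : ℕ) : Fin.ofNat (m + 3) (t + 1) = Fin.ofNat (m + 3) t + 1 := by
  ext; simp [Fin.val_add, Fin.ofNat]

lemma ofNat_add (t u : ℕ) : Fin.ofNat (m + 3) (t + u) = Fin.ofNat (m + 3) t + Fin.ofNat (m + 3) u := by
  ext; simp [Fin.val_add, Fin.ofNat]

lemma ofNat_val (k : Fin (m + 3)) : Fin.ofNat (m + 3) k.val = k := by
  ext; simp [Fin.ofNat, Nat.mod_eq_of_lt k.2]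

lemma ofNat_d (t : ℕ) : Fin.ofNat (m + 3) ((m + 3) * t) = 0 := by
  ext; simp [Fin.ofNat]

lemma JJ_pred (k0 i k : Fin (m + 3)) {t : ℕ} (h : k + 1 ∈ JJ k0 i t) : k ∈ JJ k0 i (t + (m + 3)) := by
  have hu : k ∈ JJ k0 i (t + (k - i - Fin.ofNat (m + 3) t).val + 1) := by
    refine Or.inr ⟨?_, JJ_mono k0 i (by omega) h⟩
    rw [ofNat_add, ofNat_val]; abel
  exact JJ_mono k0 i (by have := (k - i - Fin.ofNat (m + 3) t).2; omega) hu

lemma JJ_sub (k0 i : Fin (m + 3)) (r : ℕ) : k0 - Fin.ofNat (m + 3) r ∈ JJ k0 i ((m + 3) * r) := by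
  induction r with
  | zero => simp [JJ]
  | succ r ih =>
    have := JJ_pred k0 i (k0 - Fin.ofNat (m + 3) (r + 1)) (t := (m + 3) * r)
      (by rw [ofNat_succ]; convert ih using 1; abel)
    rwa [Nat.mul_succ]

lemma JJ_full (k0 i k : Fin (m + 3)) {t : ℕ} (ht : (m + 3) * (m + 3) ≤ t) : k ∈ JJ k0 i t := by
  have := JJ_sub k0 i (k0 - k).val
  rw [ofNat_val, sub_sub_cancel] at this
  refine JJ_mono k0 i (le_trans ?_ ht) this
  exact Nat.mul_le_mul_left _ (k0 - k).2.le

lemma chain {lo hi : Fin (m + 3) → ℝ} {μ x} (T : ℝ) (k0 : Fin (m + 3))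
    (s : St m) (hB : Band lo hi s) (hJ : InfV lo hi μ x (s.M k0))
    (hT : ∀ k, s.l k ≤ T) (t : ℕ) :
    Cov (fun s' => s'.lab = s.lab + Fin.ofNat (m + 3) t ∧ Band lo hi s' ∧
      (∀ k ∈ JJ k0 s.lab t, InfV lo hi μ x (s'.M k)) ∧ ∀ k, s'.l k ≤ 3 ^ t * T) s
      ((1 / 2) ^ t * s.W) := by
  induction t with
  | zero =>
    refine .leaf _ _ ⟨by simp, hB, ?_, by simpa using hT⟩ (by simp)
    intro k hk
    simp only [JJ, Set.mem_singleton_iff] at hk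
    rw [hk]; exact hJ
  | succ t ih =>
    have := Cov.comp (c := 1 / 2) (by norm_num) (fun s' hs' => step (JJ k0 s.lab t) (3 ^ t * T)
      (s.lab + Fin.ofNat (m + 3) t) s' hs'.1 hs'.2.1 hs'.2.2.1 hs'.2.2.2) ih
    rw [pow_succ' (1 / 2 : ℝ), mul_assoc]
    refine this.mono ?_
    rintro s' ⟨h1, h2, h3, h4, h5⟩
    refine ⟨by rw [h1, ofNat_succ]; abel, h2, ?_, ?_⟩
    · rintro k (hk | ⟨rfl, hk⟩)
      · exact h3 k hk
      · exact h4 hk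
    · intro k; rw [pow_succ', mul_assoc]; exact h5 k

/-- width of the cone at most `D`. -/
def Wid (D : ℝ) (s : St m) : Prop :=
  ∃ lo hi : Fin (m + 3) → ℝ, (∀ c, lo c ≤ hi c ∧ hi c - lo c ≤ D) ∧ Band lo hi s

lemma Wid.stay {D : ℝ} {s : St m} (h : Wid D s) : Wid D s.stay := by
  obtain ⟨lo, hi, h1, h2⟩ := h; exact ⟨lo, hi, h1, h2.stay⟩

lemma Wid.move {D : ℝ} {s : St m} (h : Wid D s) : Wid D s.move := by
  obtain ⟨lo, hi, h1, h2⟩ := h; exact ⟨lo, hi, h1, h2.move⟩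

/-- balance constant -/
def CC (m : ℕ) : ℝ := 3 ^ ((m + 3) * (m + 3) + (m + 3))

lemma CC_ge : 1 ≤ CC m := one_le_pow₀ (by norm_num)

def Bal (s : St m) : Prop := ∀ k k', s.l k ≤ CC m * s.l k'

lemma block (i0 : Fin (m + 3)) (D : ℝ) (s : St m) (hs : Wid D s) :
    Cov (fun s' => s'.lab = i0 ∧ Bal s' ∧ Wid ((1 - 1 / CC m) * D) s') s
      ((1 / 2) ^ ((m + 3) * (m + 3) + (m + 3)) * s.W) := by
  obtain ⟨lo, hi, hD, hB⟩ := hs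
  obtain ⟨k0, -, hk0⟩ := Finset.exists_max_image Finset.univ s.l Finset.univ_nonempty
  set μ := s.l k0 with hμ
  have hμ0 : 0 < μ := s.l_pos k0
  set t := (m + 3) * (m + 3) + (i0 - s.lab).val with ht
  have htle : t ≤ (m + 3) * (m + 3) + (m + 3) := by have := (i0 - s.lab).2; omega
  have h0 : InfV lo hi μ (s.M k0) (s.M k0) := by
    refine ⟨le_rfl, ?_⟩
    intro c
    have : (∑ c, s.M k0 c) - μ = 0 := by rw [hμ]; simp [St.l]
    simp [this]
  have hch := chain μ k0 s hB h0 (fun k => hk0 k (Finset.mem_univ _)) t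
  refine (hch.anti _ ?_).mono ?_
  · refine mul_le_mul_of_nonneg_right ?_ s.W_pos.le
    exact pow_le_pow_of_le_one (by norm_num) (by norm_num) htle
  rintro s' ⟨h1, h2, h3, h4⟩
  have hC : ∀ k, s'.l k ≤ CC m * μ := by
    intro k
    refine (h4 k).trans (mul_le_mul_of_nonneg_right ?_ hμ0.le)
    exact pow_le_pow_right₀ (by norm_num) htle
  have hinf : ∀ k, InfV lo hi μ (s.M k0) (s'.M k) := fun k => h3 k (JJ_full _ _ _ (by omega))
  have hCC := CC_ge (m := m)
  have hge : ∀ k, μ ≤ s'.l k := fun k => (hinf k).1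
  refine ⟨?_, ?_, ?_⟩
  · rw [h1, ht, ofNat_add, ofNat_d, ofNat_val]; abel
  · intro k k'
    exact (hC k).trans (mul_le_mul_of_nonneg_left (hge k') (by linarith))
  · set q := 1 / CC m with hq
    have hq0 : 0 < q := by positivity
    have hqC : q * CC m = 1 := by rw [hq]; field_simp
    refine ⟨fun c => lo c + q * (s.M k0 c / μ - lo c), fun c => hi c - q * (hi c - s.M k0 c / μ),
      ?_, ?_⟩
    · intro c
      obtain ⟨a1, a2⟩ := hD c
      obtain ⟨b1, b2⟩ := (hB k0).2 c
      have hq1 : q ≤ 1 := by rw [hq, div_le_one (by linarith)]; exact hCC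
      constructor
      · nlinarith
      · nlinarith
    · intro k
      obtain ⟨i1, i2⟩ := hinf k
      refine ⟨(s'.l_pos k).le, ?_⟩
      intro c
      obtain ⟨j1, j2⟩ := i2 c
      obtain ⟨b1, b2⟩ := (hB k0).2 c
      have hs : ∑ c, s'.M k c = s'.l k := rfl
      have hs0 : ∑ c, s.M k0 c = μ := rfl
      simp only [sub_zero, Pi.zero_apply, hs, hs0] at *
      set a := s.M k0 c / μ with ha
      have ha' : s.M k0 c = a * μ := by rw [ha]; field_simp
      rw [ha'] at b1 b2 j1 j2
      have c1 : lo c ≤ a := le_of_mul_le_mul_right b1 hμ0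
      have c2 : a ≤ hi c := le_of_mul_le_mul_right b2 hμ0
      have hk : q * s'.l k ≤ μ := by
        have := mul_le_mul_of_nonneg_left (hC k) hq0.le
        rwa [← mul_assoc, hqC, one_mul] at this
      constructor
      · nlinarith
      · nlinarith

lemma q_bounds : 0 ≤ 1 - 1 / CC m ∧ 1 - 1 / CC m < 1 := by
  have := CC_ge (m := m)
  have h1 : 1 / CC m ≤ 1 := by rw [div_le_one (by linarith)]; exact this
  have h2 : 0 < 1 / CC m := by positivity
  constructor <;> linarith

/-- the root cylinder -/
def root (i0 : Fin (m + 3)) : St m where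
  M := fun k => Pi.single k 1
  lab := i0
  nn := by intro k c; by_cases h : c = k <;> simp [Pi.single_apply, h]
  pos := by intro k; simp

lemma root_l (i0 k : Fin (m + 3)) : (root i0).l k = 1 := by simp [root, St.l]

lemma root_W (i0 : Fin (m + 3)) : (root i0).W = 1 := by simp [St.W, root_l]

lemma root_wid (i0 : Fin (m + 3)) : Wid 1 (root i0) := by
  refine ⟨fun _ => 0, fun _ => 1, fun c => by norm_num, fun k => ?_⟩
  refine ⟨by simp [root], fun c => ?_⟩
  have : (∑ c, (root i0).M k c) = 1 := by simp [root]
  rw [this]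
  by_cases h : c = k <;> simp [root, Pi.single_apply, h]

lemma block_almost (i0 : Fin (m + 3)) (D : ℝ) (s : St m) (hs : Wid D s) {ε : ℝ} (hε : 0 < ε) :
    Cov (fun s' => s'.lab = i0 ∧ Bal s' ∧ Wid ((1 - 1 / CC m) * D) s') s ((1 - ε) * s.W) :=
  Cov.almost (I := Wid D) (fun _ h => h.stay) (fun _ h => h.move)
    (c := (1 / 2) ^ ((m + 3) * (m + 3) + (m + 3))) (by positivity)
    (pow_le_one₀ (by norm_num) (by norm_num)) (fun s hs => block i0 D s hs) s hs hε

lemma cover_pow (i0 : Fin (m + 3)) (r : ℕ) : ∀ {ε : ℝ}, 0 < ε → ε ≤ 1 →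
    Cov (fun s' => s'.lab = i0 ∧ Bal s' ∧ Wid ((1 - 1 / CC m) ^ (r + 1)) s') (root i0) (1 - ε) := by
  induction r with
  | zero =>
    intro ε hε _
    have := block_almost i0 1 (root i0) (root_wid i0) hε
    simpa [root_W] using this
  | succ r ih =>
    intro ε hε hε1
    have h1 := ih (ε := ε / 2) (by linarith) (by linarith)
    have h2 := Cov.comp (c := 1 - ε / 2) (by linarith)
      (fun s hs => block_almost i0 _ s hs.2.2 (ε := ε / 2) (by linarith)) h1
    rw [← pow_succ'] at h2
    refine h2.anti _ ?_
    nlinarith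

lemma cover (i0 : Fin (m + 3)) {δ ε : ℝ} (hδ : 0 < δ) (hε : 0 < ε) (hε1 : ε ≤ 1) :
    Cov (fun s' => s'.lab = i0 ∧ Bal s' ∧ Wid δ s') (root i0) (1 - ε) := by
  obtain ⟨n, hn⟩ := exists_pow_lt_of_lt_one hδ (q_bounds (m := m)).2
  refine (cover_pow i0 n hε hε1).mono ?_
  rintro s ⟨h1, h2, lo, hi, h3, h4⟩
  refine ⟨h1, h2, lo, hi, fun c => ⟨(h3 c).1, (h3 c).2.trans ?_⟩, h4⟩
  rw [pow_succ]
  have := q_bounds (m := m)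
  have := pow_nonneg this.1 n
  nlinarith

end CycAlg

namespace CycAlg
variable {m : ℕ}

/-- weighted simplex -/
def Sx (l : Fin (m + 3) → ℝ) : Set (Fin (m + 3) → ℝ) :=
  {y | (∀ k, 0 < y k) ∧ ∑ k, l k * y k ≤ 1}

lemma meas_pos : MeasurableSet {y : Fin (m + 3) → ℝ | ∀ k, 0 < y k} := by
  rw [Set.ofPred_forall]
  exact MeasurableSet.iInter fun k => measurableSet_lt measurable_const (measurable_pi_apply k)

lemma meas_lin (l : Fin (m + 3) → ℝ) : Measurable fun y : Fin (m + 3) → ℝ => ∑ k, l k * y k :=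
  Finset.measurable_sum _ fun k _ => (measurable_pi_apply k).const_mul _

lemma meas_Sx (l : Fin (m + 3) → ℝ) : MeasurableSet (Sx l) :=
  meas_pos.inter (measurableSet_le (meas_lin l) measurable_const)

/-- replace coordinate `k` by a linear form. -/
def U (k : Fin (m + 3)) (a : Fin (m + 3) → ℝ) (y : Fin (m + 3) → ℝ) : Fin (m + 3) → ℝ :=
  Function.update y k (∑ l, a l * y l)

lemma U_meas (k : Fin (m + 3)) (a : Fin (m + 3) → ℝ) : Measurable (U k a) := by
  refine measurable_pi_iff.2 fun j => ?_
  by_cases h : j = k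
  · subst h; simpa [U] using meas_lin a
  · simpa [U, Function.update_of_ne h] using measurable_pi_apply j

lemma U_eq (k : Fin (m + 3)) (a : Fin (m + 3) → ℝ) :
    U k a = Matrix.toLin' ((1 : Matrix (Fin (m + 3)) (Fin (m + 3)) ℝ).updateRow k a) := by
  funext y
  ext j
  by_cases h : j = k
  · subst h
    simp [U, Matrix.mulVec, dotProduct]
  · simp [U, Matrix.mulVec, dotProduct, Matrix.updateRow_ne h, Function.update_of_ne h,
      Matrix.one_apply]

lemma U_det (k : Fin (m + 3)) (a : Fin (m + 3) → ℝ) :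
    ((1 : Matrix (Fin (m + 3)) (Fin (m + 3)) ℝ).updateRow k a).det = a k := by
  rw [← Matrix.det_transpose, ← Matrix.updateCol_transpose, Matrix.transpose_one,
    ← Matrix.cramer_apply, Matrix.cramer_one]
  rfl

lemma U_lint (k : Fin (m + 3)) (a : Fin (m + 3) → ℝ) (ha : a k ≠ 0)
    {H : (Fin (m + 3) → ℝ) → ENNReal} (hH : Measurable H) :
    ∫⁻ y, H (U k a y) = ENNReal.ofReal |(a k)⁻¹| * ∫⁻ y, H y := by
  rw [← lintegral_map hH (U_meas k a), U_eq,
    Real.map_matrix_volume_pi_eq_smul_volume_pi (by rwa [U_det]), U_det, lintegral_smul_measure,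
    smul_eq_mul]

lemma smul_lint (r : ℝ) (hr : r ≠ 0)
    {H : (Fin (m + 3) → ℝ) → ENNReal} (hH : Measurable H) :
    ∫⁻ y, H (r • y) = ENNReal.ofReal |(r ^ (m + 3))⁻¹| * ∫⁻ y, H y := by
  have := Measure.map_addHaar_smul (volume : Measure (Fin (m + 3) → ℝ)) hr
  rw [Module.finrank_fin_fun] at this
  rw [← lintegral_map hH (measurable_const_smul r), this, lintegral_smul_measure, smul_eq_mul]

/-- `Ad i j y`: add coordinate `j` to coordinate `i`. -/
def Ad (i j : Fin (m + 3)) (y : Fin (m + 3) → ℝ) : Fin (m + 3) → ℝ :=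
  Function.update y i (y i + y j)

lemma Ad_eq (i j : Fin (m + 3)) : Ad i j = U i (Pi.single i 1 + Pi.single j 1) := by
  funext y
  simp [Ad, U, add_mul, Finset.sum_add_distrib, Pi.single_apply]

lemma Ad_lint (i j : Fin (m + 3)) (hij : i ≠ j) {H : (Fin (m + 3) → ℝ) → ENNReal}
    (hH : Measurable H) : ∫⁻ y, H (Ad i j y) = ∫⁻ y, H y := by
  rw [Ad_eq, U_lint _ _ (by simp [Pi.single_apply, hij]) hH]
  simp [Pi.single_apply, hij]

lemma Ad_meas (i j : Fin (m + 3)) : Measurable (Ad i j) := by rw [Ad_eq]; exact U_meas _ _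

lemma Ad_sum (i j : Fin (m + 3)) (hij : i ≠ j) (l y : Fin (m + 3) → ℝ) :
    ∑ k, l k * Ad i j y k = ∑ k, Function.update l j (l j + l i) k * y k := by
  have h1 : ∀ k, l k * Ad i j y k = l k * y k + (if k = i then l i * y j else 0) := by
    intro k
    by_cases h : k = i
    · subst h; simp [Ad]; ring
    · simp [Ad, h]
  have h2 : ∀ k, Function.update l j (l j + l i) k * y k
      = l k * y k + (if k = j then l i * y j else 0) := by
    intro k
    by_cases h : k = j
    · subst h; simp; ring
    · simp [h]
  simp_rw [h1, h2, Finset.sum_add_distrib]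
  simp

lemma Ad_self (i j : Fin (m + 3)) (y) : Ad i j y i = y i + y j := by simp [Ad]
lemma Ad_ne (i j k : Fin (m + 3)) (h : k ≠ i) (y) : Ad i j y k = y k := by simp [Ad, h]

lemma Ad_mem (i j : Fin (m + 3)) (hij : i ≠ j) (l y : Fin (m + 3) → ℝ) :
    (Ad i j y ∈ Sx l ∧ Ad i j y j < Ad i j y i) ↔ y ∈ Sx (Function.update l j (l j + l i)) := by
  simp only [Sx, Set.mem_ofPred_eq, Ad_sum i j hij, Ad_self, Ad_ne i j j hij.symm]
  constructor
  · rintro ⟨⟨h1, h2⟩, h3⟩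
    refine ⟨fun k => ?_, h2⟩
    by_cases hk : k = i
    · subst hk; linarith
    · have := h1 k; rwa [Ad_ne _ _ _ hk] at this
  · rintro ⟨h1, h2⟩
    refine ⟨⟨fun k => ?_, h2⟩, by have := h1 i; linarith⟩
    by_cases hk : k = i
    · subst hk; rw [Ad_self]; exact add_pos (h1 _) (h1 _)
    · rw [Ad_ne _ _ _ hk]; exact h1 k

lemma half_lint (i j : Fin (m + 3)) (hij : i ≠ j) (l : Fin (m + 3) → ℝ)
    {w : (Fin (m + 3) → ℝ) → ENNReal} (hw : Measurable w) :
    ∫⁻ y in Sx l ∩ {y | y j < y i}, w y =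
      ∫⁻ y in Sx (Function.update l j (l j + l i)), w (Ad i j y) := by
  have hm : MeasurableSet (Sx l ∩ {y | y j < y i}) :=
    (meas_Sx l).inter (measurableSet_lt (measurable_pi_apply j) (measurable_pi_apply i))
  rw [← lintegral_indicator hm, ← lintegral_indicator (meas_Sx _),
    ← Ad_lint i j hij (hw.indicator hm)]
  congr 1
  funext y
  have := Ad_mem i j hij l y
  by_cases h : y ∈ Sx (Function.update l j (l j + l i))
  · rw [Set.indicator_of_mem h, Set.indicator_of_mem]
    exact this.2 h
  · rw [Set.indicator_of_notMem h, Set.indicator_of_notMem]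
    intro h'; exact h (this.1 h')

lemma diag_null (i j : Fin (m + 3)) (hij : i ≠ j) :
    volume {y : Fin (m + 3) → ℝ | y i = y j} = 0 := by
  let p : Submodule ℝ (Fin (m + 3) → ℝ) :=
    LinearMap.ker ((LinearMap.proj i : (Fin (m + 3) → ℝ) →ₗ[ℝ] ℝ) - LinearMap.proj j)
  have hp : p ≠ ⊤ := by
    intro h
    have : (Pi.single i 1 : Fin (m + 3) → ℝ) ∈ p := by rw [h]; trivial
    simp [p, Pi.single_apply, hij.symm] at this
  have := Measure.addHaar_submodule volume p hp
  convert this using 2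
  ext y
  simp [p, sub_eq_zero]

lemma Sx_split (i j : Fin (m + 3)) (hij : i ≠ j) (l : Fin (m + 3) → ℝ)
    {w : (Fin (m + 3) → ℝ) → ENNReal} (hw : Measurable w) :
    ∫⁻ y in Sx l, w y = (∫⁻ y in Sx (Function.update l j (l j + l i)), w (Ad i j y)) +
      ∫⁻ y in Sx (Function.update l i (l i + l j)), w (Ad j i y) := by
  rw [← half_lint i j hij l hw, ← half_lint j i hij.symm l hw]
  have hm2 : MeasurableSet (Sx l ∩ {y | y i < y j}) :=
    (meas_Sx l).inter (measurableSet_lt (measurable_pi_apply i) (measurable_pi_apply j))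
  rw [← lintegral_union hm2]
  · apply setLIntegral_congr
    have hd := diag_null i j hij
    have : ∀ᵐ y : Fin (m + 3) → ℝ, y i ≠ y j := by
      rw [ae_iff]; simpa using hd
    filter_upwards [this] with y hy
    apply propext
    constructor
    · intro h
      rcases lt_or_gt_of_ne hy with h' | h'
      · exact Or.inr ⟨h, h'⟩
      · exact Or.inl ⟨h, h'⟩
    · rintro (h | h) <;> exact h.1
  · rw [Set.disjoint_left]
    rintro y ⟨_, h1⟩ ⟨_, h2⟩
    simp only [Set.mem_ofPred_eq] at h1 h2
    exact lt_asymm h1 h2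

/-- linear action -/
def St.app (s : St m) (y : Fin (m + 3) → ℝ) : Fin (m + 3) → ℝ := fun c => ∑ k, y k * s.M k c

lemma St.app_meas (s : St m) : Measurable s.app :=
  measurable_pi_iff.2 fun c => Finset.measurable_sum _ fun k _ => (measurable_pi_apply k).mul_const _

lemma app_upd (M : Fin (m + 3) → Fin (m + 3) → ℝ) (i j : Fin (m + 3)) (hij : i ≠ j) (y) (c) :
    ∑ k, y k * Function.update M j (M j + M i) k c = ∑ k, Ad i j y k * M k c := by
  rw [show ∑ k, Ad i j y k * M k c = ∑ k, M k c * Ad i j y k from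
    Finset.sum_congr rfl fun _ _ => mul_comm _ _, Ad_sum i j hij (fun k => M k c) y]
  refine Finset.sum_congr rfl fun k _ => ?_
  by_cases h : k = j
  · subst h; simp [mul_comm]
  · simp [h, mul_comm]

lemma St.app_stay (s : St m) (y) : s.stay.app y = s.app (Ad s.lab (s.lab + 1) y) := by
  funext c
  exact app_upd s.M s.lab (s.lab + 1) (succ_ne _).symm y c

lemma St.app_move (s : St m) (y) : s.move.app y = s.app (Ad (s.lab + 1) s.lab y) := by
  funext c
  exact app_upd s.M (s.lab + 1) s.lab (succ_ne _) y c

/-- integral over a cylinder -/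
noncomputable def II (w : (Fin (m + 3) → ℝ) → ENNReal) (s : St m) : ENNReal :=
  ∫⁻ y in Sx s.l, w (s.app y)

lemma II_split {w : (Fin (m + 3) → ℝ) → ENNReal} (hw : Measurable w) (s : St m) :
    II w s = II w s.stay + II w s.move := by
  unfold II
  have := Sx_split s.lab (s.lab + 1) (succ_ne _).symm s.l (hw.comp s.app_meas)
  simp only [Function.comp] at this
  rw [this, ← s.l_stay, ← s.l_move]
  simp only [s.app_stay, s.app_move]

/-- volume of the standard simplex -/
noncomputable def kap (m : ℕ) : ENNReal := volume (Sx (fun _ : Fin (m + 3) => (1 : ℝ)))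

lemma kap_lt : kap m < ⊤ := by
  have : Sx (fun _ : Fin (m + 3) => (1 : ℝ)) ⊆ Set.Icc 0 1 := by
    rintro y ⟨h1, h2⟩
    refine ⟨fun k => (h1 k).le, fun k => ?_⟩
    simp only [one_mul] at h2
    exact (Finset.single_le_sum (fun k _ => (h1 k).le) (Finset.mem_univ k)).trans h2
  refine (measure_mono this).trans_lt ?_
  exact isCompact_Icc.measure_lt_top

lemma vol_Sx (l : Fin (m + 3) → ℝ) (hl : ∀ k, 0 < l k) :
    volume (Sx l) = ENNReal.ofReal (∏ k, (l k)⁻¹) * kap m := by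
  have hdet : (Matrix.diagonal l).det ≠ 0 := by
    rw [Matrix.det_diagonal]; exact (Finset.prod_pos fun k _ => hl k).ne'
  have h := Real.map_matrix_volume_pi_eq_smul_volume_pi hdet
  have h2 := congrArg (fun μ : Measure _ => μ (Sx (fun _ : Fin (m + 3) => (1 : ℝ)))) h
  simp only [Measure.smul_apply, smul_eq_mul] at h2
  rw [Measure.map_apply (LinearMap.continuous_on_pi _).measurable (meas_Sx _)] at h2
  rw [Matrix.det_diagonal, ← Finset.prod_inv_distrib,
    abs_of_pos (Finset.prod_pos fun k _ => inv_pos.2 (hl k))] at h2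
  rw [kap, ← h2]
  congr 1
  ext y
  simp only [Sx, Set.mem_ofPred_eq, Set.mem_preimage, Matrix.toLin'_apply, Matrix.mulVec_diagonal,
    one_mul]
  constructor
  · rintro ⟨a, b⟩; exact ⟨fun k => mul_pos (hl k) (a k), b⟩
  · rintro ⟨a, b⟩; exact ⟨fun k => (mul_pos_iff_of_pos_left (hl k)).1 (a k), b⟩

lemma St.vol (s : St m) : volume (Sx s.l) = ENNReal.ofReal s.W * kap m := vol_Sx _ s.l_pos

lemma cov_bound {G : St m → Prop} {w : (Fin (m + 3) → ℝ) → ENNReal} (hw : Measurable w)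
    (B : St m → ENNReal) (hB : ∀ s, B s ≤ B s.stay + B s.move)
    (hB1 : ∀ s, B s ≤ kap m * ENNReal.ofReal s.W) (K η : ENNReal)
    (hG : ∀ s, G s → B s ≤ K * (II w s + ENNReal.ofReal s.W * η))
    {s : St m} {p : ℝ} (h : Cov G s p) :
    B s ≤ K * (II w s + ENNReal.ofReal s.W * η) + kap m * ENNReal.ofReal (s.W - p) := by
  induction h with
  | leaf s p hg hp => exact (hG s hg).trans le_self_add
  | bad s p hp =>
    refine (hB1 s).trans (le_trans ?_ le_add_self)
    gcongr; linarith
  | split s p q h1 h2 i1 i2 =>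
    refine (hB s).trans ((add_le_add i1 i2).trans (le_of_eq ?_))
    have e1 : s.W - (p + q) = (s.stay.W - p) + (s.move.W - q) := by rw [s.W_split]; ring
    rw [e1, ENNReal.ofReal_add (sub_nonneg.2 h1.le) (sub_nonneg.2 h2.le), II_split hw s,
      s.W_split, ENNReal.ofReal_add s.stay.W_pos.le s.move.W_pos.le]
    ring

/-- invariance of the slices. -/
structure AInv (a : Fin (m + 3) → Set (Fin (m + 3) → ℝ)) : Prop where
  meas : ∀ i, MeasurableSet (a i)
  stay : ∀ i y, (∀ k, 0 < y k) → (Ad i (i + 1) y ∈ a i ↔ y ∈ a i)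
  move : ∀ i y, (∀ k, 0 < y k) → (Ad (i + 1) i y ∈ a i ↔ y ∈ a (i + 1))

lemma Ad_pos (i j : Fin (m + 3)) {y : Fin (m + 3) → ℝ} (h : ∀ k, 0 < y k) : ∀ k, 0 < Ad i j y k := by
  intro k
  by_cases hk : k = i
  · subst hk; rw [Ad_self]; exact add_pos (h _) (h _)
  · rw [Ad_ne _ _ _ hk]; exact h k

def Rel (a : Fin (m + 3) → Set (Fin (m + 3) → ℝ)) (i0 : Fin (m + 3)) (s : St m) : Prop :=
  ∀ y, (∀ k, 0 < y k) → (s.app y ∈ a i0 ↔ y ∈ a s.lab)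

lemma Rel.stay {a : Fin (m + 3) → Set (Fin (m + 3) → ℝ)} (ha : AInv a) {i0} (s : St m)
    (h : Rel a i0 s) : Rel a i0 s.stay := by
  intro y hy
  rw [s.app_stay, h _ (Ad_pos _ _ hy)]
  exact ha.stay _ _ hy

lemma Rel.move {a : Fin (m + 3) → Set (Fin (m + 3) → ℝ)} (ha : AInv a) {i0} (s : St m)
    (h : Rel a i0 s) : Rel a i0 s.move := by
  intro y hy
  rw [s.app_move, h _ (Ad_pos _ _ hy)]
  exact ha.move _ _ hy

lemma root_app (i0 : Fin (m + 3)) (y) : (root i0).app y = y := by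
  funext c; simp [St.app, root, Pi.single_apply]

lemma Rel.root (a : Fin (m + 3) → Set (Fin (m + 3) → ℝ)) (i0) : Rel a i0 (root i0) := by
  intro y _; rw [root_app]; rfl

def Good (a : Fin (m + 3) → Set (Fin (m + 3) → ℝ)) (i0 : Fin (m + 3)) (δ : ℝ) (s : St m) : Prop :=
  (s.lab = i0 ∧ Bal s ∧ Wid δ s) ∧ Rel a i0 s

lemma cover_good {a : Fin (m + 3) → Set (Fin (m + 3) → ℝ)} (ha : AInv a) (i0 : Fin (m + 3))
    {δ ε : ℝ} (hδ : 0 < δ) (hε : 0 < ε) (hε1 : ε ≤ 1) : Cov (Good a i0 δ) (root i0) (1 - ε) :=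
  Cov.withInv (I := Rel a i0) (fun s h => h.stay ha s) (fun s h => h.move ha s)
    (cover i0 hδ hε hε1) (Rel.root a i0)

end CycAlg

namespace CycAlg
variable {m : ℕ}

/-- indicator as a real function -/
noncomputable def chi (S : Set (Fin (m + 3) → ℝ)) (y : Fin (m + 3) → ℝ) : ℝ :=
  S.indicator (fun _ => 1) y

lemma chi_meas {S : Set (Fin (m + 3) → ℝ)} (hS : MeasurableSet S) : Measurable (chi S) :=
  measurable_const.indicator hS

lemma chi_congr {S T : Set (Fin (m + 3) → ℝ)} {x y} (h : x ∈ S ↔ y ∈ T) : chi S x = chi T y := by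
  by_cases hx : x ∈ S
  · simp [chi, hx, h.1 hx]
  · have : y ∉ T := fun hy => hx (h.2 hy)
    simp [chi, hx, this]

/-- Quasi-invariance of volume. -/
def Quasi (T : (Fin (m + 3) → ℝ) → (Fin (m + 3) → ℝ)) (K : ENNReal) : Prop :=
  Measurable T ∧ ∀ H : (Fin (m + 3) → ℝ) → ENNReal, Measurable H → ∫⁻ y, H (T y) ≤ K * ∫⁻ y, H y

lemma Quasi.comp {T T' : (Fin (m + 3) → ℝ) → (Fin (m + 3) → ℝ)} {K K' : ENNReal}
    (h : Quasi T K) (h' : Quasi T' K') : Quasi (fun y => T (T' y)) (K' * K) := by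
  refine ⟨h.1.comp h'.1, fun H hH => ?_⟩
  refine (h'.2 (fun y => H (T y)) (hH.comp h.1)).trans ?_
  rw [mul_assoc]
  gcongr
  exact h.2 H hH

lemma Quasi.mono {T : (Fin (m + 3) → ℝ) → (Fin (m + 3) → ℝ)} {K K' : ENNReal}
    (h : Quasi T K) (hK : K ≤ K') : Quasi T K' :=
  ⟨h.1, fun H hH => (h.2 H hH).trans (by gcongr)⟩

lemma Quasi.id : Quasi (fun y : Fin (m + 3) → ℝ => y) 1 :=
  ⟨measurable_id, fun H _ => by rw [one_mul]⟩

lemma Quasi.U (k : Fin (m + 3)) (a : Fin (m + 3) → ℝ) (ha : a k ≠ 0) :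
    Quasi (U k a) (ENNReal.ofReal |(a k)⁻¹|) :=
  ⟨U_meas k a, fun H hH => (U_lint k a ha hH).le⟩

lemma Quasi.smul (r : ℝ) (hr : r ≠ 0) :
    Quasi (fun y : Fin (m + 3) → ℝ => r • y) (ENNReal.ofReal |(r ^ (m + 3))⁻¹|) :=
  ⟨measurable_const_smul r, fun H hH => (smul_lint r hr hH).le⟩

lemma Quasi.Ad (i j : Fin (m + 3)) (h : i ≠ j) : Quasi (Ad i j) 1 :=
  ⟨Ad_meas i j, fun H hH => by rw [Ad_lint i j h hH, one_mul]⟩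

lemma sum_upd (l y : Fin (m + 3) → ℝ) (i : Fin (m + 3)) (v : ℝ) :
    ∑ k, l k * Function.update y i v k = ∑ k, l k * y k + l i * (v - y i) := by
  have : ∀ k, l k * Function.update y i v k = l k * y k + if k = i then l i * (v - y i) else 0 := by
    intro k
    by_cases h : k = i
    · subst h; simp; ring
    · simp [h]
  simp_rw [this, Finset.sum_add_distrib]
  simp

lemma sum_upd' (l y : Fin (m + 3) → ℝ) (i : Fin (m + 3)) (v : ℝ) :
    ∑ k, Function.update l i v k * y k = ∑ k, l k * y k + (v - l i) * y i := by
  have := sum_upd y l i v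
  simp only [mul_comm (y _)] at this
  rw [this]

lemma L_pos (l y : Fin (m + 3) → ℝ) (hl : ∀ k, 0 < l k) (hy : ∀ k, 0 < y k) (n : Fin (m + 3)) :
    l n * y n < ∑ k, l k * y k := by
  have h : ∑ k, l k * y k = l n * y n + ∑ k ∈ Finset.univ.erase n, l k * y k :=
    (Finset.add_sum_erase _ _ (Finset.mem_univ n)).symm
  have : 0 < ∑ k ∈ Finset.univ.erase n, l k * y k := by
    apply Finset.sum_pos (fun k _ => mul_pos (hl k) (hy k))
    exact ⟨n + 1, by simp [succ_ne]⟩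
  linarith

/-- shear -/
def Sh (i j : Fin (m + 3)) (t : ℝ) (y : Fin (m + 3) → ℝ) : Fin (m + 3) → ℝ :=
  Function.update y i (y i + t * y j)

lemma Quasi.Sh (i j : Fin (m + 3)) (h : i ≠ j) (t : ℝ) : Quasi (Sh i j t) 1 := by
  have e : CycAlg.Sh i j t = CycAlg.U i (Pi.single i 1 + Pi.single j t) := by
    funext y
    simp [CycAlg.Sh, CycAlg.U, add_mul, Finset.sum_add_distrib, Pi.single_apply]
  rw [e]
  refine (Quasi.U i _ ?_).mono ?_ <;> simp [h]

noncomputable def Pm (j : Fin (m + 3)) (l : Fin (m + 3) → ℝ) (θ : ℝ) (y : Fin (m + 3) → ℝ) :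
    Fin (m + 3) → ℝ :=
  U (j + 1) (Pi.single (j + 1) θ) (Sh j (j + 1) ((1 - θ) * (l (j + 1) / l j)) y)

noncomputable def Qm (j : Fin (m + 3)) (l : Fin (m + 3) → ℝ) (θ : ℝ) (y : Fin (m + 3) → ℝ) :
    Fin (m + 3) → ℝ :=
  (1 - θ) • U (j + 1)
    (Function.update ((θ / (1 - θ) / l (j + 1)) • l) (j + 1)
      (-(θ / (1 - θ) * ((1 + l j / l (j + 1) * θ) / (1 - θ)))))
    (Sh j (j + 1) ((1 + l j / l (j + 1) * θ) / (1 - θ) * (l (j + 1) / l j)) y)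

lemma Quasi.Pm (j : Fin (m + 3)) (l : Fin (m + 3) → ℝ) (θ : ℝ) (h0 : 0 < θ) :
    Quasi (Pm j l θ) (ENNReal.ofReal θ⁻¹) := by
  refine ((Quasi.U (j + 1) (Pi.single (j + 1) θ) (by simpa using h0.ne')).comp
    (Quasi.Sh j (j + 1) (succ_ne j).symm _)).mono ?_
  rw [one_mul, Pi.single_eq_same, abs_of_pos (inv_pos.2 h0)]

lemma Quasi.Qm (j : Fin (m + 3)) (l : Fin (m + 3) → ℝ) (hl : ∀ k, 0 < l k) (θ : ℝ) (h0 : 0 < θ)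
    (h1 : θ ≤ 1 / 2) :
    Quasi (Qm j l θ) (ENNReal.ofReal (θ⁻¹ * 2 ^ (m + 3))) := by
  have h2 : 0 < 1 - θ := by linarith
  have hρ : 0 < l j / l (j + 1) * θ := mul_pos (div_pos (hl _) (hl _)) h0
  have hc : θ ≤ θ / (1 - θ) * ((1 + l j / l (j + 1) * θ) / (1 - θ)) := by
    have a1 : θ ≤ θ / (1 - θ) := by rw [le_div_iff₀ h2]; nlinarith
    have a2 : 1 ≤ (1 + l j / l (j + 1) * θ) / (1 - θ) := by rw [le_div_iff₀ h2]; linarith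
    nlinarith
  refine ((Quasi.smul (1 - θ) h2.ne').comp ((Quasi.U (j + 1) (Function.update ((θ / (1 - θ) / l (j + 1)) • l) (j + 1)
      (-(θ / (1 - θ) * ((1 + l j / l (j + 1) * θ) / (1 - θ))))) ?_).comp
    (Quasi.Sh j (j + 1) (succ_ne j).symm _))).mono ?_
  · simp only [Function.update_self]
    linarith
  · rw [one_mul, ← ENNReal.ofReal_mul (abs_nonneg _)]
    apply ENNReal.ofReal_le_ofReal
    simp only [Function.update_self]
    rw [inv_neg, abs_neg, abs_of_pos (inv_pos.2 (h0.trans_le hc)), abs_of_pos (by positivity)]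
    gcongr
    rw [← inv_pow]
    gcongr
    rw [inv_le_comm₀ h2 two_pos]
    linarith

/-- Facts about `Pm`. -/
lemma Pm_facts (j : Fin (m + 3)) (l : Fin (m + 3) → ℝ) (hl : ∀ k, 0 < l k) (θ : ℝ) (h0 : 0 < θ)
    (h1 : θ ≤ 1 / 2) (y : Fin (m + 3) → ℝ) (hy : ∀ k, 0 < y k) :
    (∀ k, 0 < Pm j l θ y k) ∧ (∑ k, l k * Pm j l θ y k = ∑ k, l k * y k) ∧
      Pm j l θ y (j + 1) = θ * y (j + 1) := by
  have hn := succ_ne j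
  have hj := hl j
  have hlj := hl (j + 1)
  have e : Sh j (j + 1) ((1 - θ) * (l (j + 1) / l j)) y (j + 1) = y (j + 1) := by
    simp [Sh, hn]
  have e1 : ∑ k, (Pi.single (j + 1) θ : Fin (m + 3) → ℝ) k *
      (Sh j (j + 1) ((1 - θ) * (l (j + 1) / l j)) y) k = θ * y (j + 1) := by
    simp [Pi.single_apply, e]
  have e2 : Pm j l θ y = Function.update (Sh j (j + 1) ((1 - θ) * (l (j + 1) / l j)) y) (j + 1)
      (θ * y (j + 1)) := by
    rw [Pm, U, e1]
  refine ⟨fun k => ?_, ?_, ?_⟩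
  · rw [e2]
    by_cases hk : k = j + 1
    · subst hk; simp; exact mul_pos h0 (hy _)
    · rw [Function.update_of_ne hk]
      by_cases hk' : k = j
      · subst hk'
        simp only [Sh, Function.update_self]
        have : 0 < 1 - θ := by linarith
        have := hy k
        have := hy (k + 1)
        positivity
      · simpa [Sh, hk'] using hy k
  · rw [e2, sum_upd, e, Sh, sum_upd]
    field_simp
    ring
  · rw [e2]; simp

lemma Qm_facts (j : Fin (m + 3)) (l : Fin (m + 3) → ℝ) (hl : ∀ k, 0 < l k) (θ : ℝ) (h0 : 0 < θ)
    (h1 : θ ≤ 1 / 2) (y : Fin (m + 3) → ℝ) (hy : ∀ k, 0 < y k) :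
    (∀ k, 0 < Qm j l θ y k) ∧
    (∑ k, l k * Qm j l θ y k = ∑ k, l k * y k + l j * θ * y (j + 1)) ∧
      Qm j l θ y (j + 1) = θ / l (j + 1) * (∑ k, l k * y k - l (j + 1) * y (j + 1)) := by
  have hn := succ_ne j
  have hj := hl j
  have hlj := hl (j + 1)
  have h2 : 0 < 1 - θ := by linarith
  have hL := L_pos l y hl hy (j + 1)
  set c := (1 + l j / l (j + 1) * θ) / (1 - θ) with hc
  have hc0 : 0 < c := by positivity
  have e : Sh j (j + 1) (c * (l (j + 1) / l j)) y (j + 1) = y (j + 1) := by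
    simp [Sh, hn]
  have e0 : ∑ k, l k * Sh j (j + 1) (c * (l (j + 1) / l j)) y k
      = ∑ k, l k * y k + c * l (j + 1) * y (j + 1) := by
    rw [Sh, sum_upd]; field_simp; ring
  have e1 : ∑ k, Function.update ((θ / (1 - θ) / l (j + 1)) • l) (j + 1)
      (-(θ / (1 - θ) * c)) k *
      (Sh j (j + 1) (c * (l (j + 1) / l j)) y) k
      = (1 - θ)⁻¹ * (θ / l (j + 1) * (∑ k, l k * y k - l (j + 1) * y (j + 1))) := by
    rw [sum_upd', e]
    simp only [Pi.smul_apply, smul_eq_mul, mul_assoc]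
    rw [← Finset.mul_sum, e0]
    field_simp
    ring
  have e2 : Qm j l θ y = (1 - θ) • Function.update (Sh j (j + 1) (c * (l (j + 1) / l j)) y) (j + 1)
      ((1 - θ)⁻¹ * (θ / l (j + 1) * (∑ k, l k * y k - l (j + 1) * y (j + 1)))) := by
    rw [← e1]; rfl
  have e3 : Qm j l θ y (j + 1) = θ / l (j + 1) * (∑ k, l k * y k - l (j + 1) * y (j + 1)) := by
    rw [e2]; simp; field_simp
  refine ⟨fun k => ?_, ?_, e3⟩
  · by_cases hk : k = j + 1
    · subst hk; rw [e3]; exact mul_pos (div_pos h0 hlj) (by linarith)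
    · rw [e2, Pi.smul_apply, Function.update_of_ne hk, smul_eq_mul]
      refine mul_pos h2 ?_
      by_cases hk' : k = j
      · subst hk'
        simp only [Sh, Function.update_self]
        have := hy k
        have := hy (k + 1)
        positivity
      · simpa [Sh, hk'] using hy k
  · rw [e2]
    simp only [Pi.smul_apply, smul_eq_mul]
    simp_rw [mul_left_comm (l _) (1 - θ)]
    rw [← Finset.mul_sum, sum_upd, e, e0, hc]
    field_simp
    ring

/-- constant -/
noncomputable def KA (m : ℕ) (θ : ℝ) : ENNReal :=
  1 + ENNReal.ofReal θ⁻¹ + ENNReal.ofReal θ⁻¹ + ENNReal.ofReal (θ⁻¹ * 2 ^ (m + 3)) +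
    ENNReal.ofReal (θ⁻¹ * 2 ^ (m + 3)) + 1

lemma scaleA (l : Fin (m + 3) → ℝ) (hl : ∀ k, 0 < l k) (j : Fin (m + 3))
    (S : Set (Fin (m + 3) → ℝ)) (hS : MeasurableSet S)
    (hinv : ∀ y, (∀ k, 0 < y k) → (Ad j (j + 1) y ∈ S ↔ y ∈ S)) (φ : ℝ → ℝ) (hφ : Measurable φ)
    (θ : ℝ) (h0 : 0 < θ) (h1 : θ ≤ 1 / 2) (lam : ℝ) (hlam : lam = 1 + l j / l (j + 1) * θ) :
    ∫⁻ y in Sx (lam • l), edist (chi S y) (chi S (lam • y)) ≤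
      KA m θ * ∫⁻ y in Sx l, edist (chi S y) (φ (∑ k, l k * y k)) := by
  have hj := hl j
  have hlj := hl (j + 1)
  have hlam1 : 1 ≤ lam := by
    have : 0 < l j / l (j + 1) * θ := by positivity
    linarith
  have hχ := chi_meas hS
  set F : (Fin (m + 3) → ℝ) → ENNReal :=
    (Sx l).indicator fun y => edist (chi S y) (φ (∑ k, l k * y k)) with hF
  have hFm : Measurable F := (hχ.edist (hφ.comp (meas_lin l))).indicator (meas_Sx l)
  have QP := Quasi.Pm j l θ h0
  have QSP := (Quasi.Ad j (j + 1) (succ_ne j).symm).comp QP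
  have QQ := Quasi.Qm j l hl θ h0 h1
  have QSQ := (Quasi.Ad j (j + 1) (succ_ne j).symm).comp QQ
  have QL : Quasi (fun y : Fin (m + 3) → ℝ => lam • y) 1 := by
    refine (Quasi.smul lam (by linarith)).mono ?_
    rw [← ENNReal.ofReal_one]
    apply ENNReal.ofReal_le_ofReal
    rw [abs_of_pos (by positivity)]
    exact inv_le_one_of_one_le₀ (one_le_pow₀ hlam1)
  rw [mul_one] at QSP QSQ
  have key : ∀ y ∈ Sx (lam • l), edist (chi S y) (chi S (lam • y)) ≤
      F y + F (Pm j l θ y) + F (Ad j (j + 1) (Pm j l θ y)) + F (Qm j l θ y)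
        + F (Ad j (j + 1) (Qm j l θ y)) + F (lam • y) := by
    rintro y ⟨hy, hy1⟩
    simp only [Pi.smul_apply, smul_eq_mul, mul_assoc] at hy1
    rw [← Finset.mul_sum] at hy1
    set t := ∑ k, l k * y k with ht
    have hL := L_pos l y hl hy (j + 1)
    rw [← ht] at hL
    have hb := hy (j + 1)
    have ht0 : 0 < t := lt_trans (mul_pos hlj hb) hL
    obtain ⟨p1, p2, p3⟩ := Pm_facts j l hl θ h0 h1 y hy
    obtain ⟨q1, q2, q3⟩ := Qm_facts j l hl θ h0 h1 y hy
    rw [← ht] at q2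
    have sp2 : ∑ k, l k * Ad j (j + 1) (Pm j l θ y) k = t + l j * θ * y (j + 1) := by
      rw [Ad, sum_upd, p2, p3]; ring
    have sq2 : ∑ k, l k * Ad j (j + 1) (Qm j l θ y) k = lam * t := by
      rw [Ad, sum_upd, q2, q3, hlam, ← ht]; field_simp; ring
    have l2 : ∑ k, l k * (lam • y) k = lam * t := by
      simp only [Pi.smul_apply, smul_eq_mul, mul_left_comm _ lam]
      rw [← Finset.mul_sum]
    have ht1 : t ≤ 1 := by nlinarith
    have hm : t + l j * θ * y (j + 1) ≤ 1 := by
      have : l j * θ * y (j + 1) ≤ l j / l (j + 1) * θ * t := by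
        have : l j * θ * y (j + 1) = l j / l (j + 1) * θ * (l (j + 1) * y (j + 1)) := by
          field_simp
        rw [this]
        gcongr
      rw [hlam] at hy1
      linarith
    have hFe : ∀ z, (∀ k, 0 < z k) → ∀ u, ∑ k, l k * z k = u → u ≤ 1 →
        F z = edist (chi S z) (φ u) := by
      intro z hz u hu hu1
      rw [hF, Set.indicator_of_mem, hu]
      exact ⟨hz, by rw [hu]; exact hu1⟩
    rw [hFe y hy t rfl ht1, hFe _ p1 t p2 ht1, hFe _ (Ad_pos _ _ p1) _ sp2 hm, hFe _ q1 _ q2 hm,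
      hFe _ (Ad_pos _ _ q1) _ sq2 hy1,
      hFe (lam • y) (fun k => mul_pos (by linarith) (hy k)) _ l2 hy1,
      chi_congr (hinv _ p1), chi_congr (hinv _ q1)]
    set X := chi S (Pm j l θ y)
    set Y := chi S (Qm j l θ y)
    set A := φ t
    set B := φ (t + l j * θ * y (j + 1))
    set C := φ (lam * t)
    calc edist (chi S y) (chi S (lam • y))
        ≤ edist (chi S y) C + edist C (chi S (lam • y)) := edist_triangle _ _ _
      _ ≤ (edist (chi S y) A + edist A X + edist X B + edist B Y + edist Y C)
            + edist C (chi S (lam • y)) := by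
          gcongr
          refine (edist_triangle4 _ A X _).trans ?_
          simp only [add_assoc]
          gcongr
          rw [← add_assoc]
          exact edist_triangle4 _ _ _ _
      _ = _ := by rw [edist_comm A X, edist_comm B Y, edist_comm C (chi S (lam • y))]
  calc ∫⁻ y in Sx (lam • l), edist (chi S y) (chi S (lam • y))
      ≤ ∫⁻ y in Sx (lam • l), (F y + F (Pm j l θ y) + F (Ad j (j + 1) (Pm j l θ y)) + F (Qm j l θ y)
        + F (Ad j (j + 1) (Qm j l θ y)) + F (lam • y)) :=
        setLIntegral_mono' (meas_Sx _) key
    _ ≤ ∫⁻ y, (F y + F (Pm j l θ y) + F (Ad j (j + 1) (Pm j l θ y)) + F (Qm j l θ y)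
        + F (Ad j (j + 1) (Qm j l θ y)) + F (lam • y)) := setLIntegral_le_lintegral _ _
    _ = (∫⁻ y, F y) + (∫⁻ y, F (Pm j l θ y)) + (∫⁻ y, F (Ad j (j + 1) (Pm j l θ y)))
        + (∫⁻ y, F (Qm j l θ y))
        + (∫⁻ y, F (Ad j (j + 1) (Qm j l θ y))) + ∫⁻ y, F (lam • y) := by
        have b1 : Measurable fun y => F (Pm j l θ y) := hFm.comp QP.1
        have b2 : Measurable fun y => F (Ad j (j + 1) (Pm j l θ y)) := hFm.comp QSP.1
        have b3 : Measurable fun y => F (Qm j l θ y) := hFm.comp QQ.1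
        have b4 : Measurable fun y => F (Ad j (j + 1) (Qm j l θ y)) := hFm.comp QSQ.1
        have b5 : Measurable fun y => F (lam • y) := hFm.comp QL.1
        rw [lintegral_add_right _ b5, lintegral_add_right _ b4,
          lintegral_add_right _ b3, lintegral_add_right _ b2, lintegral_add_right _ b1]
    _ ≤ KA m θ * ∫⁻ y, F y := by
        have a0 := Quasi.id.2 F hFm
        have a1 := QP.2 F hFm
        have a2 := QSP.2 F hFm
        have a3 := QQ.2 F hFm
        have a4 := QSQ.2 F hFm
        have a5 := QL.2 F hFm
        simp only [KA, add_mul]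
        gcongr
    _ = _ := by rw [hF, lintegral_indicator (meas_Sx l)]

end CycAlg

namespace CycAlg
variable {m : ℕ}

lemma app_smul (s : St m) (r : ℝ) (y) : s.app (r • y) = r • s.app y := by
  funext c
  simp [St.app, Finset.mul_sum, mul_assoc]

lemma app_h (s : St m) (y) : ∑ c, s.app y c = ∑ k, s.l k * y k := by
  simp only [St.app, St.l]
  rw [Finset.sum_comm]
  refine Finset.sum_congr rfl fun k _ => ?_
  rw [← Finset.mul_sum, mul_comm]

lemma app_close {δ : ℝ} (hδ : 0 ≤ δ) (s : St m) (hs : Wid δ s) (y) (hy : y ∈ Sx s.l) :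
    dist (s.app y) ((∑ k, s.l k * y k) • ((s.l 0)⁻¹ • s.M 0)) ≤ δ := by
  obtain ⟨lo, hi, hlh, hb⟩ := hs
  obtain ⟨hy0, hy1⟩ := hy
  rw [dist_pi_le_iff hδ]
  intro c
  set t := ∑ k, s.l k * y k with ht
  have ht0 : 0 < t := Finset.sum_pos (fun k _ => mul_pos (s.l_pos k) (hy0 k)) ⟨0, Finset.mem_univ _⟩
  have hM : ∀ k, lo c * s.l k ≤ s.M k c ∧ s.M k c ≤ hi c * s.l k := by
    intro k
    have := (hb k).2 c
    simpa [St.l] using this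
  have h1 : lo c * t ≤ s.app y c := by
    rw [ht, Finset.mul_sum, St.app]
    refine Finset.sum_le_sum fun k _ => ?_
    nlinarith [(hM k).1, hy0 k]
  have h2 : s.app y c ≤ hi c * t := by
    rw [ht, Finset.mul_sum, St.app]
    refine Finset.sum_le_sum fun k _ => ?_
    nlinarith [(hM k).2, hy0 k]
  have h3 : lo c ≤ (s.l 0)⁻¹ * s.M 0 c := by
    rw [inv_mul_eq_div, le_div_iff₀ (s.l_pos 0)]; exact (hM 0).1
  have h4 : (s.l 0)⁻¹ * s.M 0 c ≤ hi c := by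
    rw [inv_mul_eq_div, div_le_iff₀ (s.l_pos 0)]; exact (hM 0).2
  simp only [Pi.smul_apply, smul_eq_mul]
  have h5 : lo c * t ≤ t * ((s.l 0)⁻¹ * s.M 0 c) := by nlinarith
  have h6 : t * ((s.l 0)⁻¹ * s.M 0 c) ≤ hi c * t := by nlinarith
  have h7 : (hi c - lo c) * t ≤ δ := by
    have := hlh c
    nlinarith
  rw [Real.dist_eq, abs_le]
  constructor <;> linarith

lemma approx {a : Fin (m + 3) → Set (Fin (m + 3) → ℝ)} {i0 : Fin (m + 3)} {δ ε : ℝ} (hδ : 0 ≤ δ)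
    {s : St m} (hG : Good a i0 δ s) (g : (Fin (m + 3) → ℝ) → ℝ)
    (hg : ∀ x x', dist x x' ≤ δ → dist (g x) (g x') ≤ ε) :
    ∫⁻ y in Sx s.l, edist (chi (a i0) y) (g ((∑ k, s.l k * y k) • ((s.l 0)⁻¹ • s.M 0))) ≤
      II (fun x => edist (chi (a i0) x) (g x)) s + ENNReal.ofReal s.W * (kap m * ENNReal.ofReal ε) := by
  obtain ⟨⟨hlab, -, hw⟩, hrel⟩ := hG
  have h1 : ∀ y ∈ Sx s.l,
      edist (chi (a i0) y) (g ((∑ k, s.l k * y k) • ((s.l 0)⁻¹ • s.M 0))) ≤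
      edist (chi (a i0) (s.app y)) (g (s.app y)) + ENNReal.ofReal ε := by
    intro y hy
    have hr := hrel y hy.1
    rw [hlab] at hr
    rw [chi_congr hr]
    refine (edist_triangle _ (g (s.app y)) _).trans ?_
    gcongr
    rw [edist_dist]
    exact ENNReal.ofReal_le_ofReal (hg _ _ (app_close hδ s hw y hy))
  refine (setLIntegral_mono' (meas_Sx _) h1).trans ?_
  rw [lintegral_add_right _ measurable_const, setLIntegral_const, s.vol]
  unfold II
  exact le_of_eq (by ring)

lemma exists_g (S : Set (Fin (m + 3) → ℝ)) (hS : MeasurableSet S) {ε : ℝ} (hε : 0 < ε) :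
    ∃ g : (Fin (m + 3) → ℝ) → ℝ, Continuous g ∧
      (∃ δ : ℝ, 0 < δ ∧ ∀ x x', dist x x' ≤ δ → dist (g x) (g x') ≤ ε) ∧
      ∫⁻ x in Sx (fun _ : Fin (m + 3) => (1 : ℝ)), edist (chi S x) (g x) ≤ ENNReal.ofReal ε := by
  have hm := (meas_Sx (fun _ : Fin (m + 3) => (1 : ℝ))).inter hS
  have hI : Integrable ((Sx (fun _ : Fin (m + 3) => (1 : ℝ)) ∩ S).indicator (fun _ => (1 : ℝ))) := by
    rw [integrable_indicator_iff hm]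
    refine integrableOn_const ((measure_mono Set.inter_subset_left).trans_lt kap_lt).ne
  obtain ⟨g, g1, g2, g3, -⟩ := hI.exists_hasCompactSupport_lintegral_sub_le
    (ε := ENNReal.ofReal ε) (by simpa using hε)
  refine ⟨g, g3, ?_, ?_⟩
  · have hu := HasCompactSupport.uniformContinuous_of_continuous g1 g3
    obtain ⟨δ, hδ, h⟩ := Metric.uniformContinuous_iff.1 hu ε hε
    exact ⟨δ / 2, by positivity, fun x x' hx => (h (by linarith)).le⟩
  · refine le_trans ?_ g2
    refine le_trans ?_ (setLIntegral_le_lintegral (Sx fun _ => (1 : ℝ)) _)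
    refine setLIntegral_mono' (meas_Sx _) fun x hx => le_of_eq ?_
    rw [edist_eq_enorm_sub]
    congr 2
    by_cases h : x ∈ S <;> simp [chi, h, hx]

lemma engine {a : Fin (m + 3) → Set (Fin (m + 3) → ℝ)} (ha : AInv a) (i0 : Fin (m + 3))
    (B : St m → ENNReal) (hB : ∀ s, B s ≤ B s.stay + B s.move)
    (hB1 : ∀ s, B s ≤ kap m * ENNReal.ofReal s.W) (K : ENNReal) (hK : K ≠ ⊤)
    (hG : ∀ s, s.lab = i0 → Bal s → Rel a i0 s → ∀ φ : ℝ → ℝ, Measurable φ →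
      B s ≤ K * ∫⁻ y in Sx s.l, edist (chi (a i0) y) (φ (∑ k, s.l k * y k))) :
    B (root i0) = 0 := by
  set C : ENNReal := K * (1 + kap m) + kap m with hC
  have hCt : C ≠ ⊤ := by
    have := (kap_lt (m := m)).ne
    rw [hC]
    finiteness
  have main : ∀ ε : ℝ, 0 < ε → ε ≤ 1 → B (root i0) ≤ C * ENNReal.ofReal ε := by
    intro ε h0 h1
    obtain ⟨g, g1, ⟨δ, hδ, g2⟩, g3⟩ := exists_g (a i0) (ha.meas i0) h0
    have hw : Measurable fun x => edist (chi (a i0) x) (g x) :=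
      (chi_meas (ha.meas i0)).edist g1.measurable
    have := cov_bound hw B hB hB1 K (kap m * ENNReal.ofReal ε) (fun s hs => ?_)
      (cover_good ha i0 hδ h0 h1)
    · refine this.trans ?_
      have e1 : II (fun x => edist (chi (a i0) x) (g x)) (root i0) ≤ ENNReal.ofReal ε := by
        refine le_trans (le_of_eq ?_) g3
        unfold II
        simp only [root_app]
        congr 2
        congr 1
        funext k
        exact root_l i0 k
      rw [root_W]
      calc _ ≤ K * (ENNReal.ofReal ε + ENNReal.ofReal 1 * (kap m * ENNReal.ofReal ε)) +
          kap m * ENNReal.ofReal (1 - (1 - ε)) := by gcongr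
        _ = _ := by
          rw [ENNReal.ofReal_one, hC, show 1 - (1 - ε) = ε by ring]; ring
    · refine (hG s hs.1.1 hs.1.2.1 hs.2 (fun t => g (t • ((s.l 0)⁻¹ • s.M 0))) ?_).trans ?_
      · exact (g1.comp (continuous_id.smul continuous_const)).measurable
      · gcongr
        exact approx hδ.le hs g g2
  by_contra hne
  have hpos : 0 < B (root i0) := pos_iff_ne_zero.2 hne
  have hlim : Filter.Tendsto (fun ε : ℝ => C * ENNReal.ofReal ε) (nhdsWithin 0 (Set.Ioi 0))
      (nhds (C * ENNReal.ofReal 0)) := by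
    refine ENNReal.Tendsto.const_mul ?_ (Or.inr hCt)
    exact (ENNReal.continuous_ofReal.tendsto 0).mono_left nhdsWithin_le_nhds
  rw [ENNReal.ofReal_zero, mul_zero] at hlim
  have h1 : ∀ᶠ ε in nhdsWithin (0 : ℝ) (Set.Ioi 0), B (root i0) ≤ C * ENNReal.ofReal ε := by
    filter_upwards [Ioo_mem_nhdsGT (show (0 : ℝ) < 1 by norm_num)] with ε hε
    exact main ε hε.1 hε.2.le
  exact hne (le_antisymm (ge_of_tendsto hlim h1) (zero_le))

lemma chi_edist_le (S T : Set (Fin (m + 3) → ℝ)) (x y) : edist (chi S x) (chi T y) ≤ 1 := by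
  unfold chi
  by_cases h : x ∈ S <;> by_cases h' : y ∈ T <;> simp [h, h', edist_dist]

lemma KA_anti {θ θ' : ℝ} (h : 0 < θ) (h' : θ ≤ θ') : KA m θ' ≤ KA m θ := by
  have : θ'⁻¹ ≤ θ⁻¹ := inv_anti₀ h h'
  unfold KA
  gcongr

lemma KA_ne_top (θ : ℝ) : KA m θ ≠ ⊤ := by
  unfold KA; finiteness

lemma near {a : Fin (m + 3) → Set (Fin (m + 3) → ℝ)} (ha : AInv a) (i0 : Fin (m + 3)) (lam : ℝ)
    (h1 : 1 < lam) (h2 : lam ≤ 1 + 1 / (2 * CC m)) :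
    ∀ᵐ y : Fin (m + 3) → ℝ, (∀ k, 0 < y k) → lam * ∑ k, y k ≤ 1 → (y ∈ a i0 ↔ lam • y ∈ a i0) := by
  have hCC := CC_ge (m := m)
  have hχ := chi_meas (ha.meas i0)
  have hχ2 : Measurable fun y : Fin (m + 3) → ℝ => chi (a i0) (lam • y) :=
    hχ.comp (measurable_const_smul lam)
  have hsum : Measurable fun y : Fin (m + 3) → ℝ => lam * ∑ k, y k :=
    (Finset.measurable_sum _ fun k _ => measurable_pi_apply k).const_mul _
  have hset : MeasurableSet {y : Fin (m + 3) → ℝ | lam * ∑ k, y k ≤ 1} :=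
    measurableSet_le hsum measurable_const
  set b : (Fin (m + 3) → ℝ) → ENNReal := {y : Fin (m + 3) → ℝ | lam * ∑ k, y k ≤ 1}.indicator
    fun y => edist (chi (a i0) y) (chi (a i0) (lam • y)) with hb
  have hbm : Measurable b := (hχ.edist hχ2).indicator hset
  have hb1 : ∀ x, b x ≤ 1 := by
    intro x
    by_cases h : x ∈ {y : Fin (m + 3) → ℝ | lam * ∑ k, y k ≤ 1}
    · rw [hb, Set.indicator_of_mem h]; exact chi_edist_le _ _ _ _
    · rw [hb, Set.indicator_of_notMem h]; exact zero_le
  have key := engine ha i0 (II b) (fun s => (II_split hbm s).le) ?_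
    (KA m ((lam - 1) / CC m)) (KA_ne_top _) ?_
  · unfold II at key
    simp only [root_app] at key
    rw [setLIntegral_eq_zero_iff' (meas_Sx _) hbm.aemeasurable] at key
    filter_upwards [key] with y hy hpos hle
    have : y ∈ Sx (root i0).l := by
      refine ⟨hpos, ?_⟩
      simp only [root_l, one_mul]
      have : 0 ≤ ∑ k, y k := Finset.sum_nonneg fun k _ => (hpos k).le
      nlinarith
    have h := hy this
    rw [hb, Set.indicator_of_mem (show y ∈ {y : Fin (m + 3) → ℝ | lam * ∑ k, y k ≤ 1} from hle)] at h
    simp only [edist_eq_zero] at h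
    unfold chi at h
    by_cases c1 : y ∈ a i0 <;> by_cases c2 : lam • y ∈ a i0 <;> simp [c1, c2] at h ⊢
  · intro s
    unfold II
    refine (lintegral_mono fun y => hb1 _).trans ?_
    rw [setLIntegral_const, s.vol, one_mul, mul_comm]
  · intro s hlab hbal hrel φ hφ
    have p1 := s.l_pos i0
    have p2 := s.l_pos (i0 + 1)
    have q1 := hbal i0 (i0 + 1)
    have q2 := hbal (i0 + 1) i0
    set θ := (lam - 1) / (s.l i0 / s.l (i0 + 1)) with hθ
    have hρ : 0 < s.l i0 / s.l (i0 + 1) := div_pos p1 p2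
    have hρ1 : s.l i0 / s.l (i0 + 1) ≤ CC m := by rw [div_le_iff₀ p2]; exact q1
    have hρ2 : (CC m)⁻¹ ≤ s.l i0 / s.l (i0 + 1) := by
      rw [le_div_iff₀ p2, inv_mul_le_iff₀ (by linarith)]; exact q2
    have ht1 : (lam - 1) / CC m ≤ θ := by
      rw [hθ]; gcongr
    have hl0 : 0 < (lam - 1) / CC m := div_pos (by linarith) (by linarith)
    have ht2 : θ ≤ 1 / 2 := by
      rw [hθ, div_le_iff₀ hρ]
      have e : 1 / (2 * CC m) = 1 / 2 * (CC m)⁻¹ := by field_simp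
      rw [e] at h2
      linarith
    have hA := scaleA s.l s.l_pos i0 (a i0) (ha.meas i0) (ha.stay i0) φ hφ θ (hl0.trans_le ht1) ht2
      lam (by rw [hθ]; field_simp; try ring)
    refine le_trans ?_ (hA.trans (mul_le_mul_left (KA_anti hl0 ht1) _))
    unfold II
    rw [← lintegral_indicator (meas_Sx (lam • s.l))]
    refine le_trans ?_ (setLIntegral_le_lintegral (Sx s.l) _)
    refine setLIntegral_mono' (meas_Sx _) fun y hy => ?_
    by_cases h : s.app y ∈ {y : Fin (m + 3) → ℝ | lam * ∑ k, y k ≤ 1}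
    · rw [hb, Set.indicator_of_mem h]
      simp only [Set.mem_ofPred_eq, app_h] at h
      rw [Set.indicator_of_mem]
      · have r1 := hrel y hy.1
        have r2 := hrel (lam • y) (fun k => mul_pos (by linarith) (hy.1 k))
        rw [hlab] at r1 r2
        rw [← app_smul, chi_congr r1, chi_congr r2]
      · refine ⟨hy.1, ?_⟩
        simp only [Pi.smul_apply, smul_eq_mul, mul_assoc]
        rwa [← Finset.mul_sum]
    · rw [hb, Set.indicator_of_notMem h]; exact zero_le

end CycAlg

namespace CycAlg
variable {m : ℕ}

lemma ae_smul {p : (Fin (m + 3) → ℝ) → Prop} (h : ∀ᵐ x, p x) {r : ℝ} (hr : r ≠ 0) :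
    ∀ᵐ x, p (r • x) :=
  (Measure.quasiMeasurePreserving_smul volume hr).ae h

lemma Ad_smul (i j : Fin (m + 3)) (r : ℝ) (y) : Ad i j (r • y) = r • Ad i j y := by
  funext k
  by_cases h : k = i
  · subst h; simp [Ad, mul_add]
  · simp [Ad, h]

lemma AInv.scale {a : Fin (m + 3) → Set (Fin (m + 3) → ℝ)} (ha : AInv a) {R : ℝ} (hR : 0 < R) :
    AInv fun i => {x | R • x ∈ a i} where
  meas i := measurable_const_smul R (ha.meas i)
  stay i y hy := by
    simp only [Set.mem_ofPred_eq, ← Ad_smul]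
    exact ha.stay i _ fun k => mul_pos hR (hy k)
  move i y hy := by
    simp only [Set.mem_ofPred_eq, ← Ad_smul]
    exact ha.move i _ fun k => mul_pos hR (hy k)

/-- a.e. invariance under scaling by `lam`. -/
def ScInv (S : Set (Fin (m + 3) → ℝ)) (lam : ℝ) : Prop :=
  ∀ᵐ y : Fin (m + 3) → ℝ, (∀ k, 0 < y k) → (y ∈ S ↔ lam • y ∈ S)

lemma near_all {a : Fin (m + 3) → Set (Fin (m + 3) → ℝ)} (ha : AInv a) (i0 : Fin (m + 3)) (lam : ℝ)
    (h1 : 1 < lam) (h2 : lam ≤ 1 + 1 / (2 * CC m)) : ScInv (a i0) lam := by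
  have h : ∀ n : ℕ, ∀ᵐ y : Fin (m + 3) → ℝ, (∀ k, 0 < y k) → lam * ∑ k, y k ≤ (n + 1 : ℝ) →
      (y ∈ a i0 ↔ lam • y ∈ a i0) := by
    intro n
    have hn : (0 : ℝ) < n + 1 := by positivity
    have := ae_smul (near (ha.scale hn) i0 lam h1 h2) (inv_ne_zero hn.ne')
    filter_upwards [this] with y hy hpos hle
    have e : ∀ x : Fin (m + 3) → ℝ, ((n : ℝ) + 1) • (((n : ℝ) + 1)⁻¹ • x) = x := fun x => by
      rw [smul_smul, mul_inv_cancel₀ hn.ne', one_smul]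
    have := hy (fun k => mul_pos (inv_pos.2 hn) (hpos k)) ?_
    · change (((n : ℝ) + 1) • (((n : ℝ) + 1)⁻¹ • y) ∈ a i0 ↔
        ((n : ℝ) + 1) • lam • (((n : ℝ) + 1)⁻¹ • y) ∈ a i0) at this
      rwa [smul_comm lam, e, e] at this
    · simp only [Pi.smul_apply, smul_eq_mul]
      rw [← Finset.mul_sum, mul_left_comm, inv_mul_le_iff₀ hn, mul_one]
      exact hle
  rw [← ae_all_iff] at h
  filter_upwards [h] with y hy hpos
  obtain ⟨n, hn⟩ := exists_nat_ge (lam * ∑ k, y k)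
  exact hy n hpos (by linarith)

lemma ScInv.mul {S : Set (Fin (m + 3) → ℝ)} {r t : ℝ} (hr : 0 < r) (h1 : ScInv S r)
    (h2 : ScInv S t) : ScInv S (t * r) := by
  filter_upwards [h1, ae_smul h2 hr.ne'] with y a b hpos
  rw [a hpos, b fun k => mul_pos hr (hpos k), smul_smul]

lemma ScInv.inv {S : Set (Fin (m + 3) → ℝ)} {r : ℝ} (hr : 0 < r) (h1 : ScInv S r) :
    ScInv S r⁻¹ := by
  filter_upwards [ae_smul h1 (inv_ne_zero hr.ne')] with y a hpos
  rw [a fun k => mul_pos (inv_pos.2 hr) (hpos k), smul_smul, mul_inv_cancel₀ hr.ne', one_smul]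

lemma ScInv.one {S : Set (Fin (m + 3) → ℝ)} : ScInv S 1 :=
  Filter.Eventually.of_forall fun y _ => by rw [one_smul]

lemma scInv {a : Fin (m + 3) → Set (Fin (m + 3) → ℝ)} (ha : AInv a) (i0 : Fin (m + 3)) (lam : ℝ)
    (h0 : 0 < lam) : ScInv (a i0) lam := by
  have hCC := CC_ge (m := m)
  set L := 1 + 1 / (2 * CC m) with hL
  have hL1 : 1 < L := by
    have : 0 < 1 / (2 * CC m) := by positivity
    linarith
  have key : ∀ n : ℕ, ∀ lam : ℝ, 1 ≤ lam → lam ≤ L ^ n → ScInv (a i0) lam := by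
    intro n
    induction n with
    | zero =>
      intro lam h1 h2
      have : lam = 1 := le_antisymm (by simpa using h2) h1
      rw [this]; exact ScInv.one
    | succ n ih =>
      intro lam h1 h2
      by_cases hc : lam ≤ L
      · rcases h1.eq_or_lt with h | h
        · rw [← h]; exact ScInv.one
        · exact near_all ha i0 lam h hc
      · push Not at hc
        have : lam = (lam / L) * L := by field_simp
        rw [this]
        refine ScInv.mul (by linarith) (near_all ha i0 L hL1 le_rfl) (ih _ ?_ ?_)
        · rw [le_div_iff₀ (by linarith)]; linarith
        · rw [div_le_iff₀ (by linarith), ← pow_succ]; exact h2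
  have key2 : ∀ lam : ℝ, 1 ≤ lam → ScInv (a i0) lam := by
    intro lam h
    obtain ⟨n, hn⟩ := pow_unbounded_of_one_lt lam hL1
    exact key n lam h hn.le
  rcases le_total 1 lam with h | h
  · exact key2 lam h
  · have := (key2 lam⁻¹ ((one_le_inv₀ h0).2 h)).inv (inv_pos.2 h0)
    rwa [inv_inv] at this

/-- homogeneous sets. -/
def Hom (S : Set (Fin (m + 3) → ℝ)) : Prop :=
  MeasurableSet S ∧ (∀ y ∈ S, ∀ k, 0 < y k) ∧ ∀ r : ℝ, 0 < r → ∀ᵐ y, y ∈ S ↔ r • y ∈ S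

lemma pos_smul {r : ℝ} (hr : 0 < r) (y : Fin (m + 3) → ℝ) :
    (∀ k, 0 < (r • y) k) ↔ ∀ k, 0 < y k :=
  forall_congr' fun k => by simp [hr]

lemma Hom1 {S : Set (Fin (m + 3) → ℝ)} (hS : MeasurableSet S)
    (h : ∀ r, 0 < r → ScInv S r) : Hom (S ∩ {y | ∀ k, 0 < y k}) := by
  refine ⟨hS.inter meas_pos, fun y hy => hy.2, fun r hr => ?_⟩
  filter_upwards [h r hr] with y hy
  simp only [Set.mem_inter_iff, Set.mem_ofPred_eq, pos_smul hr]
  constructor <;> rintro ⟨a, b⟩ <;> [exact ⟨(hy b).1 a, b⟩; exact ⟨(hy b).2 a, b⟩]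

lemma ScInv.compl {S : Set (Fin (m + 3) → ℝ)} {r : ℝ} (h : ScInv S r) : ScInv Sᶜ r := by
  filter_upwards [h] with y hy hpos
  simp only [Set.mem_compl_iff, hy hpos]

/-- truncated volume -/
noncomputable def VV (S : Set (Fin (m + 3) → ℝ)) (l : Fin (m + 3) → ℝ) (t : ℝ) : ENNReal :=
  volume (S ∩ {y | ∑ k, l k * y k ≤ t})

lemma meas_le (l : Fin (m + 3) → ℝ) (t : ℝ) :
    MeasurableSet {y : Fin (m + 3) → ℝ | ∑ k, l k * y k ≤ t} :=
  measurableSet_le (meas_lin l) measurable_const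

lemma sum_smul (l : Fin (m + 3) → ℝ) (r : ℝ) (y : Fin (m + 3) → ℝ) : ∑ k, l k * (r • y) k = r * ∑ k, l k * y k := by
  simp only [Pi.smul_apply, smul_eq_mul, mul_left_comm _ r]
  rw [← Finset.mul_sum]

lemma VV_scale {S : Set (Fin (m + 3) → ℝ)} (hS : Hom S) (l : Fin (m + 3) → ℝ) {t : ℝ} (ht : 0 < t) :
    VV S l t = ENNReal.ofReal (t ^ (m + 3)) * VV S l 1 := by
  have hm : MeasurableSet (S ∩ {y | ∑ k, l k * y k ≤ t}) := hS.1.inter (meas_le l t)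
  have hm1 : MeasurableSet (S ∩ {y | ∑ k, l k * y k ≤ 1}) := hS.1.inter (meas_le l 1)
  have h := smul_lint (m := m) t ht.ne' (H := (S ∩ {y | ∑ k, l k * y k ≤ t}).indicator 1)
    (measurable_one.indicator hm)
  rw [lintegral_indicator_one hm] at h
  have h2 : ∫⁻ y, (S ∩ {y | ∑ k, l k * y k ≤ t}).indicator (1 : (Fin (m + 3) → ℝ) → ENNReal) (t • y) = VV S l 1 := by
    rw [VV, ← lintegral_indicator_one hm1]
    apply lintegral_congr_ae
    filter_upwards [hS.2.2 t ht] with y hy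
    have : t • y ∈ S ∩ {y | ∑ k, l k * y k ≤ t} ↔ y ∈ S ∩ {y | ∑ k, l k * y k ≤ 1} := by
      simp only [Set.mem_inter_iff, Set.mem_ofPred_eq, sum_smul, ← hy, and_congr_right_iff]
      intro _
      constructor <;> intro h <;> nlinarith
    by_cases hc : y ∈ S ∩ {y | ∑ k, l k * y k ≤ 1}
    · rw [Set.indicator_of_mem hc, Set.indicator_of_mem (this.2 hc)]; rfl
    · rw [Set.indicator_of_notMem hc, Set.indicator_of_notMem (fun h => hc (this.1 h))]
  rw [h2] at h
  rw [h, abs_of_pos (by positivity), ← mul_assoc, ← ENNReal.ofReal_mul (by positivity),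
    mul_inv_cancel₀ (by positivity), ENNReal.ofReal_one, one_mul]
  rfl

lemma VV_nonpos {S : Set (Fin (m + 3) → ℝ)} (hS : Hom S) (l : Fin (m + 3) → ℝ) (hl : ∀ k, 0 < l k)
    {t : ℝ} (ht : t ≤ 0) : VV S l t = 0 := by
  rw [VV]
  convert measure_empty (μ := volume)
  ext y
  simp only [Set.mem_inter_iff, Set.mem_ofPred_eq, Set.mem_empty_iff_false, iff_false, not_and,
    not_le]
  intro hy
  refine ht.trans_lt ?_
  exact Finset.sum_pos (fun k _ => mul_pos (hl k) (hS.2.1 y hy k)) ⟨0, Finset.mem_univ _⟩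

/-- radial law -/
noncomputable def nu (S : Set (Fin (m + 3) → ℝ)) (l : Fin (m + 3) → ℝ) : Measure ℝ :=
  (volume.restrict (S ∩ {y | ∑ k, l k * y k ≤ 1})).map fun y => ∑ k, l k * y k

lemma nu_Iic {S : Set (Fin (m + 3) → ℝ)} (l : Fin (m + 3) → ℝ) (t : ℝ) :
    nu S l (Set.Iic t) = VV S l (min t 1) := by
  rw [nu, Measure.map_apply (meas_lin l) measurableSet_Iic,
    Measure.restrict_apply (meas_lin l measurableSet_Iic), VV]
  congr 1
  ext y
  simp only [Set.mem_inter_iff, Set.mem_preimage, Set.mem_Iic, Set.mem_ofPred_eq, le_min_iff]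
  tauto

lemma nu_univ {S : Set (Fin (m + 3) → ℝ)} (l : Fin (m + 3) → ℝ) :
    nu S l Set.univ = VV S l 1 := by
  rw [nu, Measure.map_apply (meas_lin l) MeasurableSet.univ]
  simp [VV]

lemma nu_prop {S T : Set (Fin (m + 3) → ℝ)} (hS : Hom S) (hT : Hom T) (l : Fin (m + 3) → ℝ)
    (hl : ∀ k, 0 < l k) (h1 : VV S l 1 ≠ ⊤) (h2 : VV T l 1 ≠ ⊤) :
    VV T l 1 • nu S l = VV S l 1 • nu T l := by
  haveI : IsFiniteMeasure (VV T l 1 • nu S l) := by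
    constructor
    rw [Measure.smul_apply, nu_univ, smul_eq_mul]
    exact (ENNReal.mul_ne_top h2 h1).lt_top
  refine Measure.ext_of_Iic _ _ fun t => ?_
  rw [Measure.smul_apply, Measure.smul_apply, nu_Iic, nu_Iic, smul_eq_mul, smul_eq_mul]
  rcases le_or_gt (min t 1) 0 with h | h
  · rw [VV_nonpos hS l hl h, VV_nonpos hT l hl h]; simp
  · rw [VV_scale hS l h, VV_scale hT l h]; ring

lemma Sx_eq (S : Set (Fin (m + 3) → ℝ)) (l : Fin (m + 3) → ℝ) :
    VV (S ∩ {y | ∀ k, 0 < y k}) l 1 = volume (Sx l ∩ S) := by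
  rw [VV]; congr 1; ext y; simp only [Sx, Set.mem_inter_iff, Set.mem_ofPred_eq]; tauto

lemma lower {S : Set (Fin (m + 3) → ℝ)} (hS : MeasurableSet S) (h : ∀ r, 0 < r → ScInv S r)
    (l : Fin (m + 3) → ℝ) (hl : ∀ k, 0 < l k) (φ : ℝ → ℝ) (hφ : Measurable φ) :
    volume (Sx l ∩ S) * volume (Sx l ∩ Sᶜ) ≤
      volume (Sx l) * ∫⁻ y in Sx l, edist (chi S y) (φ (∑ k, l k * y k)) := by
  have H1 := Hom1 hS h
  have H0 := Hom1 hS.compl fun r hr => (h r hr).compl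
  have hfin : volume (Sx l) ≠ ⊤ := by
    rw [vol_Sx l hl]
    exact ENNReal.mul_ne_top ENNReal.ofReal_ne_top kap_lt.ne
  have f1 : volume (Sx l ∩ S) ≠ ⊤ := ((measure_mono Set.inter_subset_left).trans_lt hfin.lt_top).ne
  have f0 : volume (Sx l ∩ Sᶜ) ≠ ⊤ := ((measure_mono Set.inter_subset_left).trans_lt hfin.lt_top).ne
  have hp := nu_prop H1 H0 l hl (by rwa [Sx_eq]) (by rwa [Sx_eq])
  rw [Sx_eq, Sx_eq] at hp
  set v1 := volume (Sx l ∩ S)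
  set v0 := volume (Sx l ∩ Sᶜ)
  have set1 : ∀ T : Set (Fin (m + 3) → ℝ),
      (T ∩ {y | ∀ k, 0 < y k}) ∩ {y | ∑ k, l k * y k ≤ 1} = Sx l ∩ T := by
    intro T; ext y; simp only [Sx, Set.mem_inter_iff, Set.mem_ofPred_eq]; tauto
  have hi : ∀ T : Set (Fin (m + 3) → ℝ), ∀ G : ℝ → ENNReal, Measurable G →
      ∫⁻ t, G t ∂(nu (T ∩ {y | ∀ k, 0 < y k}) l) = ∫⁻ y in Sx l ∩ T, G (∑ k, l k * y k) := by
    intro T G hG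
    rw [nu, lintegral_map hG (meas_lin l), set1]
  have g1 : Measurable fun t => edist (1 : ℝ) (φ t) := measurable_const.edist hφ
  have g0 : Measurable fun t => edist (0 : ℝ) (φ t) := measurable_const.edist hφ
  have X1 : ∫⁻ y in Sx l ∩ S, edist (chi S y) (φ (∑ k, l k * y k)) =
      ∫⁻ t, edist (1 : ℝ) (φ t) ∂(nu (S ∩ {y | ∀ k, 0 < y k}) l) := by
    rw [hi S _ g1]
    refine setLIntegral_congr_fun ((meas_Sx l).inter hS) fun y hy => ?_
    simp [chi, hy.2]
  have X0 : ∫⁻ y in Sx l ∩ Sᶜ, edist (chi S y) (φ (∑ k, l k * y k)) =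
      ∫⁻ t, edist (0 : ℝ) (φ t) ∂(nu (Sᶜ ∩ {y | ∀ k, 0 < y k}) l) := by
    rw [hi Sᶜ _ g0]
    refine setLIntegral_congr_fun ((meas_Sx l).inter hS.compl) fun y hy => ?_
    have : y ∉ S := hy.2
    simp [chi, this]
  have tot : ∫⁻ y in Sx l, edist (chi S y) (φ (∑ k, l k * y k)) =
      (∫⁻ y in Sx l ∩ S, edist (chi S y) (φ (∑ k, l k * y k))) +
      ∫⁻ y in Sx l ∩ Sᶜ, edist (chi S y) (φ (∑ k, l k * y k)) := by
    rw [← Set.diff_eq, lintegral_inter_add_diff _ _ hS]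
  have e1 : v0 * ∫⁻ t, edist (1 : ℝ) (φ t) ∂(nu (S ∩ {y | ∀ k, 0 < y k}) l) =
      v1 * ∫⁻ t, edist (1 : ℝ) (φ t) ∂(nu (Sᶜ ∩ {y | ∀ k, 0 < y k}) l) := by
    rw [← smul_eq_mul, ← smul_eq_mul, ← lintegral_smul_measure, ← lintegral_smul_measure, hp]
  have e2 : v0 ≤ (∫⁻ t, edist (1 : ℝ) (φ t) ∂(nu (Sᶜ ∩ {y | ∀ k, 0 < y k}) l)) +
      ∫⁻ t, edist (0 : ℝ) (φ t) ∂(nu (Sᶜ ∩ {y | ∀ k, 0 < y k}) l) := by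
    rw [← lintegral_add_left g1]
    have : v0 = ∫⁻ t, 1 ∂(nu (Sᶜ ∩ {y | ∀ k, 0 < y k}) l) := by
      rw [lintegral_one, nu_univ, Sx_eq]
    rw [this]
    refine lintegral_mono fun t => ?_
    calc (1 : ENNReal) = edist (1 : ℝ) 0 := by simp [edist_dist]
      _ ≤ edist (1 : ℝ) (φ t) + edist (φ t) 0 := edist_triangle _ _ _
      _ = _ := by rw [edist_comm (φ t)]
  rw [tot, X1, X0, mul_add]
  calc v1 * v0 ≤ v1 * ((∫⁻ t, edist (1 : ℝ) (φ t) ∂(nu (Sᶜ ∩ {y | ∀ k, 0 < y k}) l)) +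
      ∫⁻ t, edist (0 : ℝ) (φ t) ∂(nu (Sᶜ ∩ {y | ∀ k, 0 < y k}) l)) := by gcongr
    _ ≤ _ := by
      rw [mul_add, ← e1]
      gcongr
      · exact measure_mono Set.inter_subset_left
      · exact measure_mono Set.inter_subset_left

end CycAlg

namespace CycAlg
variable {m : ℕ}

lemma bal_lower {S : Set (Fin (m + 3) → ℝ)} (hS : Hom S) (s : St m) (hs : Bal s) :
    ENNReal.ofReal s.W * (ENNReal.ofReal (((CC m) ^ (m + 3))⁻¹) * VV S (fun _ => 1) 1) ≤
      VV S s.l 1 := by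
  have hCC := CC_ge (m := m)
  obtain ⟨k0, -, hk0⟩ := Finset.exists_max_image Finset.univ s.l ⟨0, Finset.mem_univ _⟩
  have hk := s.l_pos k0
  have h1 : VV S (fun _ => 1) (s.l k0)⁻¹ ≤ VV S s.l 1 := by
    refine measure_mono ?_
    rintro y ⟨hy, hy1⟩
    refine ⟨hy, ?_⟩
    simp only [Set.mem_ofPred_eq, one_mul] at hy1 ⊢
    calc ∑ k, s.l k * y k ≤ ∑ k, s.l k0 * y k := by
          refine Finset.sum_le_sum fun k hk' => ?_
          exact mul_le_mul_of_nonneg_right (hk0 k hk') (hS.2.1 y hy k).le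
      _ = s.l k0 * ∑ k, y k := by rw [Finset.mul_sum]
      _ ≤ s.l k0 * (s.l k0)⁻¹ := by gcongr
      _ = 1 := mul_inv_cancel₀ hk.ne'
  refine le_trans ?_ h1
  rw [VV_scale hS _ (inv_pos.2 hk), ← mul_assoc, ← ENNReal.ofReal_mul s.W_pos.le]
  gcongr
  have : s.W ≤ ∏ _k : Fin (m + 3), CC m * (s.l k0)⁻¹ := by
    refine Finset.prod_le_prod (fun k _ => (inv_pos.2 (s.l_pos k)).le) fun k _ => ?_
    rw [← div_eq_mul_inv, inv_le_comm₀ (s.l_pos k) (by positivity), inv_div,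
      div_le_iff₀ (by linarith), mul_comm]
    exact hs k0 k
  rw [Finset.prod_const, Finset.card_univ, Fintype.card_fin, mul_pow] at this
  rw [mul_inv_le_iff₀ (by positivity)]
  linarith

lemma hom_null {S : Set (Fin (m + 3) → ℝ)} (hS : Hom S) (h : VV S (fun _ => 1) 1 = 0) :
    volume S = 0 := by
  have : S ⊆ ⋃ n : ℕ, S ∩ {y | ∑ k, (fun _ => (1 : ℝ)) k * y k ≤ (n : ℝ) + 1} := by
    intro y hy
    obtain ⟨n, hn⟩ := exists_nat_ge (∑ k, (fun _ => (1 : ℝ)) k * y k)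
    exact Set.mem_iUnion.2 ⟨n, hy, hn.trans (by linarith)⟩
  refine measure_mono_null this (measure_iUnion_null fun n => ?_)
  have := VV_scale hS (fun _ => 1) (show (0 : ℝ) < (n : ℝ) + 1 by positivity)
  rw [h, mul_zero] at this
  exact this

lemma dichotomy {a : Fin (m + 3) → Set (Fin (m + 3) → ℝ)} (ha : AInv a) (i0 : Fin (m + 3)) :
    volume (a i0 ∩ {y | ∀ k, 0 < y k}) = 0 ∨ volume ((a i0)ᶜ ∩ {y | ∀ k, 0 < y k}) = 0 := by
  have hsc := scInv ha i0
  have H1 := Hom1 (ha.meas i0) hsc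
  have H0 := Hom1 (ha.meas i0).compl fun r hr => (hsc r hr).compl
  have hCC := CC_ge (m := m)
  set c := ENNReal.ofReal (((CC m) ^ (m + 3))⁻¹) with hc
  have hc0 : c ≠ 0 := by
    rw [hc]; simp only [ne_eq, ENNReal.ofReal_eq_zero, not_le]; positivity
  set m1 := VV (a i0 ∩ {y | ∀ k, 0 < y k}) (fun _ => 1) 1 with hm1
  set m0 := VV ((a i0)ᶜ ∩ {y | ∀ k, 0 < y k}) (fun _ => 1) 1 with hm0
  set D := min (kap m) ((c * m1) * (c * m0)) with hD
  have key := engine ha i0 (fun s => ENNReal.ofReal s.W * D) ?_ ?_ (kap m) kap_lt.ne ?_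
  · rw [root_W, ENNReal.ofReal_one, one_mul] at key
    have m1k : m1 ≤ kap m := by rw [hm1, Sx_eq]; exact measure_mono Set.inter_subset_left
    have : m1 = 0 ∨ m0 = 0 := by
      rcases min_choice (kap m) ((c * m1) * (c * m0)) with h | h
      · left
        rw [hD, h] at key
        rw [key] at m1k
        exact le_antisymm m1k zero_le
      · rw [hD, h] at key
        simpa [hc0] using key
    rcases this with h | h
    · exact Or.inl (hom_null H1 h)
    · exact Or.inr (hom_null H0 h)
  · intro s
    rw [s.W_split, ENNReal.ofReal_add s.stay.W_pos.le s.move.W_pos.le, add_mul]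
  · intro s
    change ENNReal.ofReal s.W * D ≤ _
    rw [mul_comm]
    gcongr
    exact min_le_left _ _
  · intro s _ hbal _ φ hφ
    have b1 := bal_lower H1 s hbal
    have b0 := bal_lower H0 s hbal
    rw [Sx_eq (a i0) s.l, ← hm1, ← hc] at b1
    rw [Sx_eq (a i0)ᶜ s.l, ← hm0, ← hc] at b0
    have hl := lower (ha.meas i0) hsc s.l s.l_pos φ hφ
    have hW0 : ENNReal.ofReal s.W ≠ 0 := by simpa using s.W_pos
    rw [s.vol] at hl
    have : ENNReal.ofReal s.W * (ENNReal.ofReal s.W * D) ≤ ENNReal.ofReal s.W *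
        (kap m * ∫⁻ y in Sx s.l, edist (chi (a i0) y) (φ (∑ k, s.l k * y k))) := by
      calc _ ≤ ENNReal.ofReal s.W * (ENNReal.ofReal s.W * ((c * m1) * (c * m0))) := by
            gcongr; exact min_le_right _ _
        _ = (ENNReal.ofReal s.W * (c * m1)) * (ENNReal.ofReal s.W * (c * m0)) := by ring
        _ ≤ _ := mul_le_mul' b1 b0
        _ ≤ _ := hl
        _ = _ := by ring
    exact (ENNReal.mul_le_mul_iff_right hW0 ENNReal.ofReal_ne_top).1 this

lemma pos_vol : volume {y : Fin (m + 3) → ℝ | ∀ k, 0 < y k} ≠ 0 := by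
  have : IsOpen {y : Fin (m + 3) → ℝ | ∀ k, 0 < y k} := by
    rw [Set.ofPred_forall]
    exact isOpen_iInter_of_finite fun k => isOpen_lt continuous_const (continuous_apply k)
  exact (this.measure_pos volume ⟨fun _ => 1, fun _ => one_pos⟩).ne'

lemma Ad_null (i j : Fin (m + 3)) (hij : i ≠ j) {N : Set (Fin (m + 3) → ℝ)} (hN : volume N = 0) :
    ∀ᵐ y, Ad i j y ∉ N := by
  have hq : Measure.QuasiMeasurePreserving (Ad (m := m) i j) volume volume := by
    refine ⟨Ad_meas i j, Measure.AbsolutelyContinuous.mk fun s hs h0 => ?_⟩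
    rw [Measure.map_apply (Ad_meas i j) hs]
    have := Ad_lint i j hij (H := s.indicator 1) (measurable_one.indicator hs)
    rw [lintegral_indicator_one hs, h0] at this
    rw [← lintegral_indicator_one (Ad_meas i j hs), ← this]
    rfl
  exact hq.ae (measure_eq_zero_iff_ae_notMem.1 hN)

lemma link {a : Fin (m + 3) → Set (Fin (m + 3) → ℝ)} (ha : AInv a) (i : Fin (m + 3))
    (h : volume (a (i + 1) ∩ {y | ∀ k, 0 < y k}) = 0) :
    volume (a i ∩ {y | ∀ k, 0 < y k}) = 0 := by
  rcases dichotomy ha i with h' | h'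
  · exact h'
  · exfalso
    apply pos_vol (m := m)
    have h1 := measure_eq_zero_iff_ae_notMem.1 h
    have h2 := Ad_null (i + 1) i (succ_ne i) h'
    refine measure_eq_zero_iff_ae_notMem.2 ?_
    filter_upwards [h1, h2] with y a1 a2 hy
    have hy' : ∀ k, 0 < y k := hy
    have : y ∉ a (i + 1) := fun hc => a1 ⟨hc, hy⟩
    apply a2
    exact ⟨fun hc => this ((ha.move i y hy').1 hc), Ad_pos _ _ hy'⟩

lemma all_null {a : Fin (m + 3) → Set (Fin (m + 3) → ℝ)} (ha : AInv a) (i : Fin (m + 3))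
    (h : volume (a i ∩ {y | ∀ k, 0 < y k}) = 0) (j : Fin (m + 3)) :
    volume (a j ∩ {y | ∀ k, 0 < y k}) = 0 := by
  have : ∀ n : ℕ, volume (a (i - (Fin.ofNat (m + 3) n)) ∩ {y | ∀ k, 0 < y k}) = 0 := by
    intro n
    induction n with
    | zero => 
      have : i - Fin.ofNat (m + 3) 0 = i := by
        have : (Fin.ofNat (m + 3) 0) = 0 := rfl
        rw [this, sub_zero]
      rw [this]; exact h
    | succ n ih =>
      apply link ha
      have : i - Fin.ofNat (m + 3) (n + 1) + 1 = i - Fin.ofNat (m + 3) n := by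
        have : Fin.ofNat (m + 3) (n + 1) = Fin.ofNat (m + 3) n + 1 := by
          ext; simp [Fin.val_add]
        rw [this]; abel
      rw [this]; exact ih
  have e := this (i - j).val
  have : Fin.ofNat (m + 3) (i - j).val = i - j := by
    ext; simp
  rw [this, sub_sub_cancel] at e
  exact e

lemma coord_null (i : Fin (m + 3)) :
    volume {y : Fin (m + 3) → ℝ | y i = 0} = 0 := by
  let p : Submodule ℝ (Fin (m + 3) → ℝ) :=
    LinearMap.ker (LinearMap.proj i : (Fin (m + 3) → ℝ) →ₗ[ℝ] ℝ)
  have hp : p ≠ ⊤ := by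
    intro h
    have : (Pi.single i 1 : Fin (m + 3) → ℝ) ∈ p := by rw [h]; trivial
    simp [p] at this
  have := Measure.addHaar_submodule volume p hp
  convert this using 2
  ext y
  simp [p]

lemma null_of_pos {N : Set (Fin (m + 3) → ℝ)} (hN : ∀ y ∈ N, ∀ k, 0 ≤ y k)
    (h : volume (N ∩ {y | ∀ k, 0 < y k}) = 0) : volume N = 0 := by
  have h1 : ∀ᵐ y : Fin (m + 3) → ℝ, ∀ i, y i ≠ 0 := by
    rw [ae_all_iff]
    intro i
    exact measure_eq_zero_iff_ae_notMem.1 (coord_null i)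
  refine measure_eq_zero_iff_ae_notMem.2 ?_
  filter_upwards [h1, measure_eq_zero_iff_ae_notMem.1 h] with y a1 a2 hy
  exact a2 ⟨hy, fun k => lt_of_le_of_ne (hN y hy k) (a1 k).symm⟩

end CycAlg

/-- For every `d ≥ 3`, the cyclic subtractive algorithm is ergodic with respect to the
measure assigning to a set the sum, over the `d` labels, of the `d`-dimensional Lebesgue
measure of its slices. -/
theorem cyclicAlg_ergodic (m : ℕ) (A : Set ((Fin (m + 3) → ℝ) × Fin (m + 3)))
    (hA : MeasurableSet A)
    (hsub : A ⊆ posConeD m ×ˢ (Set.univ : Set (Fin (m + 3))))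
    (hinv : {y ∈ posConeD m ×ˢ (Set.univ : Set (Fin (m + 3))) | cyclicAlg m y ∈ A} = A) :
    (∑ σ : Fin (m + 3), volume {x : Fin (m + 3) → ℝ | (x, σ) ∈ A}) = 0 ∨
      (∑ σ : Fin (m + 3), volume {x : Fin (m + 3) → ℝ |
        (x, σ) ∈ posConeD m ×ˢ (Set.univ : Set (Fin (m + 3))) \ A}) = 0 := by
  classical
  set a : Fin (m + 3) → Set (Fin (m + 3) → ℝ) := fun i => {x | (x, i) ∈ A} with ha
  have hmem : ∀ x i, (∀ k, 0 ≤ x k) → ((x, i) ∈ A ↔ cyclicAlg m (x, i) ∈ A) := by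
    intro x i hx
    constructor
    · intro h
      rw [← hinv] at h
      exact h.2
    · intro h
      rw [← hinv]
      exact ⟨⟨hx, Set.mem_univ _⟩, h⟩
  have hI : CycAlg.AInv a := by
    refine ⟨fun i => ?_, fun i y hy => ?_, fun i y hy => ?_⟩
    · exact measurable_prodMk_right hA
    · change (CycAlg.Ad i (i + 1) y, i) ∈ A ↔ (y, i) ∈ A
      rw [hmem _ _ fun k => (CycAlg.Ad_pos i (i + 1) hy k).le]
      have e : cyclicAlg m (CycAlg.Ad i (i + 1) y, i) = (y, i) := by
        have h1 := CycAlg.Ad_self i (i + 1) y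
        have h2 := CycAlg.Ad_ne i (i + 1) (i + 1) (CycAlg.succ_ne i) y
        have := hy i
        simp only [cyclicAlg, h1, h2]
        rw [if_pos (by linarith)]
        simp [CycAlg.Ad]
      rw [e]
    · change (CycAlg.Ad (i + 1) i y, i) ∈ A ↔ (y, i + 1) ∈ A
      rw [hmem _ _ fun k => (CycAlg.Ad_pos (i + 1) i hy k).le]
      have e : cyclicAlg m (CycAlg.Ad (i + 1) i y, i) = (y, i + 1) := by
        have h1 := CycAlg.Ad_self (i + 1) i y
        have h2 := CycAlg.Ad_ne (i + 1) i i (CycAlg.succ_ne i).symm y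
        have := hy (i + 1)
        simp only [cyclicAlg, h1, h2]
        rw [if_neg (by linarith)]
        simp [CycAlg.Ad]
      rw [e]
  by_cases hex : ∃ i, volume (a i ∩ {y | ∀ k, 0 < y k}) = 0
  · left
    obtain ⟨i, hi⟩ := hex
    refine Finset.sum_eq_zero fun j _ => ?_
    refine CycAlg.null_of_pos (fun y hy => ?_) (CycAlg.all_null hI i hi j)
    exact (hsub hy).1
  · right
    push Not at hex
    refine Finset.sum_eq_zero fun j _ => ?_
    have h0 := (CycAlg.dichotomy hI j).resolve_left (hex j)
    refine CycAlg.null_of_pos (fun y hy => ?_) (measure_mono_null ?_ h0)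
    · exact hy.1.1
    · rintro y ⟨hy, hp⟩
      exact ⟨hy.2, hp⟩
end
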